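/- Let (η, u) be a sufficiently smooth solution of (SSW) on [0,1]×[0,T] (it suffices that η, u ∈ C²([0,T]; C^r[0,1])). Let M be a positive integer, k = T/M, tⁿ = nk, Hⁿ = P(η(·,tⁿ)), Uⁿ = P₀(u(·,tⁿ)), and for 0 ≤ n ≤ M−1 define δ₁ⁿ := H^{n+1} − Hⁿ + kP(∂_x Uⁿ) + (k/2)P(∂_x(HⁿUⁿ)) and δ₂ⁿ := U^{n+1} − Uⁿ + kP₀(∂_x Hⁿ) + (k/2)P₀(Hⁿ ∂_x Hⁿ) + (3k/2)P₀(Uⁿ ∂_x Uⁿ). Then, for a fixed quasiuniformity constant γ, there exists a constant C, independent of the partition, k and M, such that for every quasiuniform partition with constant γ, max_{0≤n≤M−1} (‖δ₁ⁿ‖ + ‖δ₂ⁿ‖) ≤ C k (k + h^{r−1}). -/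

import Mathlib

noncomputable section
open Set

/-- The L²(0,1) inner product of two real functions. -/
def ip (f g : ℝ → ℝ) : ℝ := ∫ y in (0:ℝ)..1, f y * g y

/-- The L²(0,1) norm. -/
def nrm (f : ℝ → ℝ) : ℝ := Real.sqrt (∫ y in (0:ℝ)..1, (f y)^2)

/-- `g` is the L²(0,1)-orthogonal projection of `f` onto `S`. -/
def IsL2ProjOn (S : Set (ℝ → ℝ)) (f g : ℝ → ℝ) : Prop :=
  g ∈ S ∧ ∀ χ ∈ S, ip (fun y => f y - g y) χ = 0

/-- The space `S_h` of `C^k` piecewise polynomials of degree ≤ r-1 on the partition `x`. -/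
def Sh (N r k : ℕ) (x : ℕ → ℝ) : Set (ℝ → ℝ) :=
  {φ | ContDiffOn ℝ k φ (Icc (0:ℝ) 1) ∧
    ∀ j < N, ∃ p : Polynomial ℝ, p.natDegree ≤ r - 1 ∧
      ∀ y ∈ Icc (x j) (x (j+1)), φ y = Polynomial.eval y p}

/-- The subspace `S_{h,0}` of functions in `S_h` vanishing at 0 and 1. -/
def Sh0 (N r k : ℕ) (x : ℕ → ℝ) : Set (ℝ → ℝ) :=
  {φ | φ ∈ Sh N r k x ∧ φ 0 = 0 ∧ φ 1 = 0}

/-- `x 0 = 0 < x 1 < ⋯ < x N = 1` is a partition of `[0,1]`. -/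
def IsPartition (N : ℕ) (x : ℕ → ℝ) : Prop :=
  x 0 = 0 ∧ x N = 1 ∧ ∀ i < N, x i < x (i+1)

/-- `h` is the maximal meshlength of the partition `x`. -/
def IsMeshSize (N : ℕ) (x : ℕ → ℝ) (h : ℝ) : Prop :=
  (∀ i < N, x (i+1) - x i ≤ h) ∧ ∃ i < N, x (i+1) - x i = h

/-- The partition is quasiuniform with constant γ : `h ≤ γ · min meshlength`. -/
def QuasiUniform (N : ℕ) (x : ℕ → ℝ) (h γ : ℝ) : Prop :=
  ∀ i < N, h ≤ γ * (x (i+1) - x i)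

/-- `fs j` is the j-th time derivative of `fs 0` on `[0,1]×[0,T]` for `j ≤ m`,
each being r times continuously differentiable in space and jointly continuous:
an encoding of `fs 0 ∈ C^m([0,T]; C^r[0,1])`. -/
def SmoothChain (T : ℝ) (r m : ℕ) (fs : ℕ → ℝ → ℝ → ℝ) : Prop :=
  (∀ j < m, ∀ y ∈ Icc (0:ℝ) 1, ∀ t ∈ Icc (0:ℝ) T,
    HasDerivWithinAt (fun s => fs j y s) (fs (j+1) y t) (Icc (0:ℝ) T) t) ∧
  (∀ j ≤ m, ∀ t ∈ Icc (0:ℝ) T, ContDiffOn ℝ r (fun y => fs j y t) (Icc (0:ℝ) 1)) ∧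
  (∀ j ≤ m, ContinuousOn (fun p : ℝ × ℝ => fs j p.1 p.2) ((Icc (0:ℝ) 1) ×ˢ (Icc (0:ℝ) T)))

/-- `(η,u)` (with time derivatives `ηt`, `ut`) solves the symmetric shallow water
system on `[0,1]×[0,T]` with homogeneous boundary conditions for `u`. -/
def SSW (T : ℝ) (η u ηt ut : ℝ → ℝ → ℝ) : Prop :=
  (∀ y ∈ Icc (0:ℝ) 1, ∀ t ∈ Icc (0:ℝ) T,
    ηt y t + derivWithin (fun z => u z t) (Icc (0:ℝ) 1) y
      + (1/2) * derivWithin (fun z => η z t * u z t) (Icc (0:ℝ) 1) y = 0 ∧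
    ut y t + derivWithin (fun z => η z t) (Icc (0:ℝ) 1) y
      + (3/2) * (u y t * derivWithin (fun z => u z t) (Icc (0:ℝ) 1) y)
      + (1/2) * (η y t * derivWithin (fun z => η z t) (Icc (0:ℝ) 1) y) = 0) ∧
  (∀ t ∈ Icc (0:ℝ) T, u 0 t = 0 ∧ u 1 t = 0)

noncomputable section
open Set

namespace SW
open MeasureTheory
open intervalIntegral hiding integral_const_mul

/-- unit interval -/
abbrev I : Set ℝ := Icc (0:ℝ) 1

/-- `f'` is the continuous derivative of `f` on `[0,1]` -/
def D (f f' : ℝ → ℝ) : Prop :=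
  (∀ x ∈ I, HasDerivWithinAt f (f' x) I x) ∧ ContinuousOn f' I

lemma cii {f : ℝ → ℝ} (hf : ContinuousOn f I) : IntervalIntegrable f volume 0 1 := by
  apply ContinuousOn.intervalIntegrable
  rwa [uIcc_of_le zero_le_one]

namespace D
variable {f f' g g' : ℝ → ℝ}

lemma cont (h : D f f') : ContinuousOn f I := fun x hx => (h.1 x hx).continuousWithinAt
lemma cont' (h : D f f') : ContinuousOn f' I := h.2

lemma add (hf : D f f') (hg : D g g') : D (fun x => f x + g x) (fun x => f' x + g' x) :=
  ⟨fun x hx => (hf.1 x hx).add (hg.1 x hx), hf.2.add hg.2⟩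
lemma sub (hf : D f f') (hg : D g g') : D (fun x => f x - g x) (fun x => f' x - g' x) :=
  ⟨fun x hx => (hf.1 x hx).sub (hg.1 x hx), hf.2.sub hg.2⟩
lemma neg (hf : D f f') : D (fun x => - f x) (fun x => - f' x) :=
  ⟨fun x hx => (hf.1 x hx).neg, hf.2.neg⟩
lemma smul (c : ℝ) (hf : D f f') : D (fun x => c * f x) (fun x => c * f' x) :=
  ⟨fun x hx => (hf.1 x hx).const_mul c, continuousOn_const.mul hf.2⟩
lemma mul (hf : D f f') (hg : D g g') :
    D (fun x => f x * g x) (fun x => f' x * g x + f x * g' x) :=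
  ⟨fun x hx => (hf.1 x hx).mul (hg.1 x hx), (hf.2.mul hg.cont).add (hf.cont.mul hg.2)⟩
lemma const (c : ℝ) : D (fun _ => c) (fun _ => 0) :=
  ⟨fun x _ => hasDerivWithinAt_const x I c, continuousOn_const⟩
lemma congr (hf : D f f') (h1 : ∀ x ∈ I, g x = f x) (h2 : ∀ x ∈ I, g' x = f' x) : D g g' :=
  ⟨fun x hx => by
    rw [h2 x hx]; exact (hf.1 x hx).congr h1 (h1 x hx), hf.2.congr h2⟩
lemma congr' (hf : D f f') (h2 : ∀ x ∈ I, g' x = f' x) : D f g' :=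
  hf.congr (fun _ _ => rfl) h2

lemma hasDerivAt (hf : D f f') {x : ℝ} (hx : x ∈ Ioo (0:ℝ) 1) : HasDerivAt f (f' x) x :=
  (hf.1 x (Ioo_subset_Icc_self hx)).hasDerivAt (Icc_mem_nhds hx.1 hx.2)

lemma unique (h1 : D f f') (h2 : D f g') : ∀ x ∈ I, f' x = g' x := fun x hx =>
  (uniqueDiffOn_Icc zero_lt_one x hx).eq_deriv _ (h1.1 x hx) (h2.1 x hx)

lemma int_ab (hf : D f f') {a b : ℝ} (ha : a ∈ I) (hb : b ∈ I) :
    ∫ x in a..b, f' x = f b - f a := by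
  have key : ∀ a ∈ I, ∀ b ∈ I, a ≤ b → ∫ x in a..b, f' x = f b - f a := by
    intro a ha b hb hab
    have hs : Icc a b ⊆ I := Icc_subset_Icc ha.1 hb.2
    apply integral_eq_sub_of_hasDerivAt_of_le hab (hf.cont.mono hs)
    · intro x hx
      exact hf.hasDerivAt ⟨lt_of_le_of_lt ha.1 hx.1, lt_of_lt_of_le hx.2 hb.2⟩
    · apply ContinuousOn.intervalIntegrable
      rw [uIcc_of_le hab]; exact hf.2.mono hs
  rcases le_total a b with h | h
  · exact key a ha b hb h
  · rw [integral_symm, key b hb a ha h]; ring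

lemma int (hf : D f f') : ∫ x in (0:ℝ)..1, f' x = f 1 - f 0 :=
  hf.int_ab (by constructor <;> norm_num) (by constructor <;> norm_num)

end D

lemma zero_mem : (0:ℝ) ∈ I := by constructor <;> norm_num
lemma one_mem : (1:ℝ) ∈ I := by constructor <;> norm_num

lemma int_congr {f g : ℝ → ℝ} (h : ∀ x ∈ I, f x = g x) :
    ∫ x in (0:ℝ)..1, f x = ∫ x in (0:ℝ)..1, g x := by
  apply integral_congr; rw [uIcc_of_le zero_le_one]; exact h

lemma int_mono {f g : ℝ → ℝ} (hf : ContinuousOn f I) (hg : ContinuousOn g I)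
    (h : ∀ x ∈ I, f x ≤ g x) :
    ∫ x in (0:ℝ)..1, f x ≤ ∫ x in (0:ℝ)..1, g x :=
  integral_mono_on zero_le_one (cii hf) (cii hg) h

lemma int_nonneg {f : ℝ → ℝ} (h : ∀ x ∈ I, 0 ≤ f x) : 0 ≤ ∫ x in (0:ℝ)..1, f x :=
  integral_nonneg zero_le_one h

lemma int_abs_le {f g : ℝ → ℝ} (hf : ContinuousOn f I) (hg : ContinuousOn g I)
    (h : ∀ x ∈ I, |f x| ≤ g x) : |∫ x in (0:ℝ)..1, f x| ≤ ∫ x in (0:ℝ)..1, g x := by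
  refine (abs_integral_le_integral_abs zero_le_one).trans (int_mono hf.abs hg h)

/-- Cauchy-Schwarz, general integrability. -/
lemma cs_gen {f g : ℝ → ℝ} (h1 : IntervalIntegrable (fun x => f x ^ 2) volume 0 1)
    (h2 : IntervalIntegrable (fun x => g x ^ 2) volume 0 1)
    (h3 : IntervalIntegrable (fun x => f x * g x) volume 0 1) :
    |∫ x in (0:ℝ)..1, f x * g x| ≤ nrm f * nrm g := by
  set A := ∫ x in (0:ℝ)..1, f x ^ 2
  set B := ∫ x in (0:ℝ)..1, f x * g x
  set C := ∫ x in (0:ℝ)..1, g x ^ 2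
  have hA : 0 ≤ A := int_nonneg fun x _ => sq_nonneg _
  have hC : 0 ≤ C := int_nonneg fun x _ => sq_nonneg _
  have key : ∀ s : ℝ, 0 ≤ A * (s * s) + (2 * B) * s + C := by
    intro s
    have : ∫ x in (0:ℝ)..1, (s * f x + g x) ^ 2 = A * (s * s) + (2 * B) * s + C := by
      have e : ∀ x, (s * f x + g x) ^ 2 = (s * s) * f x ^ 2 + (2 * s) * (f x * g x) + g x ^ 2 := by
        intro x; ring
      simp only [e]
      rw [integral_add ((h1.const_mul _).add (h3.const_mul _)) h2,
        integral_add (h1.const_mul _) (h3.const_mul _), intervalIntegral.integral_const_mul, intervalIntegral.integral_const_mul]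
      ring
    rw [← this]; exact int_nonneg fun x _ => sq_nonneg _
  have hd := discrim_le_zero key
  unfold discrim at hd
  have hB : B ^ 2 ≤ A * C := by nlinarith
  unfold nrm
  rw [← Real.sqrt_mul hA]
  exact Real.abs_le_sqrt hB

lemma cs {f g : ℝ → ℝ} (hf : ContinuousOn f I) (hg : ContinuousOn g I) :
    |∫ x in (0:ℝ)..1, f x * g x| ≤ nrm f * nrm g :=
  cs_gen (cii (hf.pow 2)) (cii (hg.pow 2)) (cii (hf.mul hg))

lemma nrm_nonneg (f : ℝ → ℝ) : 0 ≤ nrm f := Real.sqrt_nonneg _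
lemma nrm_sq (f : ℝ → ℝ) : nrm f ^ 2 = ∫ x in (0:ℝ)..1, f x ^ 2 :=
  Real.sq_sqrt (int_nonneg fun x _ => sq_nonneg _)

lemma nrm_congr {f g : ℝ → ℝ} (h : ∀ x ∈ I, f x = g x) : nrm f = nrm g := by
  unfold nrm; congr 1; exact int_congr fun x hx => by rw [h x hx]

lemma nrm_le_of_sq {f : ℝ → ℝ} {K : ℝ} (hK : 0 ≤ K) (h : ∫ x in (0:ℝ)..1, f x ^ 2 ≤ K ^ 2) :
    nrm f ≤ K := Real.sqrt_le_iff.2 ⟨hK, h⟩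

lemma nrm_smul (c : ℝ) (f : ℝ → ℝ) : nrm (fun x => c * f x) = |c| * nrm f := by
  unfold nrm
  simp only [mul_pow]
  rw [intervalIntegral.integral_const_mul, Real.sqrt_mul (sq_nonneg c), Real.sqrt_sq_eq_abs]

lemma nrm_add {f g : ℝ → ℝ} (hf : ContinuousOn f I) (hg : ContinuousOn g I) :
    nrm (fun x => f x + g x) ≤ nrm f + nrm g := by
  apply nrm_le_of_sq (add_nonneg (nrm_nonneg _) (nrm_nonneg _))
  have e : ∀ x, (f x + g x) ^ 2 = f x ^ 2 + 2 * (f x * g x) + g x ^ 2 := by intro x; ring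
  simp only [e]
  rw [integral_add (cii (by fun_prop)) (cii (by fun_prop)),
    integral_add (cii (by fun_prop)) (cii (by fun_prop)), intervalIntegral.integral_const_mul,
    ← nrm_sq, ← nrm_sq]
  have := le_of_abs_le (cs hf hg)
  nlinarith

lemma nrm_neg (f : ℝ → ℝ) : nrm (fun x => - f x) = nrm f := by
  unfold nrm; simp
lemma nrm_sub {f g : ℝ → ℝ} (hf : ContinuousOn f I) (hg : ContinuousOn g I) :
    nrm (fun x => f x - g x) ≤ nrm f + nrm g := by
  have := nrm_add hf hg.neg
  have h2 : nrm (-g) = nrm g := nrm_neg g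
  rw [h2] at this
  simpa [sub_eq_add_neg] using this

lemma nrm_le_sup {f : ℝ → ℝ} {K : ℝ} (hK : 0 ≤ K) (hf : ContinuousOn f I)
    (h : ∀ x ∈ I, |f x| ≤ K) : nrm f ≤ K := by
  apply nrm_le_of_sq hK
  calc _ ≤ ∫ x in (0:ℝ)..1, K ^ 2 := int_mono (by fun_prop) (by fun_prop) fun x hx => by
            rw [← sq_abs]; exact pow_le_pow_left₀ (abs_nonneg _) (h x hx) 2
    _ = K ^ 2 := by simp

lemma nrm_mul_le {f g : ℝ → ℝ} {K : ℝ} (hK : 0 ≤ K) (hf : ContinuousOn f I) (hg : ContinuousOn g I)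
    (h : ∀ x ∈ I, |f x| ≤ K) : nrm (fun x => f x * g x) ≤ K * nrm g := by
  apply nrm_le_of_sq (mul_nonneg hK (nrm_nonneg _))
  rw [mul_pow, nrm_sq, ← intervalIntegral.integral_const_mul]
  apply int_mono (by fun_prop) (by fun_prop)
  intro x hx
  rw [mul_pow, ← sq_abs (f x)]
  exact mul_le_mul_of_nonneg_right (pow_le_pow_left₀ (abs_nonneg _) (h x hx) 2) (sq_nonneg _)

lemma osc_le {f f' : ℝ → ℝ} (h : D f f') {x y : ℝ} (hx : x ∈ I) (hy : y ∈ I) :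
    |f x - f y| ≤ nrm f' := by
  rw [← h.int_ab hy hx]
  have h1 : |∫ t in y..x, f' t| ≤ ∫ t in (0:ℝ)..1, |f' t| := by
    have a1 : |∫ t in y..x, f' t| ≤ |∫ t in y..x, abs (f' t)| := by
      simpa using norm_integral_le_abs_integral_norm (f := f') (a := y) (b := x) (μ := volume)
    refine a1.trans ?_
    have hm : ∀ a ∈ I, ∀ b ∈ I, a ≤ b → |∫ t in a..b, abs (f' t)| ≤ ∫ t in (0:ℝ)..1, |f' t| := by
      intro a ha b hb hab
      rw [abs_of_nonneg (integral_nonneg hab fun _ _ => abs_nonneg _)]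
      exact integral_mono_interval ha.1 hab hb.2 (Filter.Eventually.of_forall fun _ => abs_nonneg _)
        (cii h.2.abs)
    rcases le_total y x with hh | hh
    · exact hm y hy x hx hh
    · rw [integral_symm, abs_neg]; exact hm x hx y hy hh
  refine h1.trans ?_
  have h2 := cs (continuousOn_const (c := (1:ℝ))) h.2.abs
  have h3 : nrm (fun _ => (1:ℝ)) = 1 := by simp [nrm]
  have h4 : nrm (fun x => |f' x|) = nrm f' := by simp [nrm]
  rw [h3, h4] at h2
  simpa using le_of_abs_le h2

lemma sup_le_of_zero {f f' : ℝ → ℝ} (h : D f f') {z : ℝ} (hz : z ∈ I) (h0 : f z = 0) {x : ℝ}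
    (hx : x ∈ I) : |f x| ≤ nrm f' := by
  have := osc_le h hx hz
  rwa [h0, sub_zero] at this

lemma exists_le_nrm {f : ℝ → ℝ} (hf : ContinuousOn f I) : ∃ z ∈ I, |f z| ≤ nrm f := by
  obtain ⟨z, hz, hmin⟩ := isCompact_Icc.exists_isMinOn (nonempty_Icc.2 zero_le_one) hf.abs
  refine ⟨z, hz, ?_⟩
  apply Real.le_sqrt_of_sq_le
  calc |f z| ^ 2 = ∫ x in (0:ℝ)..1, |f z| ^ 2 := by simp
    _ ≤ _ := int_mono (by fun_prop) (by fun_prop) fun x hx => by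
        rw [← sq_abs (f x)]; exact pow_le_pow_left₀ (abs_nonneg _) (hmin hx) 2

lemma sup_le {f f' : ℝ → ℝ} (h : D f f') {x : ℝ} (hx : x ∈ I) : |f x| ≤ nrm f + nrm f' := by
  obtain ⟨z, hz, h1⟩ := exists_le_nrm h.cont
  have h2 := osc_le h hx hz
  have := abs_sub_abs_le_abs_sub (f x) (f z)
  linarith

lemma rolle {f f' : ℝ → ℝ} (h : D f f') (h01 : f 0 = f 1) : ∃ z ∈ I, f' z = 0 := by
  obtain ⟨z, hz, h0⟩ := exists_hasDerivAt_eq_zero zero_lt_one h.cont h01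
    (fun x hx => h.hasDerivAt hx)
  exact ⟨z, Ioo_subset_Icc_self hz, h0⟩

end SW
end

noncomputable section
open Set

namespace SW
open MeasureTheory
open intervalIntegral hiding integral_const_mul

/-- `P` solves `P - e² P'' = g` on `[0,1]`; boundary type `true` is Dirichlet (value `d`),
`false` is Neumann (homogeneous). -/
structure Gr (e : ℝ) (b0 b1 : Bool) (g : ℝ → ℝ) (d0 d1 : ℝ) (P P1 P2 : ℝ → ℝ) : Prop where
  h1 : D P P1
  h2 : D P1 P2
  eq : ∀ x ∈ I, P x - e ^ 2 * P2 x = g x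
  l0 : b0 = true → P 0 = d0
  l1 : b0 = false → P1 0 = 0
  r0 : b1 = true → P 1 = d1
  r1 : b1 = false → P1 1 = 0

lemma D.of_hasDerivAt {f f' : ℝ → ℝ} (h : ∀ x, HasDerivAt f (f' x) x) (hc : ContinuousOn f' I) :
    D f f' := ⟨fun x _ => (h x).hasDerivWithinAt, hc⟩

lemma Gr.exists {e : ℝ} (he : 0 < e) (b0 b1 : Bool) {g : ℝ → ℝ} (hg : ContinuousOn g I)
    (d0 d1 : ℝ) : ∃ P P1 P2, Gr e b0 b1 g d0 d1 P P1 P2 := by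
  obtain ⟨G, hG, hGg⟩ : ∃ G : ℝ → ℝ, Continuous G ∧ ∀ x ∈ I, G x = g x :=
    ⟨IccExtend zero_le_one (I.domRestrict g), (continuousOn_iff_continuous_domRestrict.1 hg).Icc_extend',
      fun x hx => by rw [IccExtend_of_mem _ _ hx]; rfl⟩
  set S : ℝ → ℝ := fun x => ∫ y in (0:ℝ)..x, Real.sinh (y / e) * G y with hS
  set C : ℝ → ℝ := fun x => ∫ y in (0:ℝ)..x, Real.cosh (y / e) * G y with hC
  have cs : Continuous fun y => Real.sinh (y / e) * G y :=
    (Real.continuous_sinh.comp (continuous_id.div_const e)).mul hG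
  have cc : Continuous fun y => Real.cosh (y / e) * G y :=
    (Real.continuous_cosh.comp (continuous_id.div_const e)).mul hG
  have dS : ∀ x, HasDerivAt S (Real.sinh (x / e) * G x) x := fun x =>
    cs.integral_hasStrictDerivAt 0 x |>.hasDerivAt
  have dC : ∀ x, HasDerivAt C (Real.cosh (x / e) * G x) x := fun x =>
    cc.integral_hasStrictDerivAt 0 x |>.hasDerivAt
  have dsh : ∀ x, HasDerivAt (fun x => Real.sinh (x / e)) (Real.cosh (x / e) / e) x := fun x => by
    have := ((hasDerivAt_id x).div_const e).sinh
    simpa [div_eq_mul_inv] using this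
  have dch : ∀ x, HasDerivAt (fun x => Real.cosh (x / e)) (Real.sinh (x / e) / e) x := fun x => by
    have := ((hasDerivAt_id x).div_const e).cosh
    simpa [div_eq_mul_inv] using this
  have cS : Continuous S := continuous_iff_continuousAt.2 fun x => (dS x).continuousAt
  have cC : Continuous C := continuous_iff_continuousAt.2 fun x => (dC x).continuousAt
  have csh : Continuous fun x => Real.sinh (x / e) :=
    continuous_iff_continuousAt.2 fun x => (dsh x).continuousAt
  have cch : Continuous fun x => Real.cosh (x / e) :=
    continuous_iff_continuousAt.2 fun x => (dch x).continuousAt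
  -- general solution
  let P : ℝ → ℝ → ℝ → ℝ := fun A B x =>
    (Real.cosh (x / e) * S x - Real.sinh (x / e) * C x) / e
      + (A * Real.cosh (x / e) + B * Real.sinh (x / e))
  let P1 : ℝ → ℝ → ℝ → ℝ := fun A B x =>
    (Real.sinh (x / e) * S x - Real.cosh (x / e) * C x) / e ^ 2
      + (A * Real.sinh (x / e) + B * Real.cosh (x / e)) / e
  let P2 : ℝ → ℝ → ℝ → ℝ := fun A B x => (P A B x - G x) / e ^ 2
  have hP1 : ∀ A B, D (P A B) (P1 A B) := fun A B => by
    apply D.of_hasDerivAt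
    · intro x
      have := ((((dch x).mul (dS x)).sub ((dsh x).mul (dC x))).div_const e).add
        (((dch x).const_mul A).add ((dsh x).const_mul B))
      refine this.congr_deriv ?_
      simp only [P1]; field_simp; ring
    · apply Continuous.continuousOn
      simp only [P1]; fun_prop
  have hP2 : ∀ A B, D (P1 A B) (P2 A B) := fun A B => by
    apply D.of_hasDerivAt
    · intro x
      have := ((((dsh x).mul (dS x)).sub ((dch x).mul (dC x))).div_const (e^2)).add
        ((((dsh x).const_mul A).add ((dch x).const_mul B)).div_const e)
      refine this.congr_deriv ?_
      have h := Real.cosh_sq (x / e)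
      simp only [P2, P]; field_simp
      linear_combination (-G x * e) * h
    · apply Continuous.continuousOn
      simp only [P2, P]; fun_prop
  have heq : ∀ A B, ∀ x ∈ I, P A B x - e ^ 2 * P2 A B x = g x := fun A B x hx => by
    rw [← hGg x hx]; simp only [P2]; field_simp; ring
  have P0 : ∀ A B, P A B 0 = A := fun A B => by simp [P, S, C]
  have P10 : ∀ A B, P1 A B 0 = B / e := fun A B => by simp [P1, S, C]
  have sh : 0 < Real.sinh (1 / e) := Real.sinh_pos_iff.2 (by positivity)
  have ch : 0 < Real.cosh (1 / e) := Real.cosh_pos _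
  set p := (Real.cosh (1 / e) * S 1 - Real.sinh (1 / e) * C 1) / e with hp
  set q := (Real.sinh (1 / e) * S 1 - Real.cosh (1 / e) * C 1) / e ^ 2 with hq
  have PA : ∀ A B, P A B 1 = p + (A * Real.cosh (1 / e) + B * Real.sinh (1 / e)) := fun A B => rfl
  have P1A : ∀ A B, P1 A B 1 = q + (A * Real.sinh (1 / e) + B * Real.cosh (1 / e)) / e :=
    fun A B => rfl
  have main : ∃ A B, (b0 = true → P A B 0 = d0) ∧ (b0 = false → P1 A B 0 = 0) ∧
      (b1 = true → P A B 1 = d1) ∧ (b1 = false → P1 A B 1 = 0) := by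
    cases b0 <;> cases b1
    · refine ⟨(- q * e) / Real.sinh (1 / e), 0, by simp, by simp [P10], by simp, fun _ => ?_⟩
      rw [P1A]; field_simp; ring
    · refine ⟨(d1 - p) / Real.cosh (1 / e), 0, by simp, by simp [P10], fun _ => ?_, by simp⟩
      rw [PA]; field_simp; ring
    · refine ⟨d0, (- q * e - d0 * Real.sinh (1 / e)) / Real.cosh (1 / e), by simp [P0], by simp,
        by simp, fun _ => ?_⟩
      rw [P1A]; field_simp; ring
    · refine ⟨d0, (d1 - p - d0 * Real.cosh (1 / e)) / Real.sinh (1 / e), by simp [P0], by simp,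
        fun _ => ?_, by simp⟩
      rw [PA]; field_simp; ring
  obtain ⟨A, B, h0, h1, h2, h3⟩ := main
  exact ⟨P A B, P1 A B, P2 A B, hP1 A B, hP2 A B, heq A B, h0, h1, h2, h3⟩

namespace Gr
variable {e : ℝ} {b0 b1 : Bool} {g g' : ℝ → ℝ} {d0 d1 d0' d1' : ℝ} {P P1 P2 Q Q1 Q2 : ℝ → ℝ}

lemma sub (h : Gr e b0 b1 g d0 d1 P P1 P2) (h' : Gr e b0 b1 g' d0' d1' Q Q1 Q2) :
    Gr e b0 b1 (fun x => g x - g' x) (d0 - d0') (d1 - d1') (fun x => P x - Q x)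
      (fun x => P1 x - Q1 x) (fun x => P2 x - Q2 x) where
  h1 := h.h1.sub h'.h1
  h2 := h.h2.sub h'.h2
  eq x hx := by rw [← h.eq x hx, ← h'.eq x hx]; ring
  l0 hb := by rw [h.l0 hb, h'.l0 hb]
  l1 hb := by rw [h.l1 hb, h'.l1 hb]; ring
  r0 hb := by rw [h.r0 hb, h'.r0 hb]
  r1 hb := by rw [h.r1 hb, h'.r1 hb]; ring

lemma smul (c : ℝ) (h : Gr e b0 b1 g d0 d1 P P1 P2) :
    Gr e b0 b1 (fun x => c * g x) (c * d0) (c * d1) (fun x => c * P x)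
      (fun x => c * P1 x) (fun x => c * P2 x) where
  h1 := h.h1.smul c
  h2 := h.h2.smul c
  eq x hx := by rw [← h.eq x hx]; ring
  l0 hb := by rw [h.l0 hb]
  l1 hb := by rw [h.l1 hb]; ring
  r0 hb := by rw [h.r0 hb]
  r1 hb := by rw [h.r1 hb]; ring

lemma congr (h : Gr e b0 b1 g d0 d1 P P1 P2) (hg : ∀ x ∈ I, g' x = g x) (h0 : d0' = d0)
    (h1 : d1' = d1) : Gr e b0 b1 g' d0' d1' P P1 P2 where
  h1 := h.h1
  h2 := h.h2
  eq x hx := by rw [hg x hx, h.eq x hx]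
  l0 hb := by rw [h.l0 hb, h0]
  l1 := h.l1
  r0 hb := by rw [h.r0 hb, h1]
  r1 := h.r1

end Gr

/-- at a critical point with positive second derivative there is a larger value -/
lemma bigger {P P1 P2 : ℝ → ℝ} (h1 : D P P1) (h2 : D P1 P2) {x : ℝ} (hx : x ∈ I)
    (hc : P1 x = 0) (hp : 0 < P2 x) : ∃ y ∈ I, P x < P y := by
  obtain ⟨δ, hδ, hpos⟩ : ∃ δ > 0, ∀ y ∈ I, |y - x| < δ → 0 < P2 y := by
    have := (h2.2 x hx).eventually_const_lt hp
    rw [eventually_nhdsWithin_iff, Metric.eventually_nhds_iff] at this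
    obtain ⟨δ, hδ, h⟩ := this
    exact ⟨δ, hδ, fun y hy hyx => h (by rwa [Real.dist_eq]) hy⟩
  -- move right or left
  rcases lt_or_ge x 1 with hx1 | hx1
  · set y := min (x + δ / 2) 1 with hy
    have hxy : x < y := lt_min (by linarith) hx1
    have hyI : y ∈ I := ⟨hx.1.trans hxy.le, min_le_right _ _⟩
    have hyδ : y - x < δ := by have := min_le_left (x + δ / 2) 1; linarith
    refine ⟨y, hyI, ?_⟩
    have sub : ∀ z ∈ Ioo x y, z ∈ Ioo (0:ℝ) 1 := fun z hz =>
      ⟨lt_of_le_of_lt hx.1 hz.1, lt_of_lt_of_le hz.2 hyI.2⟩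
    have subc : Icc x y ⊆ I := Icc_subset_Icc hx.1 hyI.2
    obtain ⟨ξ, hξ, e1⟩ := exists_hasDerivAt_eq_slope P P1 hxy (h1.cont.mono subc)
      (fun z hz => h1.hasDerivAt (sub z hz))
    obtain ⟨ζ, hζ, e2⟩ := exists_hasDerivAt_eq_slope P1 P2 hξ.1
      (h2.cont.mono ((Icc_subset_Icc_right hξ.2.le).trans subc))
      (fun z hz => h2.hasDerivAt (sub z ⟨hz.1, hz.2.trans hξ.2⟩))
    have p2 : 0 < P2 ζ := hpos ζ (subc ⟨hζ.1.le, (hζ.2.trans hξ.2).le⟩) (by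
      rw [abs_of_pos (by linarith [hζ.1])]; linarith [hζ.2, hξ.2])
    rw [e2, hc, sub_zero] at p2
    have p1 : 0 < P1 ξ := by
      have hh : 0 < ξ - x := by linarith [hξ.1]
      exact (div_pos_iff_of_pos_right hh).1 p2
    rw [e1] at p1
    have hh : 0 < y - x := by linarith
    have := (div_pos_iff_of_pos_right hh).1 p1
    linarith
  · have hx1' : x = 1 := le_antisymm hx.2 hx1
    set y := max (x - δ / 2) 0 with hy
    have hxy : y < x := max_lt (by linarith) (by rw [hx1']; norm_num)
    have hyI : y ∈ I := ⟨le_max_right _ _, hxy.le.trans hx.2⟩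
    have hyδ : x - y < δ := by have := le_max_left (x - δ / 2) 0; linarith
    refine ⟨y, hyI, ?_⟩
    have sub : ∀ z ∈ Ioo y x, z ∈ Ioo (0:ℝ) 1 := fun z hz =>
      ⟨lt_of_le_of_lt hyI.1 hz.1, lt_of_lt_of_le hz.2 hx.2⟩
    have subc : Icc y x ⊆ I := Icc_subset_Icc hyI.1 hx.2
    obtain ⟨ξ, hξ, e1⟩ := exists_hasDerivAt_eq_slope P P1 hxy (h1.cont.mono subc)
      (fun z hz => h1.hasDerivAt (sub z hz))
    obtain ⟨ζ, hζ, e2⟩ := exists_hasDerivAt_eq_slope P1 P2 hξ.2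
      (h2.cont.mono ((Icc_subset_Icc_left hξ.1.le).trans subc))
      (fun z hz => h2.hasDerivAt (sub z ⟨hξ.1.trans hz.1, hz.2⟩))
    have p2 : 0 < P2 ζ := hpos ζ (subc ⟨(hξ.1.trans hζ.1).le, hζ.2.le⟩) (by
      rw [abs_of_neg (by linarith [hζ.2])]; linarith [hζ.1, hξ.1])
    rw [e2, hc, zero_sub] at p2
    have p1 : 0 < -P1 ξ := by
      have hh : 0 < x - ξ := by linarith [hξ.2]
      exact (div_pos_iff_of_pos_right hh).1 p2
    rw [e1, ← neg_div] at p1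
    have hh : 0 < x - y := by linarith
    have := (div_pos_iff_of_pos_right hh).1 p1
    linarith

namespace Gr
variable {e : ℝ} {b0 b1 : Bool} {g g' : ℝ → ℝ} {d0 d1 d0' d1' : ℝ} {P P1 P2 Q Q1 Q2 : ℝ → ℝ}

lemma le_of (he : 0 < e) (h : Gr e b0 b1 g d0 d1 P P1 P2) {m : ℝ}
    (hg : ∀ x ∈ I, g x ≤ m) (h0 : d0 ≤ m) (h1 : d1 ≤ m) : ∀ x ∈ I, P x ≤ m := by
  obtain ⟨x, hx, hmax⟩ := isCompact_Icc.exists_isMaxOn (nonempty_Icc.2 zero_le_one) h.h1.cont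
  by_contra! hcon
  obtain ⟨y, hy, hmy⟩ := hcon
  have hmx : m < P x := hmy.trans_le (hmax hy)
  have hP2 : 0 < P2 x := by
    have := h.eq x hx
    have hg' := hg x hx
    have : 0 < e ^ 2 * P2 x := by linarith
    exact (pos_iff_pos_of_mul_pos this).1 (by positivity)
  have hP1 : P1 x = 0 := by
    rcases eq_or_lt_of_le hx.1 with h00 | h00
    · rw [← h00] at hmx ⊢
      cases hb : b0
      · exact h.l1 hb
      · rw [h.l0 hb] at hmx; linarith
    rcases eq_or_lt_of_le hx.2 with h11 | h11
    · rw [h11] at hmx ⊢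
      cases hb : b1
      · exact h.r1 hb
      · rw [h.r0 hb] at hmx; linarith
    · exact (hmax.isLocalMax (Icc_mem_nhds h00 h11)).hasDerivAt_eq_zero (h.h1.hasDerivAt ⟨h00, h11⟩)
  obtain ⟨z, hz, hlt⟩ := bigger h.h1 h.h2 hx hP1 hP2
  exact absurd (hmax hz) (not_le.2 hlt)

lemma abs_le (he : 0 < e) (h : Gr e b0 b1 g d0 d1 P P1 P2) {m : ℝ}
    (hg : ∀ x ∈ I, |g x| ≤ m) (h0 : |d0| ≤ m) (h1 : |d1| ≤ m) : ∀ x ∈ I, |P x| ≤ m := by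
  intro x hx
  rw [abs_le']
  refine ⟨le_of he h (fun x hx => le_of_abs_le (hg x hx)) (le_of_abs_le h0) (le_of_abs_le h1) x hx,
    ?_⟩
  have := le_of he (h.smul (-1)) (m := m) (fun x hx => by linarith [neg_le_of_abs_le (hg x hx)])
    (by linarith [neg_le_of_abs_le h0]) (by linarith [neg_le_of_abs_le h1]) x hx
  linarith

lemma unique (he : 0 < e) (h : Gr e b0 b1 g d0 d1 P P1 P2) (h' : Gr e b0 b1 g d0 d1 Q Q1 Q2) :
    ∀ x ∈ I, P x = Q x := by
  intro x hx
  have := abs_le he (h.sub h') (m := 0) (by simp) (by simp) (by simp) x hx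
  have := abs_nonpos_iff.1 this
  linarith

lemma cont_rhs (h : Gr e b0 b1 g d0 d1 P P1 P2) : ContinuousOn g I := by
  have := h.h1.cont
  have h2 := h.h2.2
  have : ContinuousOn (fun x => P x - e ^ 2 * P2 x) I := by fun_prop
  exact this.congr fun x hx => (h.eq x hx).symm

/-- boundary products vanish for two solutions with homogeneous data -/
lemma bdry0 (h : Gr e b0 b1 g 0 d1 P P1 P2) (h' : Gr e b0 b1 g' 0 d1' Q Q1 Q2) :
    P1 0 * Q 0 = 0 := by
  cases hb : b0
  · rw [h.l1 hb]; ring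
  · rw [h'.l0 hb]; ring
lemma bdry1 (h : Gr e b0 b1 g d0 0 P P1 P2) (h' : Gr e b0 b1 g' d0' 0 Q Q1 Q2) :
    P1 1 * Q 1 = 0 := by
  cases hb : b1
  · rw [h.r1 hb]; ring
  · rw [h'.r0 hb]; ring

lemma energy (h : Gr e b0 b1 g 0 0 P P1 P2) : nrm P ≤ nrm g := by
  have hP := h.h1.cont
  have hP1 := h.h2.cont
  have hP2 := h.h2.2
  have hg := h.cont_rhs
  have i1 : ∫ x in (0:ℝ)..1, (P2 x * P x + P1 x * P1 x) = 0 := by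
    rw [(h.h2.mul h.h1).int, h.bdry0 h, h.bdry1 h]; ring
  have i2 : ∫ x in (0:ℝ)..1, (P x ^ 2 + e ^ 2 * P1 x ^ 2) = ∫ x in (0:ℝ)..1, g x * P x := by
    have : ∫ x in (0:ℝ)..1, ((P x ^ 2 + e ^ 2 * P1 x ^ 2) - e ^ 2 * (P2 x * P x + P1 x * P1 x))
        = ∫ x in (0:ℝ)..1, g x * P x := int_congr fun x hx => by rw [← h.eq x hx]; ring
    rw [integral_sub (cii (by fun_prop)) (cii (by fun_prop)),
      intervalIntegral.integral_const_mul, i1] at this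
    linarith
  have i3 : nrm P ^ 2 ≤ nrm g * nrm P := by
    rw [nrm_sq]
    calc _ ≤ ∫ x in (0:ℝ)..1, (P x ^ 2 + e ^ 2 * P1 x ^ 2) :=
          int_mono (by fun_prop) (by fun_prop) fun x _ => by nlinarith [sq_nonneg (e * P1 x)]
      _ ≤ _ := by rw [i2]; exact le_of_abs_le (cs hg hP)
  have := nrm_nonneg P
  rcases eq_or_lt_of_le this with h0 | h0
  · rw [← h0]; exact nrm_nonneg g
  · nlinarith

lemma reg (he : 0 < e) {g1 g2 : ℝ → ℝ} (h : Gr e b0 b1 g d0 d1 P P1 P2) (hg1 : D g g1)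
    (hg2 : D g1 g2) (hl0 : b0 = true → d0 = g 0) (hl1 : b0 = false → g1 0 = 0)
    (hr0 : b1 = true → d1 = g 1) (hr1 : b1 = false → g1 1 = 0) : nrm P2 ≤ nrm g2 := by
  obtain ⟨Q, Q1, Q2, hQ⟩ := Gr.exists he b0 b1 hg2.2 0 0
  have hX : Gr e b0 b1 g d0 d1 (fun x => g x + e ^ 2 * Q x) (fun x => g1 x + e ^ 2 * Q1 x)
      (fun x => g2 x + e ^ 2 * Q2 x) :=
    { h1 := hg1.add (hQ.h1.smul _)
      h2 := hg2.add (hQ.h2.smul _)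
      eq := fun x hx => by rw [← hQ.eq x hx]; ring
      l0 := fun hb => by rw [hQ.l0 hb, hl0 hb]; ring
      l1 := fun hb => by rw [hQ.l1 hb, hl1 hb]; ring
      r0 := fun hb => by rw [hQ.r0 hb, hr0 hb]; ring
      r1 := fun hb => by rw [hQ.r1 hb, hr1 hb]; ring }
  have e0 := unique he h hX
  have e2 : ∀ x ∈ I, P2 x = Q x := fun x hx => by
    have a := h.eq x hx
    have b := e0 x hx
    have : e ^ 2 * P2 x = e ^ 2 * Q x := by linarith
    exact mul_left_cancel₀ (by positivity) this
  rw [nrm_congr e2]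
  exact hQ.energy

/-- a zero of the derivative -/
lemma zero_deriv (h : Gr e b0 b1 g 0 0 P P1 P2) : ∃ z ∈ I, P1 z = 0 := by
  cases hb : b0
  · exact ⟨0, zero_mem, h.l1 hb⟩
  · cases hb' : b1
    · exact ⟨1, one_mem, h.r1 hb'⟩
    · exact rolle h.h1 (by rw [h.l0 hb, h.r0 hb'])

/-- self-adjointness: `∫ W (f - R) = ∫ (W - Z) f` when `R = S f`, `Z = S W`. -/
lemma selfadj {f : ℝ → ℝ} (hR : Gr e b0 b1 f 0 0 P P1 P2) (hZ : Gr e b0 b1 g 0 0 Q Q1 Q2) :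
    ∫ x in (0:ℝ)..1, g x * (f x - P x) = ∫ x in (0:ℝ)..1, (g x - Q x) * f x := by
  have := (hZ.h1.mul hR.h2).sub (hZ.h2.mul hR.h1)
  have i := (this.smul (- e ^ 2)).int
  have a0 := hR.bdry0 hZ
  have a1 := hR.bdry1 hZ
  have b0' := hZ.bdry0 hR
  have b1' := hZ.bdry1 hR
  have c1 := hR.h1.cont
  have c2 := hR.cont_rhs
  have c3 := hZ.h1.cont
  have c4 := hZ.cont_rhs
  have hz : ∫ x in (0:ℝ)..1, (g x * (f x - P x) - (g x - Q x) * f x) = 0 := by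
    refine Eq.trans (int_congr fun x hx => ?_) (i.trans ?_)
    · rw [← hR.eq x hx, ← hZ.eq x hx]; ring
    · linear_combination (-e ^ 2) * (a1 - b1' - a0 + b0')
  rw [integral_sub (cii (by fun_prop)) (cii (by fun_prop))] at hz
  linarith

end Gr
end SW
end

noncomputable section
open Set

namespace SW
open MeasureTheory
open intervalIntegral hiding integral_const_mul

/-- totally symmetric trilinear form -/
def cf (A X Y : ℝ × ℝ) : ℝ :=
  (1/2) * (A.2 * X.1 * Y.1 + A.1 * (X.1 * Y.2 + X.2 * Y.1) + 3 * A.2 * X.2 * Y.2)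

def sq (X : ℝ × ℝ) : ℝ := X.1 ^ 2 + X.2 ^ 2

lemma sq_nn (X : ℝ × ℝ) : 0 ≤ sq X := by unfold sq; positivity

lemma cf_le {a : ℝ} {A X Y : ℝ × ℝ} (h1 : |A.1| ≤ a) (h2 : |A.2| ≤ a) :
    |cf A X Y| ≤ a * (sq X + sq Y) := by
  have ha : 0 ≤ a := (abs_nonneg _).trans h1
  have m : ∀ p q r : ℝ, |p| ≤ a → |p * q * r| ≤ a * ((q ^ 2 + r ^ 2) / 2) := by
    intro p q r hp
    rw [mul_assoc, abs_mul]
    apply mul_le_mul hp _ (abs_nonneg _) ha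
    rw [abs_le]; constructor <;> nlinarith [sq_nonneg (q - r), sq_nonneg (q + r)]
  have e1 := abs_le.1 (m A.2 X.1 Y.1 h2)
  have e2 := abs_le.1 (m A.1 X.1 Y.2 h1)
  have e3 := abs_le.1 (m A.1 X.2 Y.1 h1)
  have e4 := abs_le.1 (m A.2 X.2 Y.2 h2)
  have p1 : 0 ≤ a * X.1 ^ 2 := by positivity
  have p2 : 0 ≤ a * X.2 ^ 2 := by positivity
  have p3 : 0 ≤ a * Y.1 ^ 2 := by positivity
  have p4 : 0 ≤ a * Y.2 ^ 2 := by positivity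
  unfold cf sq
  rw [abs_le]
  constructor <;> nlinarith

/-- pair version of `D` -/
def D2 (F F' : ℝ → ℝ × ℝ) : Prop :=
  D (fun x => (F x).1) (fun x => (F' x).1) ∧ D (fun x => (F x).2) (fun x => (F' x).2)

namespace D2
variable {F F' G G' H H' : ℝ → ℝ × ℝ}
lemma sub (h : D2 F F') (h' : D2 G G') : D2 (fun x => F x - G x) (fun x => F' x - G' x) :=
  ⟨h.1.sub h'.1, h.2.sub h'.2⟩
lemma add (h : D2 F F') (h' : D2 G G') : D2 (fun x => F x + G x) (fun x => F' x + G' x) :=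
  ⟨h.1.add h'.1, h.2.add h'.2⟩
lemma smul (c : ℝ) (h : D2 F F') : D2 (fun x => c • F x) (fun x => c • F' x) :=
  ⟨h.1.smul c, h.2.smul c⟩
lemma cont (h : D2 F F') : ContinuousOn F I := h.1.cont.prodMk h.2.cont
lemma cont' (h : D2 F F') : ContinuousOn F' I := h.1.2.prodMk h.2.2
lemma cf (h : D2 F F') (h' : D2 G G') (h'' : D2 H H') :
    D (fun x => SW.cf (F x) (G x) (H x))
      (fun x => SW.cf (F' x) (G x) (H x) + SW.cf (F x) (G' x) (H x) + SW.cf (F x) (G x) (H' x)) := by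
  have := ((((h.2.mul h'.1).mul h''.1).add (h.1.mul ((h'.1.mul h''.2).add (h'.2.mul h''.1)))).add
    (((h.2.smul 3).mul h'.2).mul h''.2)).smul (1/2)
  refine this.congr (fun x _ => ?_) (fun x _ => ?_)
  · simp only [SW.cf]
  · simp only [SW.cf]; ring
end D2

@[fun_prop]
lemma cf_cont {F G H : ℝ → ℝ × ℝ} (h1 : ContinuousOn F I) (h2 : ContinuousOn G I)
    (h3 : ContinuousOn H I) : ContinuousOn (fun x => cf (F x) (G x) (H x)) I := by
  unfold cf; fun_prop

@[fun_prop]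
lemma sq_cont {F : ℝ → ℝ × ℝ} (h1 : ContinuousOn F I) : ContinuousOn (fun x => sq (F x)) I := by
  unfold sq; fun_prop

structure Gr2 (e : ℝ) (b0 b1 : Bool × Bool) (g : ℝ → ℝ × ℝ) (d0 d1 : ℝ × ℝ)
    (P P1 P2 : ℝ → ℝ × ℝ) : Prop where
  fst : Gr e b0.1 b1.1 (fun x => (g x).1) d0.1 d1.1 (fun x => (P x).1) (fun x => (P1 x).1)
    (fun x => (P2 x).1)
  snd : Gr e b0.2 b1.2 (fun x => (g x).2) d0.2 d1.2 (fun x => (P x).2) (fun x => (P1 x).2)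
    (fun x => (P2 x).2)

namespace Gr2
variable {e : ℝ} {b0 b1 : Bool × Bool} {g : ℝ → ℝ × ℝ} {d0 d1 : ℝ × ℝ} {P P1 P2 : ℝ → ℝ × ℝ}
lemma h1 (h : Gr2 e b0 b1 g d0 d1 P P1 P2) : D2 P P1 := ⟨h.fst.h1, h.snd.h1⟩
lemma h2 (h : Gr2 e b0 b1 g d0 d1 P P1 P2) : D2 P1 P2 := ⟨h.fst.h2, h.snd.h2⟩
lemma eq (h : Gr2 e b0 b1 g d0 d1 P P1 P2) : ∀ x ∈ I, P x - e ^ 2 • P2 x = g x := fun x hx =>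
  Prod.ext (h.fst.eq x hx) (h.snd.eq x hx)
lemma exists' (he : 0 < e) (b0 b1 : Bool × Bool) (hg : ContinuousOn g I) (d0 d1 : ℝ × ℝ) :
    ∃ P P1 P2, Gr2 e b0 b1 g d0 d1 P P1 P2 := by
  obtain ⟨p, p1, p2, hp⟩ := Gr.exists he b0.1 b1.1 (g := fun x => (g x).1) (by fun_prop) d0.1 d1.1
  obtain ⟨q, q1, q2, hq⟩ := Gr.exists he b0.2 b1.2 (g := fun x => (g x).2) (by fun_prop) d0.2 d1.2
  exact ⟨fun x => (p x, q x), fun x => (p1 x, q1 x), fun x => (p2 x, q2 x), hp, hq⟩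
lemma energy (h : Gr2 e b0 b1 g 0 0 P P1 P2) :
    ∫ x in (0:ℝ)..1, sq (P x) ≤ ∫ x in (0:ℝ)..1, sq (g x) := by
  have a := h.fst.energy
  have b := h.snd.energy
  have a1 := pow_le_pow_left₀ (nrm_nonneg _) a 2
  have b1 := pow_le_pow_left₀ (nrm_nonneg _) b 2
  rw [nrm_sq, nrm_sq] at a1 b1
  have c1 := h.fst.h1.cont
  have c2 := h.snd.h1.cont
  have c3 := h.fst.cont_rhs
  have c4 := h.snd.cont_rhs
  unfold sq
  rw [integral_add (cii (by fun_prop)) (cii (by fun_prop)),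
    integral_add (cii (by fun_prop)) (cii (by fun_prop))]
  linarith
end Gr2

/-- compatibility at an endpoint making the boundary terms vanish -/
def Endok (b : Bool × Bool) (A A1 W : ℝ × ℝ) : Prop :=
  (b = (true, true) ∧ A = 0) ∨ (A.2 = 0 ∧ A1.1 = 0 ∧
    ((b = (false, true) ∧ W.2 = 0) ∨ (b = (true, false) ∧ W.1 = 0)))

lemma core {e : ℝ} {b0 b1 : Bool × Bool} {d0 d1 : ℝ × ℝ}
    {A A1 A2 F F1 P P1 P2 Z Z1 Z2 : ℝ → ℝ × ℝ} (hA : D2 A A1) (hA1 : D2 A1 A2)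
    (hF : D2 F F1) (hP : Gr2 e b0 b1 F d0 d1 P P1 P2)
    (hZ : Gr2 e b0 b1 (fun x => F x - P x) 0 0 Z Z1 Z2)
    (h0 : Endok b0 (A 0) (A1 0) (F 0 - P 0)) (h1 : Endok b1 (A 1) (A1 1) (F 1 - P 1)) :
    ∫ x in (0:ℝ)..1, cf (A x) (F x - P x - Z x) (F1 x) =
      ∫ x in (0:ℝ)..1, (-(1/2) * cf (A1 x) (F x - P x) (F x - P x) + 2 * cf (A1 x) (Z x) (F x - P x)
        - e ^ 2 * cf (A2 x) (Z x) (P1 x)) := by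
  have hW : D2 (fun x => F x - P x) (fun x => F1 x - P1 x) := hF.sub hP.h1
  have hG := ((((hA.cf hW hW).smul (1/2)).sub (hA.cf hZ.h1 hW)).sub
    ((hA.cf hZ.h2 hP.h2).smul (e ^ 2))).add ((hA1.cf hZ.h1 hP.h2).smul (e ^ 2))
  have hi := hG.int
  have cA := hA.cont
  have cA1 := hA1.cont
  have cA2 := hA1.cont'
  have cF := hF.cont
  have cF1 := hF.cont'
  have cP := hP.h1.cont
  have cP1 := hP.h2.cont
  have cZ := hZ.h1.cont
  have bd : ∀ G G1 Gp Gz Gz1 : ℝ × ℝ, ∀ W : ℝ × ℝ, ∀ b : Bool × Bool, Endok b G G1 W →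
      (b.1 = true → Gz.1 = 0) → (b.2 = true → Gz.2 = 0) →
      (b.1 = false → Gz1.1 = 0) → (b.2 = false → Gz1.2 = 0) →
      (b.1 = false → Gp.1 = 0) → (b.2 = false → Gp.2 = 0) →
      (1/2) * cf G W W - cf G Gz W - e ^ 2 * cf G Gz1 Gp + e ^ 2 * cf G1 Gz Gp = 0 := by
    intro G G1 Gp Gz Gz1 W b hE z1 z2 z3 z4 p1 p2
    rcases hE with ⟨rfl, hh⟩ | ⟨hh1, hh2, ⟨rfl, hw⟩ | ⟨rfl, hw⟩⟩
    · have a := z1 rfl; have b := z2 rfl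
      simp [cf, hh, a, b]
    · have a := z2 rfl; have b := z3 rfl; have c := p1 rfl
      simp [cf, hh1, hh2, hw, a, b, c]
    · have a := z1 rfl; have b := z4 rfl; have c := p2 rfl
      simp [cf, hh1, hh2, hw, a, b, c]
  have B0 := bd (A 0) (A1 0) (P1 0) (Z 0) (Z1 0) (F 0 - P 0) b0 h0 hZ.fst.l0 hZ.snd.l0 hZ.fst.l1
    hZ.snd.l1 hP.fst.l1 hP.snd.l1
  have B1 := bd (A 1) (A1 1) (P1 1) (Z 1) (Z1 1) (F 1 - P 1) b1 h1 hZ.fst.r0 hZ.snd.r0 hZ.fst.r1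
    hZ.snd.r1 hP.fst.r1 hP.snd.r1
  have hi' : (∫ x in (0:ℝ)..1, (cf (A x) (F x - P x - Z x) (F1 x) -
     (-(1/2) * cf (A1 x) (F x - P x) (F x - P x) + 2 * cf (A1 x) (Z x) (F x - P x)
        - e ^ 2 * cf (A2 x) (Z x) (P1 x)))) = 0 := by
    refine Eq.trans (int_congr fun x hx => ?_) (hi.trans ?_)
    · have a1 := hP.fst.eq x hx
      have a2 := hP.snd.eq x hx
      have a3 := hZ.fst.eq x hx
      have a4 := hZ.snd.eq x hx
      simp only [cf, Prod.fst_sub, Prod.snd_sub] at a1 a2 a3 a4 ⊢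
      linear_combination
        (-(1/2) * ((A x).2 * (Z1 x).1 + (A x).1 * (Z1 x).2) + (1/2) *
          ((A1 x).2 * (Z x).1 + (A1 x).1 * (Z x).2)) * a1 +
        (-(1/2) * ((A x).1 * (Z1 x).1 + 3 * (A x).2 * (Z1 x).2) + (1/2) *
          ((A1 x).1 * (Z x).1 + 3 * (A1 x).2 * (Z x).2)) * a2 +
        (-(1/2) * ((A x).2 * (P1 x).1 + (A x).1 * (P1 x).2)) * a3 +
        (-(1/2) * ((A x).1 * (P1 x).1 + 3 * (A x).2 * (P1 x).2)) * a4
    · linear_combination B1 - B0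
  rw [integral_sub (cii (by fun_prop)) (cii (by fun_prop))] at hi'
  linarith

end SW
end

noncomputable section
open Set

namespace SW
open MeasureTheory
open intervalIntegral hiding integral_const_mul

lemma sq_sub_le (X Y : ℝ × ℝ) : sq (X - Y) ≤ 2 * sq X + 2 * sq Y := by
  simp only [sq, Prod.fst_sub, Prod.snd_sub]
  nlinarith [sq_nonneg (X.1 + Y.1), sq_nonneg (X.2 + Y.2)]

/-- the instantaneous a priori estimate of stage 1 -/
lemma stage1_inst {e y : ℝ} {b0 b1 : Bool × Bool}
    {U U1 P P1 P2 Z Z1 Z2 : ℝ → ℝ × ℝ} 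
    (hU : D2 U U1) (hP : Gr2 e b0 b1 U 0 0 P P1 P2)
    (hZ : Gr2 e b0 b1 (fun x => U x - P x) 0 0 Z Z1 Z2)
    (hb0 : b0.2 = true) (hb1 : b1.2 = true) (hu0 : (U 0).2 = 0) (hu1 : (U 1).2 = 0)
    (hP1 : ∀ x ∈ I, |(P1 x).1| ≤ y ∧ |(P1 x).2| ≤ y)
    (hZ1 : ∀ x ∈ I, |(Z1 x).1| ≤ y ∧ |(Z1 x).2| ≤ y) :
    |∫ x in (0:ℝ)..1, cf (U x) (U x - P x - Z x) (U1 x)|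
      ≤ 20 * y * ∫ x in (0:ℝ)..1, sq (U x - P x) := by
  have hy : 0 ≤ y := (abs_nonneg _).trans (hP1 0 zero_mem).1
  have hW : D2 (fun x => U x - P x) (fun x => U1 x - P1 x) := hU.sub hP.h1
  have cP := hP.h1.cont
  have cP1 := hP.h2.cont
  have cP2 := hP.h2.cont'
  have cU := hU.cont
  have cU1 := hU.cont'
  have cZ := hZ.h1.cont
  have cZ1 := hZ.h2.cont
  have e0 : Endok b0 (P 0) (P1 0) (U 0 - P 0) := by
    have a := hP.snd.l0 hb0
    obtain ⟨b, b'⟩ := b0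
    simp only at hb0; subst hb0
    cases b
    · right; exact ⟨a, hP.fst.l1 rfl, Or.inl ⟨rfl, by simp only [Prod.snd_sub, hu0, a]; simp⟩⟩
    · left; exact ⟨rfl, Prod.ext (hP.fst.l0 rfl) a⟩
  have e1 : Endok b1 (P 1) (P1 1) (U 1 - P 1) := by
    have a := hP.snd.r0 hb1
    obtain ⟨b, b'⟩ := b1
    simp only at hb1; subst hb1
    cases b
    · right; exact ⟨a, hP.fst.r1 rfl, Or.inl ⟨rfl, by simp only [Prod.snd_sub, hu1, a]; simp⟩⟩
    · left; exact ⟨rfl, Prod.ext (hP.fst.r0 rfl) a⟩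
  have k := core hP.h1 hP.h2 hU hP hZ e0 e1
  -- the cubic part
  have hG := ((hW.cf hW hW).smul (1/3)).sub ((hZ.h1.cf hW hW).smul (1/2))
  have hi := hG.int
  have p0 := hP.snd.l0 hb0
  have p1 := hP.snd.r0 hb1
  have z0 := hZ.snd.l0 hb0
  have z1 := hZ.snd.r0 hb1
  simp only [Prod.snd_zero] at p0 p1 z0 z1
  have k2 : ∫ x in (0:ℝ)..1, cf (U x - P x) (U x - P x - Z x) (U1 x) =
      ∫ x in (0:ℝ)..1, ((1/2) * cf (Z1 x) (U x - P x) (U x - P x)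
        + cf (P1 x) (U x - P x - Z x) (U x - P x)) := by
    have hi' : (∫ x in (0:ℝ)..1, (cf (U x - P x) (U x - P x - Z x) (U1 x) -
       ((1/2) * cf (Z1 x) (U x - P x) (U x - P x)
        + cf (P1 x) (U x - P x - Z x) (U x - P x)))) = 0 := by
      refine Eq.trans (int_congr fun x hx => ?_) (hi.trans ?_)
      · simp only [cf, Prod.fst_sub, Prod.snd_sub]; ring
      · simp only [cf, Prod.fst_sub, Prod.snd_sub, p0, p1, z0, z1, hu0, hu1]; ring
    rw [integral_sub (cii (by fun_prop)) (cii (by fun_prop))] at hi'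
    linarith
  have k3 : ∫ x in (0:ℝ)..1, cf (U x) (U x - P x - Z x) (U1 x) =
      (∫ x in (0:ℝ)..1, cf (P x) (U x - P x - Z x) (U1 x)) +
      ∫ x in (0:ℝ)..1, cf (U x - P x) (U x - P x - Z x) (U1 x) := by
    rw [← integral_add (cii (by fun_prop)) (cii (by fun_prop))]
    exact int_congr fun x _ => by simp only [cf, Prod.fst_sub, Prod.snd_sub]; ring
  rw [k3, k, k2, ← integral_add (cii (by fun_prop)) (cii (by fun_prop))]
  have hen := hZ.energy
  have step : |∫ x in (0:ℝ)..1, ((-(1/2) * cf (P1 x) (U x - P x) (U x - P x) + 2 * cf (P1 x) (Z x) (U x - P x)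
        - e ^ 2 * cf (P2 x) (Z x) (P1 x)) + ((1/2) * cf (Z1 x) (U x - P x) (U x - P x)
        + cf (P1 x) (U x - P x - Z x) (U x - P x)))| ≤
        ∫ x in (0:ℝ)..1, y * (10 * sq (U x - P x) + 10 * sq (Z x)) := by
    apply int_abs_le (by fun_prop) (by fun_prop)
    intro x hx
    have t3 : e ^ 2 * cf (P2 x) (Z x) (P1 x) = - cf (P1 x) (Z x) (U x - P x) := by
      have a1 := hP.fst.eq x hx
      have a2 := hP.snd.eq x hx
      simp only [cf, Prod.fst_sub, Prod.snd_sub]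
      linear_combination 
        (-(1/2) * ((Z x).1 * (P1 x).2 + (Z x).2 * (P1 x).1)) * a1 +
        (-(1/2) * ((Z x).1 * (P1 x).1 + 3 * (Z x).2 * (P1 x).2)) * a2
    rw [t3]
    set W := U x - P x with hWd
    have b1 := abs_le.1 (cf_le (X := W) (Y := W) (hP1 x hx).1 (hP1 x hx).2)
    have b2 := abs_le.1 (cf_le (X := Z x) (Y := W) (hP1 x hx).1 (hP1 x hx).2)
    have b3 := abs_le.1 (cf_le (X := W) (Y := W) (hZ1 x hx).1 (hZ1 x hx).2)
    have b4 := abs_le.1 (cf_le (X := W - Z x) (Y := W) (hP1 x hx).1 (hP1 x hx).2)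
    have b5 : y * sq (W - Z x) ≤ y * (2 * sq W + 2 * sq (Z x)) :=
      mul_le_mul_of_nonneg_left (sq_sub_le _ _) hy
    have q1 : 0 ≤ y * sq W := mul_nonneg hy (sq_nn _)
    have q2 : 0 ≤ y * sq (Z x) := mul_nonneg hy (sq_nn _)
    rw [abs_le]
    constructor <;> nlinarith
  refine step.trans ?_
  rw [intervalIntegral.integral_const_mul, integral_add (cii (by fun_prop)) (cii (by fun_prop)),
    intervalIntegral.integral_const_mul, intervalIntegral.integral_const_mul]
  nlinarith [mul_le_mul_of_nonneg_left hen hy]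

end SW
end

noncomputable section
open Set

namespace SW
open MeasureTheory Filter Topology
open intervalIntegral hiding integral_const_mul

/-- uniform differentiability in time at `t` -/
def UD (J : Set ℝ) (F : ℝ → ℝ → ℝ) (G : ℝ → ℝ) (t : ℝ) : Prop :=
  ∀ κ > 0, ∃ δ > 0, ∀ s ∈ J, |s - t| < δ → ∀ x ∈ I, |F s x - F t x - (s - t) * G x| ≤ κ * |s - t|

lemma UD_of_joint {c d : ℝ} {F Ft : ℝ → ℝ → ℝ}
    (h : ∀ t ∈ Icc c d, ∀ x ∈ I, HasDerivWithinAt (fun s => F s x) (Ft t x) (Icc c d) t)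
    (hc : ContinuousOn (fun p : ℝ × ℝ => Ft p.1 p.2) (Icc c d ×ˢ I)) :
    ∀ t ∈ Icc c d, UD (Icc c d) F (Ft t) t := by
  intro t ht κ hκ
  have hcomp : IsCompact (Icc c d ×ˢ I) := isCompact_Icc.prod isCompact_Icc
  have huc := hcomp.uniformContinuousOn_of_continuous hc
  rw [Metric.uniformContinuousOn_iff] at huc
  obtain ⟨δ, hδ, hu⟩ := huc κ hκ
  refine ⟨δ, hδ, fun s hs hst x hx => ?_⟩
  have hsub : uIcc t s ⊆ Icc c d := (convex_Icc c d).ordConnected.uIcc_subset ht hs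
  have key := (convex_uIcc t s).norm_image_sub_le_of_norm_hasDerivWithin_le
    (f := fun σ => F σ x - σ * Ft t x) (f' := fun σ => Ft σ x - Ft t x) (C := κ) (x := t) (y := s)
    (fun σ hσ => by
      have a := (h σ (hsub hσ) x hx).mono hsub
      have b := ((hasDerivWithinAt_id σ (uIcc t s)).mul_const (Ft t x))
      exact (a.sub b).congr_deriv (by simp))
    (fun σ hσ => by
      have hd : dist (σ, x) (t, x) < δ := by
        rw [Prod.dist_eq, dist_self, Real.dist_eq]
        have : |σ - t| ≤ |s - t| := abs_sub_left_of_mem_uIcc hσ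
        exact max_lt (this.trans_lt hst) hδ
      have := hu (σ, x) ⟨hsub hσ, hx⟩ (t, x) ⟨ht, hx⟩ hd
      rw [Real.dist_eq] at this
      exact this.le) left_mem_uIcc right_mem_uIcc
  simp only [Real.norm_eq_abs] at key
  have e : F s x - F t x - (s - t) * Ft t x = F s x - s * Ft t x - (F t x - t * Ft t x) := by ring
  rw [e]; exact key

lemma bdd_of_cont {f : ℝ → ℝ} (hf : ContinuousOn f I) : ∃ M, 0 ≤ M ∧ ∀ x ∈ I, |f x| ≤ M := by
  obtain ⟨M, hM⟩ := isCompact_Icc.exists_bound_of_continuousOn hf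
  exact ⟨M, (abs_nonneg _).trans (hM 0 zero_mem), hM⟩

lemma deriv_sq {J : Set ℝ} {W : ℝ → ℝ → ℝ} {G : ℝ → ℝ} {t : ℝ} (ht : t ∈ J) (h : UD J W G t)
    (hW : ∀ s ∈ J, ContinuousOn (W s) I) (hG : ContinuousOn G I) :
    HasDerivWithinAt (fun s => ∫ x in (0:ℝ)..1, (W s x) ^ 2)
      (2 * ∫ x in (0:ℝ)..1, W t x * G x) J t := by
  obtain ⟨M, hM0, hM⟩ := bdd_of_cont hG
  obtain ⟨N, hN0, hN⟩ := bdd_of_cont (hW t ht)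
  rw [hasDerivWithinAt_iff_isLittleO, Asymptotics.isLittleO_iff]
  intro κ0 hκ0
  set κ := min 1 (κ0 / (4 * (N + 1))) with hκd
  have hκ : 0 < κ := lt_min one_pos (by positivity)
  obtain ⟨δ, hδ, hu⟩ := h κ hκ
  set δ' := min δ (κ0 / (2 * (1 + M) ^ 2)) with hδ'
  have hδ'0 : 0 < δ' := lt_min hδ (by positivity)
  rw [eventually_nhdsWithin_iff, Metric.eventually_nhds_iff]
  refine ⟨δ', hδ'0, fun s hs hsJ => ?_⟩
  rw [Real.dist_eq] at hs
  have hs1 : |s - t| < δ := hs.trans_le (min_le_left _ _)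
  have hs2 : |s - t| ≤ κ0 / (2 * (1 + M) ^ 2) := hs.le.trans (min_le_right _ _)
  have cW := hW s hsJ
  have cW0 := hW t ht
  have e1 : (∫ x in (0:ℝ)..1, (W s x) ^ 2) - (∫ x in (0:ℝ)..1, (W t x) ^ 2)
      - (s - t) * (2 * ∫ x in (0:ℝ)..1, W t x * G x) =
      ∫ x in (0:ℝ)..1, ((W s x - W t x) ^ 2 + 2 * W t x * (W s x - W t x - (s - t) * G x)) := by
    rw [← intervalIntegral.integral_const_mul, ← intervalIntegral.integral_const_mul,
      ← integral_sub (cii (by fun_prop)) (cii (by fun_prop)),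
      ← integral_sub (cii (by fun_prop)) (cii (by fun_prop))]
    exact int_congr fun x _ => by ring
  simp only [smul_eq_mul, Real.norm_eq_abs]
  rw [e1]
  have b : ∀ x ∈ I, |(W s x - W t x) ^ 2 + 2 * W t x * (W s x - W t x - (s - t) * G x)|
      ≤ κ0 * |s - t| := by
    intro x hx
    have a1 := hu s hsJ hs1 x hx
    have a2 : |(s - t) * G x| ≤ |s - t| * M := by
      rw [abs_mul]; exact mul_le_mul_of_nonneg_left (hM x hx) (abs_nonneg _)
    have a3 : |W s x - W t x| ≤ |s - t| * (1 + M) := by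
      have : W s x - W t x = (W s x - W t x - (s - t) * G x) + (s - t) * G x := by ring
      rw [this]
      refine (abs_add_le _ _).trans ?_
      have : κ * |s - t| ≤ 1 * |s - t| := mul_le_mul_of_nonneg_right (min_le_left _ _) (abs_nonneg _)
      linarith
    have a4 : |(W s x - W t x) ^ 2| ≤ (κ0 / 2) * |s - t| := by
      rw [abs_pow]
      calc |W s x - W t x| ^ 2 ≤ (|s - t| * (1 + M)) ^ 2 := pow_le_pow_left₀ (abs_nonneg _) a3 2
        _ = |s - t| * (1 + M) ^ 2 * |s - t| := by ring
        _ ≤ (κ0 / (2 * (1 + M) ^ 2)) * (1 + M) ^ 2 * |s - t| := by gcongr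
        _ = _ := by field_simp
    have a5 : |2 * W t x * (W s x - W t x - (s - t) * G x)| ≤ (κ0 / 2) * |s - t| := by
      rw [abs_mul, abs_mul, abs_two]
      calc 2 * |W t x| * |W s x - W t x - (s - t) * G x| ≤ 2 * N * (κ * |s - t|) := by
            gcongr; exact hN x hx
        _ ≤ 2 * (N + 1) * ((κ0 / (4 * (N + 1))) * |s - t|) := by
            gcongr
            · linarith
            · exact min_le_right _ _
        _ = _ := by field_simp; ring
    refine (abs_add_le _ _).trans ?_
    linarith
  calc _ ≤ ∫ x in (0:ℝ)..1, κ0 * |s - t| := int_abs_le (by fun_prop) (by fun_prop) b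
    _ = _ := by simp

lemma time_deriv {e lam : ℝ} (he : 0 < e) (hl : |lam| ≤ 1) {b0 b1 : Bool} {J : Set ℝ} {t : ℝ}
    (ht : t ∈ J) {F P P1 P2 : ℝ → ℝ → ℝ} {G R R1 R2 : ℝ → ℝ}
    (hF : UD J F G t) 
    (hP : ∀ s ∈ J, Gr e b0 b1 (F s) (lam * F s 0) (lam * F s 1) (P s) (P1 s) (P2 s))
    (hR : Gr e b0 b1 G (lam * G 0) (lam * G 1) R R1 R2) :
    HasDerivWithinAt (fun s => ∫ x in (0:ℝ)..1, (F s x - P s x) ^ 2)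
      (2 * ∫ x in (0:ℝ)..1, (F t x - P t x) * (G x - R x)) J t := by
  apply deriv_sq (W := fun s x => F s x - P s x) (G := fun x => G x - R x) ht
  · intro κ hκ
    obtain ⟨δ, hδ, h⟩ := hF (κ / 2) (by positivity)
    refine ⟨δ, hδ, fun s hs hst x hx => ?_⟩
    have hD := ((hP s hs).sub (hP t ht)).sub (hR.smul (s - t))
    have a := fun x hx => h s hs hst x hx
    have hlam : ∀ z : ℝ, |z| ≤ κ / 2 * |s - t| → |lam * z| ≤ κ / 2 * |s - t| := fun z hz => by
      rw [abs_mul]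
      calc |lam| * |z| ≤ 1 * |z| := mul_le_mul_of_nonneg_right hl (abs_nonneg _)
        _ ≤ _ := by rw [one_mul]; exact hz
    have b := hD.abs_le he (m := κ / 2 * |s - t|) a
      (by
        have := hlam _ (a 0 zero_mem)
        convert this using 2; ring)
      (by
        have := hlam _ (a 1 one_mem)
        convert this using 2; ring) x hx
    have e1 : F s x - P s x - (F t x - P t x) - (s - t) * (G x - R x)
      = (F s x - F t x - (s - t) * G x) - (P s x - P t x - (s - t) * R x) := by ring
    rw [e1]
    refine (abs_sub _ _).trans ?_
    have := a x hx
    linarith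
  · intro s hs
    exact ((hP s hs).cont_rhs).sub (hP s hs).h1.cont
  · exact hR.cont_rhs.sub hR.h1.cont

end SW
end

noncomputable section
open Set

namespace SW
open MeasureTheory Filter Topology
open intervalIntegral hiding integral_const_mul

open Polynomial in
/-- test polynomials vanishing to order `m` at both ends -/
def tp (m : ℕ) (q : Polynomial ℝ) : Polynomial ℝ := (X * (1 - X)) ^ m * q

lemma tp_zero (m : ℕ) (q : Polynomial ℝ) {j : ℕ} (hj : j < m) :
    (Polynomial.derivative^[j] (tp m q)).eval 0 = 0 ∧
    (Polynomial.derivative^[j] (tp m q)).eval 1 = 0 := by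
  have h1 : (Polynomial.X * (1 - Polynomial.X) : Polynomial ℝ) ∣
      Polynomial.derivative^[j] (tp m q) := by
    have := Polynomial.pow_sub_dvd_iterate_derivative_of_pow_dvd (p := tp m q)
      (q := (Polynomial.X * (1 - Polynomial.X) : Polynomial ℝ)) (n := m) j (Dvd.intro _ rfl)
    exact (dvd_pow_self _ (by omega)).trans this
  obtain ⟨s, hs⟩ := h1
  rw [hs]; simp

lemma D.poly (p : Polynomial ℝ) : D (fun x => p.eval x) (fun x => p.derivative.eval x) :=
  ⟨fun x _ => (p.hasDerivAt x).hasDerivWithinAt, p.derivative.continuous.continuousOn⟩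

lemma poly_cont (p : Polynomial ℝ) : ContinuousOn (fun x => p.eval x) I := p.continuous.continuousOn

lemma ibp_one {f f' : ℝ → ℝ} (h : D f f') {p : Polynomial ℝ} (h0 : p.eval 0 = 0)
    (h1 : p.eval 1 = 0) : ∫ x in (0:ℝ)..1, f' x * p.eval x
      = - ∫ x in (0:ℝ)..1, f x * p.derivative.eval x := by
  have := (h.mul (D.poly p)).int
  have c1 := h.cont
  have c2 := h.2
  have c3 := poly_cont p
  have c4 := poly_cont p.derivative
  rw [integral_add (cii (by fun_prop)) (cii (by fun_prop)), h0, h1] at this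
  linarith

lemma ibp {f : ℕ → ℝ → ℝ} {m : ℕ} (h : ∀ j < m, D (f j) (f (j+1))) (q : Polynomial ℝ) :
    ∫ x in (0:ℝ)..1, f m x * (tp m q).eval x
      = (-1) ^ m * ∫ x in (0:ℝ)..1, f 0 x * (Polynomial.derivative^[m] (tp m q)).eval x := by
  have key : ∀ j ≤ m, ∫ x in (0:ℝ)..1, f m x * (tp m q).eval x
      = (-1) ^ j * ∫ x in (0:ℝ)..1, f (m - j) x * (Polynomial.derivative^[j] (tp m q)).eval x := by
    intro j
    induction j with
    | zero => intro _; simp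
    | succ j ih =>
      intro hj
      rw [ih (by omega)]
      have hD := h (m - (j + 1)) (by omega)
      rw [show m - (j + 1) + 1 = m - j by omega] at hD
      have hz := tp_zero m q (show j < m by omega)
      rw [ibp_one hD hz.1 hz.2, Function.iterate_succ_apply']
      ring
  have := key m le_rfl
  simpa using this

/-- duality characterisation of the `L²` norm -/
lemma duality {V : ℝ → ℝ} (hV : ContinuousOn V I) {B : ℝ} (hB : 0 ≤ B) (m : ℕ)
    (h : ∀ q : Polynomial ℝ, |∫ x in (0:ℝ)..1, V x * (tp m q).eval x|
      ≤ B * nrm (fun x => (tp m q).eval x)) : nrm V ≤ B := by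
  set ω : ℝ → ℝ := fun x => (x * (1 - x)) ^ m with hω
  have cω : Continuous ω := by fun_prop
  have hω0 : ∀ x ∈ I, 0 ≤ ω x := fun x hx =>
    pow_nonneg (mul_nonneg hx.1 (by linarith [hx.2])) m
  have hω1 : ∀ x ∈ I, ω x ≤ 1 := fun x hx =>
    pow_le_one₀ (mul_nonneg hx.1 (by linarith [hx.2])) (by nlinarith [hx.1, hx.2])
  have etp : ∀ q : Polynomial ℝ, ∀ x, (tp m q).eval x = ω x * q.eval x := fun q x => by
    simp [tp, hω]
  have cωI : ContinuousOn ω I := cω.continuousOn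
  obtain ⟨M, hM0, hM⟩ := bdd_of_cont hV
  -- extend to continuous g
  have hg : ∀ g : ℝ → ℝ, ContinuousOn g I → |∫ x in (0:ℝ)..1, V x * (ω x * g x)|
      ≤ B * nrm (fun x => ω x * g x) := by
    intro g cg
    apply le_of_forall_pos_le_add
    intro κ hκ
    set κ' := κ / (M + B + 1) with hκ'
    have hκ'0 : 0 < κ' := by positivity
    obtain ⟨q, hq⟩ := exists_polynomial_near_of_continuousOn 0 1 g cg κ' hκ'0
    have cq := poly_cont q
    have h1 := h q
    simp only [etp] at h1
    have h2 : |∫ x in (0:ℝ)..1, V x * (ω x * (g x - q.eval x))| ≤ M * κ' := by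
      calc _ ≤ ∫ x in (0:ℝ)..1, M * κ' := int_abs_le (by fun_prop) (by fun_prop) fun x hx => by
            rw [abs_mul, abs_mul]
            have a1 := hM x hx
            have a2 : |ω x| ≤ 1 := by rw [abs_of_nonneg (hω0 x hx)]; exact hω1 x hx
            have a3 : |g x - q.eval x| ≤ κ' := by rw [abs_sub_comm]; exact (hq x hx).le
            calc _ ≤ M * (1 * κ') := by gcongr
              _ = _ := by ring
        _ = _ := by simp
    have h3 : nrm (fun x => ω x * (q.eval x - g x)) ≤ κ' :=
      nrm_le_sup hκ'0.le (by fun_prop) fun x hx => by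
        rw [abs_mul]
        have a2 : |ω x| ≤ 1 := by rw [abs_of_nonneg (hω0 x hx)]; exact hω1 x hx
        have a3 : |q.eval x - g x| ≤ κ' := (hq x hx).le
        calc _ ≤ 1 * κ' := by gcongr
          _ = _ := by ring
    have h4 : nrm (fun x => ω x * q.eval x) ≤ nrm (fun x => ω x * g x) + κ' := by
      have := nrm_add (f := fun x => ω x * g x) (g := fun x => ω x * (q.eval x - g x))
        (by fun_prop) (by fun_prop)
      have e : (fun x => ω x * g x + ω x * (q.eval x - g x)) = fun x => ω x * q.eval x := by
        funext x; ring
      rw [e] at this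
      linarith
    have h5 : ∫ x in (0:ℝ)..1, V x * (ω x * g x) = (∫ x in (0:ℝ)..1, V x * (ω x * q.eval x))
        + ∫ x in (0:ℝ)..1, V x * (ω x * (g x - q.eval x)) := by
      rw [← integral_add (cii (by fun_prop)) (cii (by fun_prop))]
      exact int_congr fun x _ => by ring
    rw [h5]
    refine (abs_add_le _ _).trans ?_
    have h6 : B * nrm (fun x => ω x * q.eval x) ≤ B * (nrm (fun x => ω x * g x) + κ') :=
      mul_le_mul_of_nonneg_left h4 hB
    have h7 : (M + B) * κ' ≤ κ := by
      rw [hκ', mul_div_assoc', div_le_iff₀ (by positivity)]; nlinarith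
    nlinarith
  -- approximate
  have hθ : ∀ θ : ℝ, 0 < θ → ∫ x in (0:ℝ)..1, V x ^ 2 * (ω x / (ω x + θ)) ≤ B ^ 2 := by
    intro θ hθ
    have hpos : ∀ x ∈ I, ω x + θ ≠ 0 := fun x hx => by have := hω0 x hx; positivity
    have cg : ContinuousOn (fun x => V x / (ω x + θ)) I := hV.div (by fun_prop) hpos
    have cr : ContinuousOn (fun x => ω x / (ω x + θ)) I := cωI.div (by fun_prop) hpos
    have h1 := hg _ cg
    have e1 : ∫ x in (0:ℝ)..1, V x * (ω x * (V x / (ω x + θ)))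
      = ∫ x in (0:ℝ)..1, V x ^ 2 * (ω x / (ω x + θ)) := int_congr fun x _ => by ring
    rw [e1] at h1
    set A := ∫ x in (0:ℝ)..1, V x ^ 2 * (ω x / (ω x + θ)) with hA
    have hr : ∀ x ∈ I, 0 ≤ ω x / (ω x + θ) ∧ ω x / (ω x + θ) ≤ 1 := fun x hx => by
      have := hω0 x hx
      exact ⟨by positivity, by rw [div_le_one (by positivity)]; linarith⟩
    have hA0 : 0 ≤ A := int_nonneg fun x hx => mul_nonneg (sq_nonneg _) (hr x hx).1
    have h2 : nrm (fun x => ω x * (V x / (ω x + θ))) ^ 2 ≤ A := by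
      rw [nrm_sq]
      apply int_mono (by fun_prop) (by fun_prop)
      intro x hx
      have := hr x hx
      have e : (ω x * (V x / (ω x + θ))) ^ 2 = V x ^ 2 * (ω x / (ω x + θ)) * (ω x / (ω x + θ)) := by
        ring
      rw [e]
      exact mul_le_of_le_one_right (mul_nonneg (sq_nonneg _) this.1) this.2
    set n := nrm (fun x => ω x * (V x / (ω x + θ))) with hn
    have hn0 : 0 ≤ n := nrm_nonneg _
    have h3 : A ≤ B * n := le_of_abs_le h1
    nlinarith [sq_nonneg (B - n)]
  apply nrm_le_of_sq hB
  have lim : Tendsto (fun n : ℕ => ∫ x in (0:ℝ)..1, V x ^ 2 * (ω x / (ω x + 1 / ((n:ℝ) + 1)))) atTop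
      (𝓝 (∫ x in (0:ℝ)..1, V x ^ 2)) := by
    apply intervalIntegral.tendsto_integral_filter_of_dominated_convergence (fun _ => M ^ 2)
    · refine Eventually.of_forall fun n => ?_
      have hpos : ∀ x ∈ I, ω x + 1 / ((n:ℝ) + 1) ≠ 0 := fun x hx => by
        have := hω0 x hx; positivity
      have : ContinuousOn (fun x => V x ^ 2 * (ω x / (ω x + 1 / ((n:ℝ) + 1)))) I :=
        (hV.pow 2).mul (cωI.div (by fun_prop) hpos)
      rw [uIoc_of_le zero_le_one]
      exact (this.mono Ioc_subset_Icc_self).aestronglyMeasurable measurableSet_Ioc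
    · refine Eventually.of_forall fun n => Eventually.of_forall fun x hx => ?_
      rw [uIoc_of_le zero_le_one] at hx
      have hx := Ioc_subset_Icc_self hx
      have := hω0 x hx
      have hp : 0 < 1 / ((n:ℝ) + 1) := by positivity
      have h1 : |ω x / (ω x + 1 / ((n:ℝ) + 1))| ≤ 1 := by
        rw [abs_of_nonneg (by positivity), div_le_one (by positivity)]; linarith
      rw [Real.norm_eq_abs, abs_mul, abs_pow]
      calc _ ≤ M ^ 2 * 1 := by gcongr; exact hM x hx
        _ = _ := by ring
    · exact intervalIntegrable_const
    · have hne : ∀ᵐ x : ℝ, x ≠ 1 := by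
        simp [ae_iff, measure_singleton]
      filter_upwards [hne] with x hx1 hx
      rw [uIoc_of_le zero_le_one] at hx
      have hωp : 0 < ω x := pow_pos (mul_pos hx.1 (sub_pos.2 (lt_of_le_of_ne hx.2 hx1))) m
      have l1 : Tendsto (fun n : ℕ => ω x + 1 / ((n:ℝ) + 1)) atTop (𝓝 (ω x + 0)) :=
        tendsto_const_nhds.add tendsto_one_div_add_atTop_nhds_zero_nat
      have l2 := (tendsto_const_nhds (x := V x ^ 2)).mul
        ((tendsto_const_nhds (x := ω x)).div l1 (by linarith))
      have e : V x ^ 2 * (ω x / (ω x + 0)) = V x ^ 2 := by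
        rw [add_zero, div_self hωp.ne', mul_one]
      rwa [e] at l2
  exact le_of_tendsto' lim fun n => hθ _ (by positivity)

end SW
end

noncomputable section
open Set

namespace SW
open MeasureTheory Filter Topology
open intervalIntegral hiding integral_const_mul

lemma limit_lemma {f : ℕ → ℝ → ℝ} (h : ∀ j < 2, D (f j) (f (j+1))) {K : ℝ} (hK : 0 ≤ K)
    (hP : ∀ e > 0, ∃ P P1 P2, D P P1 ∧ D P1 P2 ∧ (∀ x ∈ I, P x - e ^ 2 * P2 x = f 0 x) ∧
      nrm P2 ≤ K) : nrm (f 2) ≤ K := by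
  apply duality (h 1 (by norm_num)).2 hK 2
  intro q
  have c0 := (h 0 (by norm_num)).cont
  set φ := tp 2 q
  set φ2 := Polynomial.derivative^[2] φ
  have cφ := poly_cont φ
  have cφ2 := poly_cont φ2
  set B := K * nrm (fun x => φ2.eval x) with hB
  have hB0 : 0 ≤ B := mul_nonneg hK (nrm_nonneg _)
  have main : ∀ e > 0, |∫ x in (0:ℝ)..1, f 2 x * φ.eval x| ≤ K * nrm (fun x => φ.eval x) + e ^ 2 * B := by
    intro e he
    obtain ⟨P, P1, P2, h1, h2, heq, hn⟩ := hP e he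
    have i1 := ibp h q
    have i2 := ibp (f := fun j => if j = 0 then P else if j = 1 then P1 else P2) (m := 2) (by
      intro j hj
      interval_cases j
      · simpa using h1
      · simpa using h2) q
    simp only [if_true, show (2:ℕ) ≠ 0 by norm_num, show (2:ℕ) ≠ 1 by norm_num, if_false] at i2
    have cP := h1.cont
    have cP2 := h2.2
    have e3 : ∫ x in (0:ℝ)..1, f 2 x * φ.eval x = (∫ x in (0:ℝ)..1, P2 x * φ.eval x)
        - e ^ 2 * ∫ x in (0:ℝ)..1, P2 x * φ2.eval x := by
      rw [i1, i2, neg_one_sq, one_mul, one_mul, ← intervalIntegral.integral_const_mul,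
        ← integral_sub (cii (by fun_prop)) (cii (by fun_prop))]
      apply int_congr
      intro x hx
      rw [← heq x hx]; ring
    rw [e3]
    have a1 := cs cP2 cφ
    have a2 := cs cP2 cφ2
    have a3 : nrm P2 * nrm (fun x => φ.eval x) ≤ K * nrm (fun x => φ.eval x) :=
      mul_le_mul_of_nonneg_right hn (nrm_nonneg _)
    have a4 : nrm P2 * nrm (fun x => φ2.eval x) ≤ B :=
      mul_le_mul_of_nonneg_right hn (nrm_nonneg _)
    have a5 := abs_sub (∫ x in (0:ℝ)..1, P2 x * φ.eval x) (e ^ 2 * ∫ x in (0:ℝ)..1, P2 x * φ2.eval x)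
    rw [abs_mul, abs_of_nonneg (sq_nonneg e)] at a5
    have a6 := mul_le_mul_of_nonneg_left (a2.trans a4) (sq_nonneg e)
    linarith
  apply le_of_forall_pos_le_add
  intro δ hδ
  have := main (Real.sqrt (δ / (B + 1))) (Real.sqrt_pos.2 (by positivity))
  rw [Real.sq_sqrt (by positivity)] at this
  have h3 : δ / (B + 1) * B ≤ δ := by
    rw [div_mul_eq_mul_div, div_le_iff₀ (by positivity)]; nlinarith
  linarith

lemma joint_int {T : ℝ} {f : ℝ → ℝ → ℝ} (hf : ContinuousOn (fun p : ℝ × ℝ => f p.1 p.2) (Icc 0 T ×ˢ I))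
    {g : ℝ → ℝ} (hg : ContinuousOn g I) :
    ContinuousOn (fun t => ∫ x in (0:ℝ)..1, f t x * g x) (Icc 0 T) := by
  obtain ⟨M, hM0, hM⟩ := bdd_of_cont hg
  obtain ⟨A, hA⟩ := (isCompact_Icc.prod isCompact_Icc).exists_bound_of_continuousOn hf
  intro t ht
  apply intervalIntegral.continuousWithinAt_of_dominated_interval (bound := fun _ => A * M)
  · filter_upwards [self_mem_nhdsWithin] with s hs
    have : ContinuousOn (fun x => f s x * g x) I := by
      apply ContinuousOn.mul _ hg
      exact hf.comp (f := fun x => (s, x)) (by fun_prop) (fun x hx => ⟨hs, hx⟩)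
    rw [uIoc_of_le zero_le_one]
    exact (this.mono Ioc_subset_Icc_self).aestronglyMeasurable measurableSet_Ioc
  · filter_upwards [self_mem_nhdsWithin] with s hs
    apply Eventually.of_forall
    intro x hx
    rw [uIoc_of_le zero_le_one] at hx
    have hx' := Ioc_subset_Icc_self hx
    rw [norm_mul]
    exact mul_le_mul (hA (s, x) ⟨hs, hx'⟩) (hM x hx') (norm_nonneg _)
      ((norm_nonneg _).trans (hA (s, x) ⟨hs, hx'⟩))
  · exact _root_.intervalIntegrable_const
  · apply Eventually.of_forall
    intro x hx
    rw [uIoc_of_le zero_le_one] at hx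
    have hx' := Ioc_subset_Icc_self hx
    apply ContinuousWithinAt.mul _ continuousWithinAt_const
    exact (hf.comp (f := fun s => (s, x)) (by fun_prop) (fun s hs => ⟨hs, hx'⟩)) t ht

lemma closed_lemma {T : ℝ} {f : ℕ → ℝ → ℝ → ℝ} {m : ℕ} 
    (h : ∀ t ∈ Icc 0 T, ∀ j < m, D (f j t) (f (j+1) t)) (hm : 0 < m)
    (hf : ContinuousOn (fun p : ℝ × ℝ => f 0 p.1 p.2) (Icc 0 T ×ˢ I)) {K : ℝ} (hK : 0 ≤ K) :
    IsClosed {t | t ∈ Icc 0 T ∧ nrm (f m t) ≤ K} := by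
  have : {t | t ∈ Icc 0 T ∧ nrm (f m t) ≤ K} = {t | t ∈ Icc 0 T ∧ ∀ q : Polynomial ℝ, 
      |∫ x in (0:ℝ)..1, f 0 t x * (Polynomial.derivative^[m] (tp m q)).eval x|
      ≤ K * nrm (fun x => (tp m q).eval x)} := by
    ext t
    constructor
    · rintro ⟨ht, hn⟩
      refine ⟨ht, fun q => ?_⟩
      have i := ibp (h t ht) q
      have i2 := cs (f := f m t) (by
        have := (h t ht (m-1) (by omega)).2
        rwa [Nat.sub_add_cancel hm] at this) (poly_cont (tp m q))
      rw [i, abs_mul, abs_pow, abs_neg, abs_one, one_pow, one_mul] at i2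
      exact i2.trans (mul_le_mul_of_nonneg_right hn (nrm_nonneg _))
    · rintro ⟨ht, hn⟩
      refine ⟨ht, duality (by
        have := (h t ht (m-1) (by omega)).2
        rwa [Nat.sub_add_cancel hm] at this) hK m fun q => ?_⟩
      rw [ibp (h t ht) q, abs_mul, abs_pow, abs_neg, abs_one, one_pow, one_mul]
      exact hn q
  rw [this]
  have e : {t | t ∈ Icc 0 T ∧ ∀ q : Polynomial ℝ, 
      |∫ x in (0:ℝ)..1, f 0 t x * (Polynomial.derivative^[m] (tp m q)).eval x|
      ≤ K * nrm (fun x => (tp m q).eval x)} = ⋂ q : Polynomial ℝ, {t | t ∈ Icc 0 T ∧  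
      |∫ x in (0:ℝ)..1, f 0 t x * (Polynomial.derivative^[m] (tp m q)).eval x|
      ≤ K * nrm (fun x => (tp m q).eval x)} := by
    ext t; simp only [mem_ofPred_eq, mem_iInter]
    exact ⟨fun h q => ⟨h.1, h.2 q⟩, fun h => ⟨(h 0).1, fun q => (h q).2⟩⟩
  rw [e]
  apply isClosed_iInter
  intro q
  have c := (joint_int hf (poly_cont (Polynomial.derivative^[m] (tp m q)))).abs
  exact c.preimage_isClosed_of_isClosed isClosed_Icc isClosed_Iic

/-- in a short gap of the bad set -/
lemma gap {Y : ℝ → ℝ} {C δ t0 t K : ℝ} {B : Set ℝ} (hY : ∀ t, 0 ≤ Y t) (hC : 0 ≤ C)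
    (hδ : C * δ ≤ 1 / 2) (ht : t0 ≤ t) (htδ : t - t0 ≤ δ)
    (est : ∀ c d S, t0 ≤ c → c ≤ d → d ≤ t → (∀ s ∈ Icc c d, Y s ≤ S) → 
      ∀ s ∈ Icc c d, ∀ s' ∈ Icc c d, Y s ≤ 2 * Y s' + C * (S + 1) * |s - s'|)
    (hB : IsClosed B) (h0 : t0 ∈ B) (hK : ∀ s ∈ B ∩ Icc t0 t, Y s ≤ K)
    (hgood : ∀ s ∈ Icc t0 t, s ∉ B → ∃ ε > 0, ∃ S, ∀ s' ∈ Icc t0 t, |s' - s| < ε → Y s' ≤ S) :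
    Y t ≤ 4 * K + 1 := by
  have hK0 : 0 ≤ K := (hY _).trans (hK t0 ⟨h0, le_rfl, ht⟩)
  have key : ∀ c, t0 ≤ c → c ≤ t → (∃ S, ∀ s ∈ Icc c t, Y s ≤ S) → 
      ∀ s ∈ Icc c t, ∀ s' ∈ Icc c t, Y s ≤ 4 * Y s' + 1 := by
    rintro c hc hct ⟨S, hS⟩ s hs s' hs'
    have hne : (Y '' Icc c t).Nonempty := ⟨Y c, c, ⟨le_rfl, hct⟩, rfl⟩
    have hbd : BddAbove (Y '' Icc c t) := ⟨S, by rintro _ ⟨z, hz, rfl⟩; exact hS z hz⟩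
    set S' := sSup (Y '' Icc c t) with hS'
    have h1 : ∀ z ∈ Icc c t, Y z ≤ S' := fun z hz => le_csSup hbd ⟨z, hz, rfl⟩
    have h0' : 0 ≤ S' := (hY c).trans (h1 c ⟨le_rfl, hct⟩)
    have h2 : ∀ z ∈ Icc c t, Y z ≤ 2 * Y s' + (S' + 1) / 2 := by
      intro z hz
      have := est c t S' hc hct le_rfl h1 z hz s' hs'
      have h3 : |z - s'| ≤ δ := by
        rw [abs_le]; constructor <;> linarith [hz.1, hz.2, hs'.1, hs'.2]
      have h4 : C * (S' + 1) * |z - s'| ≤ C * (S' + 1) * δ := by gcongr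
      nlinarith
    have h5 : S' ≤ 2 * Y s' + (S' + 1) / 2 := csSup_le hne (by rintro _ ⟨z, hz, rfl⟩; exact h2 z hz)
    linarith [h1 s hs]
  have hcl : IsCompact (B ∩ Icc t0 t) := (isCompact_Icc).inter_left hB
  obtain ⟨s, hs, hmax⟩ := hcl.exists_isMaxOn ⟨t0, h0, le_rfl, ht⟩ continuousOn_id
  have hsK := hK s hs
  rcases eq_or_lt_of_le hs.2.2 with rfl | hst
  · linarith
  have hfree : ∀ z ∈ Ioc s t, z ∉ B := by
    intro z hz hzB
    have := hmax ⟨hzB, hs.2.1.trans hz.1.le, hz.2⟩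
    simp only [id, mem_ofPred_eq] at this
    linarith [hz.1]
  have hb : ∀ s' ∈ Ioc s t, ∃ S, ∀ z ∈ Icc s' t, Y z ≤ S := by
    intro s' hs'
    have hc : IsCompact (Icc s' t) := isCompact_Icc
    have : ∃ S, ∀ z ∈ Icc s' t, Y z ≤ S := by
      refine hc.induction_on (p := fun A => ∃ S, ∀ z ∈ A, Y z ≤ S) ⟨0, by simp⟩ ?_ ?_ ?_
      · rintro A A' hAA ⟨S, h⟩; exact ⟨S, fun z hz => h z (hAA hz)⟩
      · rintro A A' ⟨S, h⟩ ⟨S', h'⟩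
        exact ⟨max S S', fun z hz => hz.elim (fun q => (h z q).trans (le_max_left _ _))
          (fun q => (h' z q).trans (le_max_right _ _))⟩
      · intro z hz
        obtain ⟨ε, hε, S, hS⟩ := hgood z ⟨hs.2.1.trans (hs'.1.le.trans hz.1), hz.2⟩
          (hfree z ⟨hs'.1.trans_le hz.1, hz.2⟩)
        refine ⟨Icc s' t ∩ Metric.ball z ε, inter_mem_nhdsWithin _ (Metric.ball_mem_nhds z hε), S, ?_⟩
        rintro w ⟨hw, hw'⟩
        exact hS w ⟨hs.2.1.trans (hs'.1.le.trans hw.1), hw.2⟩ hw'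
    exact this
  have hb2 : ∀ z ∈ Icc s t, Y z ≤ max (4 * Y t + 1) K := by
    intro z hz
    rcases eq_or_lt_of_le hz.1 with rfl | hlt
    · exact hsK.trans (le_max_right _ _)
    · exact (key z (hs.2.1.trans hz.1) hz.2 (hb z ⟨hlt, hz.2⟩) z ⟨le_rfl, hz.2⟩ t ⟨hz.2, le_rfl⟩).trans
        (le_max_left _ _)
  have := key s hs.2.1 hst.le ⟨_, hb2⟩ t ⟨hst.le, le_rfl⟩ s ⟨le_rfl, hst.le⟩
  linarith

lemma baire {T C : ℝ} {Y : ℝ → ℝ} (hY : ∀ t, 0 ≤ Y t) (hC : 0 ≤ C)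
    (hcl : ∀ K : ℝ, IsClosed {t | t ∈ Icc 0 T ∧ Y t ≤ K})
    (est : ∀ c d S, 0 ≤ c → c ≤ d → d ≤ T → (∀ s ∈ Icc c d, Y s ≤ S) → 
      ∀ s ∈ Icc c d, ∀ s' ∈ Icc c d, Y s ≤ 2 * Y s' + C * (S + 1) * |s - s'|) :
    ∃ K, ∀ t ∈ Icc 0 T, Y t ≤ K := by
  set B : Set ℝ := {t | t ∈ Icc 0 T ∧ ∀ ε > 0, ∀ S, ∃ s ∈ Icc 0 T, |s - t| < ε ∧ S < Y s} with hBd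
  have hBc : IsClosed B := by
    rw [isClosed_iff_clusterPt]
    intro t htB
    rw [← mem_closure_iff_clusterPt, Metric.mem_closure_iff] at htB
    refine ⟨?_, fun ε hε S => ?_⟩
    · have : closure B ⊆ Icc 0 T := closure_minimal (fun x hx => hx.1) isClosed_Icc
      exact this (Metric.mem_closure_iff.2 htB)
    · obtain ⟨b, hb, hd⟩ := htB (ε / 2) (by positivity)
      obtain ⟨s, hs, h1, h2⟩ := hb.2 (ε / 2) (by positivity) S
      refine ⟨s, hs, ?_, h2⟩
      rw [Real.dist_eq] at hd
      have := abs_sub_le s b t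
      rw [abs_sub_comm b t] at this
      linarith
  have hgood : ∀ s ∈ Icc 0 T, s ∉ B → ∃ ε > 0, ∃ S, ∀ s' ∈ Icc 0 T, |s' - s| < ε → Y s' ≤ S := by
    intro s hs hsB
    by_contra! hcon
    exact hsB ⟨hs, fun ε hε S => hcon ε hε S⟩
  by_cases hne : B.Nonempty
  · exfalso
    have : Nonempty B := hne.to_subtype
    have : CompleteSpace B := hBc.completeSpace_coe
    obtain ⟨n, x, hx⟩ := nonempty_interior_of_iUnion_of_closed (X := B) (f := fun n : ℕ => 
      (fun z : B => (z : ℝ)) ⁻¹' {t | t ∈ Icc 0 T ∧ Y t ≤ n})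
      (fun n => (hcl n).preimage continuous_subtype_val) (by
        rw [eq_univ_iff_forall]; intro z
        obtain ⟨n, hn⟩ := exists_nat_ge (Y z)
        exact mem_iUnion.2 ⟨n, z.2.1, hn⟩)
    rw [mem_interior_iff_mem_nhds, Metric.mem_nhds_iff] at hx
    obtain ⟨ε, hε, hsub⟩ := hx
    set t0 : ℝ := x.1
    have hK : ∀ s ∈ B, |s - t0| < ε → Y s ≤ n := fun s hs hd => (hsub (a := ⟨s, hs⟩) hd).2
    set δ := min (ε / 2) (1 / (2 * (C + 1))) with hδ
    have hδ0 : 0 < δ := lt_min (by positivity) (by positivity)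
    have hCδ : C * δ ≤ 1 / 2 := by
      have : δ ≤ 1 / (2 * (C + 1)) := min_le_right _ _
      calc C * δ ≤ (C + 1) * (1 / (2 * (C + 1))) := by gcongr; linarith
        _ = 1 / 2 := by field_simp
    have hδε : δ < ε := (min_le_left _ _).trans_lt (by linarith)
    obtain ⟨s, hs, hsd, hsY⟩ := x.2.2 δ hδ0 (4 * n + 1)
    have hx0 := x.2.1
    rcases le_total t0 s with hle | hle
    · rw [abs_of_nonneg (by linarith)] at hsd
      have := gap (t0 := t0) (t := s) (K := n) (δ := δ) hY hC hCδ hle hsd.le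
        (fun c d S h1 h2 h3 h4 => est c d S (hx0.1.trans h1) h2 (h3.trans hs.2) h4)
        hBc x.2 (fun z hz => hK z hz.1 (by
          rw [abs_of_nonneg (by linarith [hz.2.1])]; linarith [hz.2.2]))
        (fun z hz hzB => by
          obtain ⟨ε', h1, S, h2⟩ := hgood z ⟨hx0.1.trans hz.1, hz.2.trans hs.2⟩ hzB
          exact ⟨ε', h1, S, fun s' hs' => h2 s' ⟨hx0.1.trans hs'.1, hs'.2.trans hs.2⟩⟩)
      linarith
    · rw [abs_of_nonpos (by linarith)] at hsd
      have := gap (Y := fun z => Y (-z)) (t0 := -t0) (t := -s) (K := n) (δ := δ) (B := Neg.neg ⁻¹' B)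
        (fun z => hY _) hC hCδ (by linarith) (by linarith)
        (fun c d S h1 h2 h3 h4 w hw w' hw' => by
          have := est (-d) (-c) S (by linarith [hs.1]) (by linarith) (by linarith [hx0.2])
            (fun z hz => by
              have := h4 (-z) ⟨by linarith [hz.2], by linarith [hz.1]⟩
              simpa using this) (-w) ⟨by linarith [hw.2], by linarith [hw.1]⟩
              (-w') ⟨by linarith [hw'.2], by linarith [hw'.1]⟩
          have e : |-w - -w'| = |w - w'| := by rw [← abs_neg]; congr 1; ring
          rwa [e] at this)
        (hBc.preimage continuous_neg) (by rw [mem_preimage, neg_neg]; exact x.2) (fun z hz => hK (-z) hz.1 (by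
          rw [abs_of_nonpos (by linarith [hz.2.1])]; linarith [hz.2.2]))
        (fun z hz hzB => by
          obtain ⟨ε', h1, S, h2⟩ := hgood (-z) ⟨by linarith [hz.2, hs.1], by linarith [hz.1, hx0.2]⟩ hzB
          refine ⟨ε', h1, S, fun s' hs' hd => h2 (-s') ⟨by linarith [hs'.2, hs.1], by linarith [hs'.1, hx0.2]⟩ ?_⟩
          have e : |-s' - -z| = |s' - z| := by rw [← abs_neg]; congr 1; ring
          rwa [e])
      simp only [neg_neg] at this
      linarith
  · rw [not_nonempty_iff_eq_empty] at hne
    refine (isCompact_Icc (a := (0:ℝ)) (b := T)).induction_on (p := fun A => ∃ S, ∀ z ∈ A, Y z ≤ S) ⟨0, by simp⟩ ?_ ?_ ?_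
    · rintro A A' hAA ⟨S, h⟩; exact ⟨S, fun z hz => h z (hAA hz)⟩
    · rintro A A' ⟨S, h⟩ ⟨S', h'⟩
      exact ⟨max S S', fun z hz => hz.elim (fun q => (h z q).trans (le_max_left _ _))
        (fun q => (h' z q).trans (le_max_right _ _))⟩
    · intro z hz
      obtain ⟨ε, hε, S, hS⟩ := hgood z hz (by rw [hne]; exact notMem_empty z)
      refine ⟨Icc 0 T ∩ Metric.ball z ε, inter_mem_nhdsWithin _ (Metric.ball_mem_nhds z hε), S, ?_⟩
      rintro w ⟨hw, hw'⟩
      exact hS w hw hw'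

end SW
end

noncomputable section
open Set

namespace SW
open MeasureTheory Filter Topology
open intervalIntegral hiding integral_const_mul

lemma ode_fwd {f f' : ℝ → ℝ} {b d C A : ℝ} (hbd : b ≤ d) (hC : 0 ≤ C)
    (hf : ∀ t ∈ Icc b d, HasDerivWithinAt f (f' t) (Icc b d) t)
    (hb : ∀ t ∈ Icc b d, f' t ≤ C * √(f t) * f t) (hA : 0 < A) (hfb : f b ≤ A)
    (hd : (d - b) * (8 * C * A * √A + 1) ≤ 3 * A) : f d ≤ 4 * A := by
  set L := 8 * C * A * √A + 1 with hL
  have hL0 : 0 < L := by positivity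
  have key : ∀ ⦃x⦄, x ∈ Icc b d → f x ≤ A + L * (x - b) := by
    apply image_le_of_deriv_right_lt_deriv_boundary' (f := f) (f' := f') (B := fun x => A + L * (x - b)) (B' := fun _ => L)
    · exact fun x hx => (hf x hx).continuousWithinAt
    · intro x hx
      exact (hf x (Ico_subset_Icc_self hx)).mono_of_mem_nhdsWithin (Icc_mem_nhdsGE_of_mem hx)
    · simpa using hfb
    · fun_prop
    · intro x hx
      have : HasDerivAt (fun x => A + L * (x - b)) L x := by
        simpa using (((hasDerivAt_id x).sub_const b).const_mul L).const_add A
      exact this.hasDerivWithinAt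
    · intro x hx heq
      have h1 : f x ≤ 4 * A := by
        rw [heq]
        nlinarith [hx.1, hx.2]
      have hx0 : 0 ≤ f x := by rw [heq]; nlinarith [hx.1]
      have h2 : √(f x) ≤ 2 * √A := by
        rw [show 2 * √A = √(4 * A) by
          rw [Real.sqrt_mul (by norm_num), show (4:ℝ) = 2 ^ 2 by norm_num, Real.sqrt_sq (by norm_num)]]
        exact Real.sqrt_le_sqrt h1
      calc f' x ≤ C * √(f x) * f x := hb x (Ico_subset_Icc_self hx)
        _ ≤ C * (2 * √A) * (4 * A) := by gcongr
        _ < L := by rw [hL]; linarith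
  have := key ⟨hbd, le_rfl⟩
  nlinarith

lemma ode {f f' : ℝ → ℝ} {T b C A : ℝ} (hC : 0 ≤ C)
    (hf : ∀ t ∈ Icc 0 T, HasDerivWithinAt f (f' t) (Icc 0 T) t)
    (hb : ∀ t ∈ Icc 0 T, |f' t| ≤ C * √(f t) * f t) (hA : 0 < A) (hbT : b ∈ Icc 0 T) (hfb : f b ≤ A)
    {t : ℝ} (ht : t ∈ Icc 0 T)
    (hd : |t - b| * (8 * C * A * √A + 1) ≤ 3 * A) : f t ≤ 4 * A := by
  rcases le_total b t with h | h
  · rw [abs_of_nonneg (by linarith)] at hd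
    have hs : Icc b t ⊆ Icc 0 T := Icc_subset_Icc hbT.1 ht.2
    exact ode_fwd h hC (fun s hs' => (hf s (hs hs')).mono hs) 
      (fun s hs' => (le_abs_self _).trans (hb s (hs hs'))) hA hfb hd
  · rw [abs_of_nonpos (by linarith)] at hd
    have hs : Icc t b ⊆ Icc 0 T := Icc_subset_Icc ht.1 hbT.2
    have hs2 : ∀ s ∈ Icc (-b) (-t), -s ∈ Icc t b := fun s hs => ⟨by linarith [hs.2], by linarith [hs.1]⟩
    have := ode_fwd (f := fun s => f (-s)) (f' := fun s => - f' (-s)) (b := -b) (d := -t)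
      (C := C) (A := A) (by linarith) hC
      (fun s hs' => by
        have h1 := (hf (-s) (hs (hs2 s hs')))
        have h2 : HasDerivWithinAt (fun s : ℝ => -s) (-1) (Icc (-b) (-t)) s :=
          (hasDerivAt_neg s).hasDerivWithinAt
        have := h1.comp (h := fun s : ℝ => -s) s h2 (fun z hz => hs (hs2 z hz))
        simpa [Function.comp_def] using this)
      (fun s hs' => (neg_le_abs _).trans (hb (-s) (hs (hs2 s hs')))) hA (by simpa using hfb)
      (by rw [show -t - -b = -(t - b) by ring]; exact hd)
    simpa using this

structure Sol (T : ℝ) (r : ℕ) (a u : ℕ → ℝ → ℝ → ℝ) (av uv : ℝ → ℝ → ℝ) : Prop where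
  hT : 0 < T
  ca : ∀ t ∈ Icc 0 T, ∀ j < r, D (a j t) (a (j+1) t)
  cu : ∀ t ∈ Icc 0 T, ∀ j < r, D (u j t) (u (j+1) t)
  ja : ContinuousOn (fun p : ℝ × ℝ => a 0 p.1 p.2) (Icc 0 T ×ˢ I)
  ju : ContinuousOn (fun p : ℝ × ℝ => u 0 p.1 p.2) (Icc 0 T ×ˢ I)
  jav : ContinuousOn (fun p : ℝ × ℝ => av p.1 p.2) (Icc 0 T ×ˢ I)
  juv : ContinuousOn (fun p : ℝ × ℝ => uv p.1 p.2) (Icc 0 T ×ˢ I)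
  da : ∀ t ∈ Icc 0 T, ∀ x ∈ I, HasDerivWithinAt (fun s => a 0 s x) (av t x) (Icc 0 T) t
  du : ∀ t ∈ Icc 0 T, ∀ x ∈ I, HasDerivWithinAt (fun s => u 0 s x) (uv t x) (Icc 0 T) t
  ea : ∀ t ∈ Icc 0 T, ∀ x ∈ I, av t x = -(1/2) * (u 1 t x * a 0 t x + u 0 t x * a 1 t x)
  eu : ∀ t ∈ Icc 0 T, ∀ x ∈ I, uv t x = -((1/2) * (a 0 t x * a 1 t x) + (3/2) * (u 0 t x * u 1 t x))
  bd : ∀ t ∈ Icc 0 T, u 0 t 0 = 0 ∧ u 0 t 1 = 0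

lemma joint_slice {T : ℝ} {f : ℝ → ℝ → ℝ} (hf : ContinuousOn (fun p : ℝ × ℝ => f p.1 p.2) (Icc 0 T ×ˢ I))
    {t : ℝ} (ht : t ∈ Icc 0 T) : ContinuousOn (f t) I :=
  hf.comp (f := fun x => (t, x)) (by fun_prop) (fun _ hx => ⟨ht, hx⟩)

lemma nrm_P2 {e : ℝ} (he : 0 < e) {f P P2 : ℝ → ℝ} (h : ∀ x ∈ I, P x - e ^ 2 * P2 x = f x) :
    nrm (fun x => f x - P x) = e ^ 2 * nrm P2 := by
  have := nrm_smul (-e ^ 2) P2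
  rw [abs_of_nonpos (by nlinarith [sq_nonneg e]), neg_neg] at this
  rw [← this]
  apply nrm_congr
  intro x hx
  rw [← h x hx]; ring

lemma stage1_deriv {T : ℝ} {r : ℕ} {a u : ℕ → ℝ → ℝ → ℝ} {av uv : ℝ → ℝ → ℝ}
    (h : Sol T r a u av uv) (hr : 2 ≤ r) {e : ℝ} (he : 0 < e) (b0 b1 : Bool)
    {p p1 p2 q q1 q2 : ℝ → ℝ → ℝ}
    (hp : ∀ t ∈ Icc 0 T, Gr e b0 b1 (a 0 t) 0 0 (p t) (p1 t) (p2 t))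
    (hq : ∀ t ∈ Icc 0 T, Gr e true true (u 0 t) 0 0 (q t) (q1 t) (q2 t)) :
    ∀ t ∈ Icc 0 T, ∃ E', HasDerivWithinAt (fun s => nrm (p2 s) ^ 2 + nrm (q2 s) ^ 2) E' (Icc 0 T) t ∧
      |E'| ≤ 80 * √(nrm (p2 t) ^ 2 + nrm (q2 t) ^ 2) * (nrm (p2 t) ^ 2 + nrm (q2 t) ^ 2) := by
  intro t ht
  have hua := UD_of_joint h.da h.jav t ht
  have huu := UD_of_joint h.du h.juv t ht
  obtain ⟨R, R1, R2, hR⟩ := Gr.exists he b0 b1 (joint_slice h.jav ht) 0 0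
  obtain ⟨S, S1, S2, hS⟩ := Gr.exists he true true (joint_slice h.juv ht) 0 0
  have d1 := time_deriv (lam := 0) he (by simp) ht (F := fun s => a 0 s) hua (P := p) (P1 := p1) (P2 := p2)
    (fun s hs => by simpa using hp s hs) (by simpa using hR)
  have d2 := time_deriv (lam := 0) he (by simp) ht (F := fun s => u 0 s) huu (P := q) (P1 := q1) (P2 := q2)
    (fun s hs => by simpa using hq s hs) (by simpa using hS)
  have P_ := hp t ht
  have Q_ := hq t ht
  have Da := h.ca t ht 0 (by omega)
  have Du := h.cu t ht 0 (by omega)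
  have ca := Da.cont
  have cu := Du.cont
  have cp := P_.h1.cont
  have cq := Q_.h1.cont
  obtain ⟨z, z1, z2, hz⟩ := Gr.exists he b0 b1 (g := fun x => a 0 t x - p t x) (by fun_prop) 0 0
  obtain ⟨w, w1, w2, hw⟩ := Gr.exists he true true (g := fun x => u 0 t x - q t x) (by fun_prop) 0 0
  rw [hR.selfadj hz] at d1
  rw [hS.selfadj hw] at d2
  set y := √(nrm (p2 t) ^ 2 + nrm (q2 t) ^ 2) with hy
  have hy0 : 0 ≤ y := Real.sqrt_nonneg _
  have hyp : nrm (p2 t) ≤ y := Real.le_sqrt_of_sq_le (by nlinarith [sq_nonneg (nrm (q2 t))])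
  have hyq : nrm (q2 t) ≤ y := Real.le_sqrt_of_sq_le (by nlinarith [sq_nonneg (nrm (p2 t))])
  have bP : ∀ x ∈ I, |p1 t x| ≤ y := fun x hx => by
    obtain ⟨c, hc, h0⟩ := P_.zero_deriv
    exact (sup_le_of_zero P_.h2 hc h0 hx).trans hyp
  have bQ : ∀ x ∈ I, |q1 t x| ≤ y := fun x hx => by
    obtain ⟨c, hc, h0⟩ := Q_.zero_deriv
    exact (sup_le_of_zero Q_.h2 hc h0 hx).trans hyq
  have e2 : 0 < e ^ 2 := by positivity
  have bz2 : nrm z2 ≤ 2 * y := by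
    have h1 := nrm_P2 he hz.eq
    have h2 := nrm_sub (f := fun x => a 0 t x - p t x) (g := z) (by fun_prop) hz.h1.cont
    have h3 := hz.energy
    have h4 := nrm_P2 he P_.eq
    have : e ^ 2 * nrm z2 ≤ e ^ 2 * (2 * y) := by
      rw [← h1]; nlinarith
    exact le_of_mul_le_mul_left this e2
  have bw2 : nrm w2 ≤ 2 * y := by
    have h1 := nrm_P2 he hw.eq
    have h2 := nrm_sub (f := fun x => u 0 t x - q t x) (g := w) (by fun_prop) hw.h1.cont
    have h3 := hw.energy
    have h4 := nrm_P2 he Q_.eq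
    have : e ^ 2 * nrm w2 ≤ e ^ 2 * (2 * y) := by
      rw [← h1]; nlinarith
    exact le_of_mul_le_mul_left this e2
  have bz : ∀ x ∈ I, |z1 x| ≤ 2 * y := fun x hx => by
    obtain ⟨c, hc, h0⟩ := hz.zero_deriv
    exact (sup_le_of_zero hz.h2 hc h0 hx).trans bz2
  have bw : ∀ x ∈ I, |w1 x| ≤ 2 * y := fun x hx => by
    obtain ⟨c, hc, h0⟩ := hw.zero_deriv
    exact (sup_le_of_zero hw.h2 hc h0 hx).trans bw2
  have st := stage1_inst (e := e) (y := 2 * y) (b0 := (b0, true)) (b1 := (b1, true))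
    (U := fun x => (a 0 t x, u 0 t x)) (U1 := fun x => (a 1 t x, u 1 t x))
    (P := fun x => (p t x, q t x)) (P1 := fun x => (p1 t x, q1 t x)) (P2 := fun x => (p2 t x, q2 t x))
    (Z := fun x => (z x, w x)) (Z1 := fun x => (z1 x, w1 x)) (Z2 := fun x => (z2 x, w2 x))
    ⟨Da, Du⟩ ⟨P_, Q_⟩ ⟨hz, hw⟩ rfl rfl (h.bd t ht).1 (h.bd t ht).2
    (fun x hx => ⟨(bP x hx).trans (by linarith), (bQ x hx).trans (by linarith)⟩)
    (fun x hx => ⟨bz x hx, bw x hx⟩)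
  have cz := hz.h1.cont
  have cw := hw.h1.cont
  have cav := joint_slice h.jav ht
  have cuv := joint_slice h.juv ht
  have ca1 := Da.2
  have cu1 := Du.2
  have heq : ∫ x in (0:ℝ)..1, cf (a 0 t x, u 0 t x) ((a 0 t x, u 0 t x) - (p t x, q t x) - (z x, w x)) (a 1 t x, u 1 t x)
      = - ((∫ x in (0:ℝ)..1, (a 0 t x - p t x - z x) * av t x) + ∫ x in (0:ℝ)..1, (u 0 t x - q t x - w x) * uv t x) := by
    rw [← integral_add (cii (by fun_prop)) (cii (by fun_prop)), ← intervalIntegral.integral_neg]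
    apply int_congr
    intro x hx
    rw [h.ea t ht x hx, h.eu t ht x hx]
    simp only [cf, Prod.fst_sub, Prod.snd_sub]
    ring
  have hsq : ∫ x in (0:ℝ)..1, sq ((a 0 t x, u 0 t x) - (p t x, q t x)) = e ^ 4 * (nrm (p2 t) ^ 2 + nrm (q2 t) ^ 2) := by
    have h4 := nrm_P2 he P_.eq
    have h5 := nrm_P2 he Q_.eq
    have : e ^ 4 * (nrm (p2 t) ^ 2 + nrm (q2 t) ^ 2) = (e ^ 2 * nrm (p2 t)) ^ 2 + (e ^ 2 * nrm (q2 t)) ^ 2 := by ring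
    rw [this, ← h4, ← h5, nrm_sq, nrm_sq, ← integral_add (cii (by fun_prop)) (cii (by fun_prop))]
    rfl
  rw [heq, hsq] at st
  set A1 := ∫ x in (0:ℝ)..1, (a 0 t x - p t x - z x) * av t x
  set A2 := ∫ x in (0:ℝ)..1, (u 0 t x - q t x - w x) * uv t x
  refine ⟨(2 * A1 + 2 * A2) / e ^ 4, ?_, ?_⟩
  · refine ((d1.add d2).div_const (e ^ 4)).congr_of_mem (fun s hs => ?_) ht
    have h4 := nrm_P2 he (hp s hs).eq
    have h5 := nrm_P2 he (hq s hs).eq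
    simp only [Pi.add_apply]
    rw [← nrm_sq, ← nrm_sq, h4, h5]
    field_simp
  · rw [abs_div, abs_of_pos (show 0 < e ^ 4 by positivity), div_le_iff₀ (by positivity)]
    rw [abs_neg] at st
    have : |2 * A1 + 2 * A2| = 2 * |A1 + A2| := by
      rw [← mul_add, abs_mul, abs_of_pos (by norm_num : (0:ℝ) < 2)]
    rw [this]
    linarith

lemma stage1 {T : ℝ} {r : ℕ} {a u : ℕ → ℝ → ℝ → ℝ} {av uv : ℝ → ℝ → ℝ}
    (h : Sol T r a u av uv) (hr : 2 ≤ r) : 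
    ∃ K, 0 ≤ K ∧ ∀ t ∈ Icc 0 T, nrm (a 2 t) ≤ K ∧ nrm (u 2 t) ≤ K := by
  have main : ∃ K, ∀ t ∈ Icc 0 T, nrm (a 2 t) ≤ K ∧ nrm (u 2 t) ≤ K := by
    refine (isCompact_Icc (a := (0:ℝ)) (b := T)).induction_on
      (p := fun A => ∃ K, ∀ t ∈ A, nrm (a 2 t) ≤ K ∧ nrm (u 2 t) ≤ K) ⟨0, by simp⟩ ?_ ?_ ?_
    · rintro A A' hAA ⟨S, h⟩; exact ⟨S, fun z hz => h z (hAA hz)⟩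
    · rintro A A' ⟨S, h⟩ ⟨S', h'⟩
      refine ⟨max S S', fun z hz => hz.elim (fun q => ?_) (fun q => ?_)⟩
      · exact ⟨(h z q).1.trans (le_max_left _ _), (h z q).2.trans (le_max_left _ _)⟩
      · exact ⟨(h' z q).1.trans (le_max_right _ _), (h' z q).2.trans (le_max_right _ _)⟩
    intro b hb
    have hub := h.bd b hb
    have huv : uv b 0 = 0 ∧ uv b 1 = 0 := by
      have key : ∀ x ∈ I, (∀ t ∈ Icc 0 T, u 0 t x = 0) → uv b x = 0 := by
        intro x hx h0
        have d0 : HasDerivWithinAt (fun s => u 0 s x) 0 (Icc 0 T) b :=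
          (hasDerivWithinAt_const b (Icc 0 T) (0:ℝ)).congr_of_mem h0 hb
        exact (uniqueDiffOn_Icc h.hT b hb).eq_deriv _ (h.du b hb x hx) d0
      exact ⟨key 0 zero_mem fun t ht => (h.bd t ht).1, key 1 one_mem fun t ht => (h.bd t ht).2⟩
    set A := nrm (a 2 b) ^ 2 + nrm (u 2 b) ^ 2 + 1 with hA
    have hA0 : 0 < A := by positivity
    set L := 8 * 80 * A * √A + 1 with hL
    have hL0 : 0 < L := by positivity
    refine ⟨Icc 0 T ∩ Metric.ball b (3 * A / L), inter_mem_nhdsWithin _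
      (Metric.ball_mem_nhds b (by positivity)), √(4 * A), ?_⟩
    rintro t ⟨ht, hd⟩
    rw [Metric.mem_ball, Real.dist_eq, lt_div_iff₀ hL0] at hd
    classical
    set b0 : Bool := decide (a 0 b 0 = 0) with hb0
    set b1 : Bool := decide (a 0 b 1 = 0) with hb1
    have main : ∀ e > 0, ∃ p p1 p2 q q1 q2 : ℝ → ℝ, Gr e b0 b1 (a 0 t) 0 0 p p1 p2 ∧ 
        Gr e true true (u 0 t) 0 0 q q1 q2 ∧ nrm p2 ^ 2 + nrm q2 ^ 2 ≤ 4 * A := by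
      intro e he
      have ex1 : ∀ t, ∃ P P1 P2, t ∈ Icc 0 T → Gr e b0 b1 (a 0 t) 0 0 P P1 P2 := by
        intro t
        by_cases ht : t ∈ Icc 0 T
        · obtain ⟨P, P1, P2, h⟩ := Gr.exists he b0 b1 (h.ca t ht 0 (by omega)).cont 0 0
          exact ⟨P, P1, P2, fun _ => h⟩
        · exact ⟨0, 0, 0, fun h => absurd h ht⟩
      have ex2 : ∀ t, ∃ P P1 P2, t ∈ Icc 0 T → Gr e true true (u 0 t) 0 0 P P1 P2 := by
        intro t
        by_cases ht : t ∈ Icc 0 T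
        · obtain ⟨P, P1, P2, h⟩ := Gr.exists he true true (h.cu t ht 0 (by omega)).cont 0 0
          exact ⟨P, P1, P2, fun _ => h⟩
        · exact ⟨0, 0, 0, fun h => absurd h ht⟩
      choose p p1 p2 hp using ex1
      choose q q1 q2 hq using ex2
      refine ⟨p t, p1 t, p2 t, q t, q1 t, q2 t, hp t ht, hq t ht, ?_⟩
      have dd := stage1_deriv h hr he b0 b1 hp hq
      have dd' : ∀ t, ∃ E', t ∈ Icc 0 T → HasDerivWithinAt (fun s => nrm (p2 s) ^ 2 + nrm (q2 s) ^ 2) E' (Icc 0 T) t ∧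
        |E'| ≤ 80 * √(nrm (p2 t) ^ 2 + nrm (q2 t) ^ 2) * (nrm (p2 t) ^ 2 + nrm (q2 t) ^ 2) := by
        intro t
        by_cases ht : t ∈ Icc 0 T
        · obtain ⟨E', h⟩ := dd t ht
          exact ⟨E', fun _ => h⟩
        · exact ⟨0, fun h => absurd h ht⟩
      choose E' hE' using dd'
      refine ode (f := fun s => nrm (p2 s) ^ 2 + nrm (q2 s) ^ 2) (f' := E') (b := b) (C := 80) (by norm_num) (fun t ht => (hE' t ht).1) 
        (fun t ht => (hE' t ht).2) hA0 hb ?_ ht hd.le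
      have e1 := h.ea b hb
      have e2 := h.eu b hb
      have r1 := (hp b hb).reg he (h.ca b hb 0 (by omega)) (h.ca b hb 1 (by omega))
        (fun hh => by simpa [hb0, eq_comm] using hh) (fun hh => by 
          have := e2 0 zero_mem
          rw [huv.1, hub.1] at this
          simp only [hb0, decide_eq_false_iff_not] at hh
          have h3 : a 0 b 0 * a 1 b 0 = 0 := by linarith
          exact (mul_eq_zero.1 h3).resolve_left hh)
        (fun hh => by simpa [hb1, eq_comm] using hh) (fun hh => by 
          have := e2 1 one_mem
          rw [huv.2, hub.2] at this
          simp only [hb1, decide_eq_false_iff_not] at hh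
          have h3 : a 0 b 1 * a 1 b 1 = 0 := by linarith
          exact (mul_eq_zero.1 h3).resolve_left hh)
      have r2 := (hq b hb).reg he (h.cu b hb 0 (by omega)) (h.cu b hb 1 (by omega))
        (fun hh => hub.1.symm) (fun hh => by simp at hh)
        (fun hh => hub.2.symm) (fun hh => by simp at hh)
      have s1 := pow_le_pow_left₀ (nrm_nonneg _) r1 2
      have s2 := pow_le_pow_left₀ (nrm_nonneg _) r2 2
      simp only [Nat.reduceAdd] at s1 s2
      linarith
    constructor
    · apply limit_lemma (f := fun j => a j t) (fun j hj => h.ca t ht j (by omega)) (Real.sqrt_nonneg _)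
      intro e he
      obtain ⟨p, p1, p2, q, q1, q2, h1, h2, h3⟩ := main e he
      exact ⟨p, p1, p2, h1.h1, h1.h2, h1.eq, Real.le_sqrt_of_sq_le (by nlinarith [sq_nonneg (nrm q2)])⟩
    · apply limit_lemma (f := fun j => u j t) (fun j hj => h.cu t ht j (by omega)) (Real.sqrt_nonneg _)
      intro e he
      obtain ⟨p, p1, p2, q, q1, q2, h1, h2, h3⟩ := main e he
      exact ⟨q, q1, q2, h2.h1, h2.h2, h2.eq, Real.le_sqrt_of_sq_le (by nlinarith [sq_nonneg (nrm p2)])⟩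
  obtain ⟨K, hK⟩ := main
  exact ⟨max K 0, le_max_right _ _, fun t ht => ⟨(hK t ht).1.trans (le_max_left _ _), (hK t ht).2.trans (le_max_left _ _)⟩⟩

end SW
end

noncomputable section
open Set

namespace SW
open MeasureTheory Filter Topology
open intervalIntegral hiding integral_const_mul

lemma Gr.data {e : ℝ} {b0 b1 : Bool} {g : ℝ → ℝ} {d0 d1 d0' d1' : ℝ} {P P1 P2 : ℝ → ℝ}
    (h : Gr e b0 b1 g d0 d1 P P1 P2) (h0 : b0 = true → d0 = d0') (h1 : b1 = true → d1 = d1') :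
    Gr e b0 b1 g d0' d1' P P1 P2 where
  h1 := h.h1
  h2 := h.h2
  eq := h.eq
  l0 hb := by rw [h.l0 hb, h0 hb]
  l1 := h.l1
  r0 hb := by rw [h.r0 hb, h1 hb]
  r1 := h.r1

def EndOK2 (b : Bool × Bool) (A A1 F1 G1 : ℝ × ℝ) : Prop :=
  (b = (true, true) ∧ A = 0) ∨ (A.2 = 0 ∧ A1.1 = 0 ∧
    ((b = (false, true) ∧ F1.1 = 0 ∧ G1.1 = 0) ∨ (b = (true, false) ∧ F1.2 = 0 ∧ G1.2 = 0)))

lemma EndOK2.regF {b : Bool × Bool} {A A1 F1 G1 : ℝ × ℝ} (h : EndOK2 b A A1 F1 G1) :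
    (b.1 = false → F1.1 = 0 ∧ G1.1 = 0) ∧ (b.2 = false → F1.2 = 0 ∧ G1.2 = 0) := by
  rcases h with ⟨rfl, h⟩ | ⟨h1, h2, ⟨rfl, h3⟩ | ⟨rfl, h3⟩⟩
  · simp
  · simp [h3]
  · simp [h3]

/-- the flux matrix applied to a vector -/
def bm (A X : ℝ × ℝ) : ℝ × ℝ :=
  ((1/2) * (A.2 * X.1 + A.1 * X.2), (1/2) * (A.1 * X.1 + 3 * A.2 * X.2))

lemma EndOK2.h0 {b : Bool × Bool} {A A1 F1 G1 : ℝ × ℝ} (h : EndOK2 b A A1 F1 G1) :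
    (b.1 = true → (bm A F1).1 = 0) ∧ (b.2 = true → (bm A F1).2 = 0) := by
  rcases h with ⟨rfl, h⟩ | ⟨h1, h2, ⟨rfl, h3⟩ | ⟨rfl, h3⟩⟩ <;> simp [*, bm]

lemma EndOK2.endok {b : Bool × Bool} {A A1 F1 G1 W : ℝ × ℝ} (h : EndOK2 b A A1 F1 G1)
    (h1 : b.1 = true → W.1 = 0) (h2 : b.2 = true → W.2 = 0) : Endok b A A1 W := by
  rcases h with ⟨rfl, h⟩ | ⟨q1, q2, ⟨rfl, h3⟩ | ⟨rfl, h3⟩⟩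
  · exact Or.inl ⟨rfl, h⟩
  · exact Or.inr ⟨q1, q2, Or.inl ⟨rfl, h2 rfl⟩⟩
  · exact Or.inr ⟨q1, q2, Or.inr ⟨rfl, h1 rfl⟩⟩

lemma cf_sym (A X Y : ℝ × ℝ) : cf A X Y = cf Y X A := by unfold cf; ring

lemma P1_bound {e : ℝ} (he : 0 < e) {b0 b1 : Bool} {f P P1 P2 : ℝ → ℝ}
    (h : Gr e b0 b1 f (f 0) (f 1) P P1 P2) {K q : ℝ} (hf : ∀ x ∈ I, |f x| ≤ K) 
    (h2 : nrm P2 ≤ q) : ∀ x ∈ I, |P1 x| ≤ 2 * K + q := by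
  intro x hx
  have hP := h.abs_le he hf (hf 0 zero_mem) (hf 1 one_mem)
  obtain ⟨z, hz, hz'⟩ := exists_hasDerivAt_eq_slope P P1 zero_lt_one h.h1.cont
    (fun x hx => h.h1.hasDerivAt hx)
  have hzI := Ioo_subset_Icc_self hz
  have o := osc_le h.h2 hx hzI
  have h3 : |P1 z| ≤ 2 * K := by
    rw [hz']
    have := abs_sub (P 1) (P 0)
    have h0 := hP 0 zero_mem
    have h1 := hP 1 one_mem
    norm_num
    linarith
  have := abs_sub_abs_le_abs_sub (P1 x) (P1 z)
  linarith

set_option maxHeartbeats 1000000 in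
lemma stage2_inst {e K q : ℝ} (he : 0 < e) (hK : 0 ≤ K) (hq : 1 ≤ q) {b0 b1 : Bool × Bool}
    {A A1 A2 F F1 F2 G G1 G2 P P1 P2 Φ R R1 R2 : ℝ → ℝ × ℝ}
    (hA : D2 A A1) (hA1 : D2 A1 A2) (hF : D2 F F1) (hF1 : D2 F1 F2) (hG : D2 G G1) (hG1 : D2 G1 G2)
    (hP : Gr2 e b0 b1 F (F 0) (F 1) P P1 P2) (hR : Gr2 e b0 b1 Φ (Φ 0) (Φ 1) R R1 R2)
    (hΦ : ∀ x ∈ I, Φ x = - (bm (A x) (F1 x) + G x))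
    (e0 : EndOK2 b0 (A 0) (A1 0) (F1 0) (G1 0)) (e1 : EndOK2 b1 (A 1) (A1 1) (F1 1) (G1 1))
    (kA1 : ∀ x ∈ I, |(A1 x).1| ≤ K ∧ |(A1 x).2| ≤ K) (kF : ∀ x ∈ I, |(F x).1| ≤ K ∧ |(F x).2| ≤ K)
    (kA2 : nrm (fun x => (A2 x).1) ≤ K ∧ nrm (fun x => (A2 x).2) ≤ K)
    (kF2 : nrm (fun x => (F2 x).1) ≤ q ∧ nrm (fun x => (F2 x).2) ≤ q)
    (kG2 : nrm (fun x => (G2 x).1) ≤ K * q ∧ nrm (fun x => (G2 x).2) ≤ K * q) :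
    |(∫ x in (0:ℝ)..1, ((F x).1 - (P x).1) * ((Φ x).1 - (R x).1)) 
      + ∫ x in (0:ℝ)..1, ((F x).2 - (P x).2) * ((Φ x).2 - (R x).2)| ≤
      e ^ 4 * q ^ 2 * (12 * K + (2 * K + 1) * (2 + 2 * K ^ 2)) := by
  have cA := hA.cont
  have cA1 := hA1.cont
  have cA2 := hA1.cont'
  have cF := hF.cont
  have cF1 := hF.cont'
  have cG := hG.cont
  have cP := hP.h1.cont
  have cP1 := hP.h2.cont
  have cR := hR.h1.cont
  have hW : ContinuousOn (fun x => F x - P x) I := by fun_prop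
  have e2 : 0 < e ^ 2 := by positivity
  -- P2 bounds
  have p21 : nrm (fun x => (P2 x).1) ≤ q := (hP.fst.reg he hF.1 hF1.1 (fun _ => rfl)
    (fun hb => (e0.regF.1 hb).1) (fun _ => rfl) (fun hb => (e1.regF.1 hb).1)).trans kF2.1
  have p22 : nrm (fun x => (P2 x).2) ≤ q := (hP.snd.reg he hF.2 hF1.2 (fun _ => rfl)
    (fun hb => (e0.regF.2 hb).1) (fun _ => rfl) (fun hb => (e1.regF.2 hb).1)).trans kF2.2
  have w1 : nrm (fun x => (F x).1 - (P x).1) ≤ e ^ 2 * q := by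
    rw [nrm_P2 he hP.fst.eq]; gcongr
  have w2 : nrm (fun x => (F x).2 - (P x).2) ≤ e ^ 2 * q := by
    rw [nrm_P2 he hP.snd.eq]; gcongr
  have wsq : ∫ x in (0:ℝ)..1, sq (F x - P x) ≤ 2 * (e ^ 4 * q ^ 2) := by
    have := pow_le_pow_left₀ (nrm_nonneg _) w1 2
    have h' := pow_le_pow_left₀ (nrm_nonneg _) w2 2
    rw [nrm_sq] at this h'
    unfold sq
    simp only [Prod.fst_sub, Prod.snd_sub]
    rw [integral_add (cii (by fun_prop)) (cii (by fun_prop))]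
    nlinarith
  -- R_G
  obtain ⟨S, S1, S2, hS⟩ := Gr2.exists' he b0 b1 cG (G 0) (G 1)
  have cS := hS.h1.cont
  have s1 : nrm (fun x => (G x).1 - (S x).1) ≤ e ^ 2 * (K * q) := by
    rw [nrm_P2 he hS.fst.eq]; gcongr
    exact (hS.fst.reg he hG.1 hG1.1 (fun _ => rfl)
      (fun hb => (e0.regF.1 hb).2) (fun _ => rfl) (fun hb => (e1.regF.1 hb).2)).trans kG2.1
  have s2 : nrm (fun x => (G x).2 - (S x).2) ≤ e ^ 2 * (K * q) := by
    rw [nrm_P2 he hS.snd.eq]; gcongr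
    exact (hS.snd.reg he hG.2 hG1.2 (fun _ => rfl)
      (fun hb => (e0.regF.2 hb).2) (fun _ => rfl) (fun hb => (e1.regF.2 hb).2)).trans kG2.2
  -- R_h
  have h01 := hΦ 0 zero_mem
  have h11 := hΦ 1 one_mem
  have hH1 : Gr e b0.1 b1.1 (fun x => (bm (A x) (F1 x)).1) 0 0 (fun x => -1 * (R x).1 - (S x).1)
      (fun x => -1 * (R1 x).1 - (S1 x).1) (fun x => -1 * (R2 x).1 - (S2 x).1) := by
    refine (((hR.fst.smul (-1)).sub hS.fst).congr (fun x hx => ?_) rfl rfl).data (fun hb => ?_) (fun hb => ?_)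
    · rw [hΦ x hx]; simp
    · have := e0.h0.1 hb
      rw [h01]
      simp only [Prod.fst_neg, Prod.fst_add]
      linarith
    · have := e1.h0.1 hb
      rw [h11]
      simp only [Prod.fst_neg, Prod.fst_add]
      linarith
  have hH2 : Gr e b0.2 b1.2 (fun x => (bm (A x) (F1 x)).2) 0 0 (fun x => -1 * (R x).2 - (S x).2)
      (fun x => -1 * (R1 x).2 - (S1 x).2) (fun x => -1 * (R2 x).2 - (S2 x).2) := by
    refine (((hR.snd.smul (-1)).sub hS.snd).congr (fun x hx => ?_) rfl rfl).data (fun hb => ?_) (fun hb => ?_)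
    · rw [hΦ x hx]; simp
    · have := e0.h0.2 hb
      rw [h01]
      simp only [Prod.snd_neg, Prod.snd_add]
      linarith
    · have := e1.h0.2 hb
      rw [h11]
      simp only [Prod.snd_neg, Prod.snd_add]
      linarith
  obtain ⟨Z, Z1, Z2, hZ⟩ := Gr2.exists' he b0 b1 hW 0 0
  have cZ := hZ.h1.cont
  have zsq := hZ.energy.trans wsq
  have sa1 := hH1.selfadj hZ.fst
  have sa2 := hH2.selfadj hZ.snd
  have cr := core hA hA1 hF hP hZ
    (e0.endok (fun hb => by simp [hP.fst.l0 hb]) (fun hb => by simp [hP.snd.l0 hb]))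
    (e1.endok (fun hb => by simp [hP.fst.r0 hb]) (fun hb => by simp [hP.snd.r0 hb]))
  have cH1 := hH1.cont_rhs
  have cH2 := hH2.cont_rhs
  have t1 : (∫ x in (0:ℝ)..1, (F x - P x).1 * ((bm (A x) (F1 x)).1 - (-1 * (R x).1 - (S x).1))) + 
      ∫ x in (0:ℝ)..1, (F x - P x).2 * ((bm (A x) (F1 x)).2 - (-1 * (R x).2 - (S x).2)) = 
      ∫ x in (0:ℝ)..1, cf (A x) (F x - P x - Z x) (F1 x) := by
    rw [sa1, sa2, ← integral_add (cii (by fun_prop)) (cii (by fun_prop))]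
    apply int_congr
    intro x hx
    simp only [cf, bm, Prod.fst_sub, Prod.snd_sub]
    ring
  have bP1 := P1_bound he hP.fst (fun x hx => (kF x hx).1) p21
  have bP2 := P1_bound he hP.snd (fun x hx => (kF x hx).2) p22
  have a2sq : ∫ x in (0:ℝ)..1, sq (A2 x) ≤ 2 * K ^ 2 := by
    have := pow_le_pow_left₀ (nrm_nonneg _) kA2.1 2
    have h' := pow_le_pow_left₀ (nrm_nonneg _) kA2.2 2
    rw [nrm_sq] at this h'
    unfold sq
    rw [integral_add (cii (by fun_prop)) (cii (by fun_prop))]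
    linarith
  have q0 : 0 < q := by linarith
  have t2 : |∫ x in (0:ℝ)..1, cf (A x) (F x - P x - Z x) (F1 x)| ≤ 
      ∫ x in (0:ℝ)..1, (3 * K * sq (F x - P x) + 2 * K * sq (Z x) 
        + (2 * K + 1) * (sq (Z x) + e ^ 4 * q ^ 2 * sq (A2 x))) := by
    rw [cr]
    apply int_abs_le (by fun_prop) (by fun_prop)
    intro x hx
    have u1 := abs_le.1 (cf_le (X := F x - P x) (Y := F x - P x) (kA1 x hx).1 (kA1 x hx).2)
    have u2 := abs_le.1 (cf_le (X := Z x) (Y := F x - P x) (kA1 x hx).1 (kA1 x hx).2)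
    have b1' : |((1 / q) • P1 x).1| ≤ 2 * K + 1 := by
      simp only [Prod.smul_fst, smul_eq_mul]
      rw [abs_mul, abs_of_pos (by positivity), one_div_mul_eq_div, div_le_iff₀ q0]
      nlinarith [bP1 x hx]
    have b2' : |((1 / q) • P1 x).2| ≤ 2 * K + 1 := by
      simp only [Prod.smul_snd, smul_eq_mul]
      rw [abs_mul, abs_of_pos (by positivity), one_div_mul_eq_div, div_le_iff₀ q0]
      nlinarith [bP2 x hx]
    have u3 := cf_le (X := Z x) (Y := (e ^ 2 * q) • A2 x) b1' b2'
    have e3 : cf ((1 / q) • P1 x) (Z x) ((e ^ 2 * q) • A2 x) = e ^ 2 * cf (A2 x) (Z x) (P1 x) := by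
      rw [cf_sym (A2 x)]
      simp only [cf, Prod.smul_fst, Prod.smul_snd, smul_eq_mul]
      field_simp
    have e4 : sq ((e ^ 2 * q) • A2 x) = e ^ 4 * q ^ 2 * sq (A2 x) := by
      simp only [sq, Prod.smul_fst, Prod.smul_snd, smul_eq_mul]; ring
    rw [e3, e4] at u3
    have u3 := abs_le.1 u3
    rw [abs_le]
    constructor <;> linarith [u1.1, u1.2, u2.1, u2.2, u3.1, u3.2]
  have t3 : ∫ x in (0:ℝ)..1, (3 * K * sq (F x - P x) + 2 * K * sq (Z x) 
        + (2 * K + 1) * (sq (Z x) + e ^ 4 * q ^ 2 * sq (A2 x))) ≤ 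
        e ^ 4 * q ^ 2 * (10 * K + (2 * K + 1) * (2 + 2 * K ^ 2)) := by
    rw [integral_add (cii (by fun_prop)) (cii (by fun_prop)), integral_add (cii (by fun_prop)) (cii (by fun_prop)),
      intervalIntegral.integral_const_mul, intervalIntegral.integral_const_mul,
      intervalIntegral.integral_const_mul, integral_add (cii (by fun_prop)) (cii (by fun_prop)),
      intervalIntegral.integral_const_mul]
    have m1 := mul_le_mul_of_nonneg_left wsq (show 0 ≤ 3 * K by positivity)
    have m2 := mul_le_mul_of_nonneg_left zsq (show 0 ≤ 2 * K by positivity)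
    have m3 := mul_le_mul_of_nonneg_left a2sq (show 0 ≤ e ^ 4 * q ^ 2 by positivity)
    have m4 := mul_le_mul_of_nonneg_left (add_le_add zsq m3) (show 0 ≤ 2 * K + 1 by positivity)
    linarith
  have g1 := (cs (f := fun x => (F x).1 - (P x).1) (g := fun x => (G x).1 - (S x).1) (by fun_prop) (by fun_prop)).trans
    (mul_le_mul w1 s1 (nrm_nonneg _) (by positivity))
  have g2 := (cs (f := fun x => (F x).2 - (P x).2) (g := fun x => (G x).2 - (S x).2) (by fun_prop) (by fun_prop)).trans
    (mul_le_mul w2 s2 (nrm_nonneg _) (by positivity))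
  have split1 : ∫ x in (0:ℝ)..1, ((F x).1 - (P x).1) * ((Φ x).1 - (R x).1) = 
      - (∫ x in (0:ℝ)..1, (F x - P x).1 * ((bm (A x) (F1 x)).1 - (-1 * (R x).1 - (S x).1)))
      - ∫ x in (0:ℝ)..1, ((F x).1 - (P x).1) * ((G x).1 - (S x).1) := by
    rw [← intervalIntegral.integral_neg, ← integral_sub (cii (by fun_prop)) (cii (by fun_prop))]
    apply int_congr
    intro x hx
    rw [hΦ x hx]
    simp only [Prod.fst_sub, Prod.fst_neg, Prod.fst_add]
    ring
  have split2 : ∫ x in (0:ℝ)..1, ((F x).2 - (P x).2) * ((Φ x).2 - (R x).2) = 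
      - (∫ x in (0:ℝ)..1, (F x - P x).2 * ((bm (A x) (F1 x)).2 - (-1 * (R x).2 - (S x).2)))
      - ∫ x in (0:ℝ)..1, ((F x).2 - (P x).2) * ((G x).2 - (S x).2) := by
    rw [← intervalIntegral.integral_neg, ← integral_sub (cii (by fun_prop)) (cii (by fun_prop))]
    apply int_congr
    intro x hx
    rw [hΦ x hx]
    simp only [Prod.snd_sub, Prod.snd_neg, Prod.snd_add]
    ring
  rw [split1, split2]
  have t4 := abs_le.1 (t2.trans t3)
  rw [← t1] at t4
  have g1 := abs_le.1 g1
  have g2 := abs_le.1 g2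
  have : e ^ 2 * q * (e ^ 2 * (K * q)) = e ^ 4 * q ^ 2 * K := by ring
  rw [this] at g1 g2
  rw [abs_le]
  constructor <;> linarith [t4.1, t4.2, g1.1, g1.2, g2.1, g2.2]

end SW
end

noncomputable section
open Set

namespace SW
open MeasureTheory Filter Topology
open intervalIntegral hiding integral_const_mul

lemma holder {f f' : ℝ → ℝ} (h : D f f') {M l : ℝ} (hM : nrm f' ≤ M) (hl : 0 < l) {x y : ℝ} (hx : x ∈ I) (hy : y ∈ I) :
    |f x - f y| ≤ (l * M ^ 2 + |x - y| / l) / 2 := by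
  have key : ∀ x ∈ I, ∀ y ∈ I, y ≤ x → |f x - f y| ≤ (l * M ^ 2 + |x - y| / l) / 2 := by
    intro x hx y hy hxy
    have hs : Icc y x ⊆ I := Icc_subset_Icc hy.1 hx.2
    have hc : ContinuousOn f' (uIcc y x) := by rw [uIcc_of_le hxy]; exact h.2.mono hs
    rw [← h.int_ab hy hx]
    have a1 : |∫ t in y..x, f' t| ≤ ∫ t in y..x, (l * f' t ^ 2 + 1 / l) / 2 := by
      have := norm_integral_le_of_norm_le (f := f') (g := fun t => (l * f' t ^ 2 + 1 / l) / 2) (a := y) (b := x) (μ := volume) hxy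
        (Filter.Eventually.of_forall fun t _ => by
          rw [Real.norm_eq_abs, le_div_iff₀ (by norm_num)]
          have h1 : 0 ≤ (l * |f' t| - 1) ^ 2 / l := by positivity
          have h2 : (l * |f' t| - 1) ^ 2 / l = l * f' t ^ 2 + 1 / l - |f' t| * 2 := by
            rw [← sq_abs (f' t)]; field_simp; ring
          linarith) (ContinuousOn.intervalIntegrable (by fun_prop))
      simpa using this
    refine a1.trans ?_
    rw [intervalIntegral.integral_div, integral_add (ContinuousOn.intervalIntegrable (by fun_prop)) (by simp),
      intervalIntegral.integral_const_mul, intervalIntegral.integral_const, abs_of_nonneg (by linarith)]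
    have h3 : ∫ t in y..x, f' t ^ 2 ≤ nrm f' ^ 2 := by
      rw [nrm_sq]
      have c2 : ContinuousOn (fun t => f' t ^ 2) I := h.2.pow 2
      exact integral_mono_interval hy.1 hxy hx.2 (Filter.Eventually.of_forall fun _ => sq_nonneg _)
        (cii c2)
    have h4 := pow_le_pow_left₀ (nrm_nonneg _) hM 2
    have h5 := mul_le_mul_of_nonneg_left (h3.trans h4) hl.le
    rw [smul_eq_mul, mul_one_div]
    linarith
  rcases le_total y x with hh | hh
  · exact key x hx y hy hh
  · rw [abs_sub_comm, abs_sub_comm x y]; exact key y hy x hx hh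

lemma JC {J : Set ℝ} {f f1 f2 : ℝ → ℝ → ℝ} (hf : ContinuousOn (fun p : ℝ × ℝ => f p.1 p.2) (J ×ˢ I))
    (h1 : ∀ t ∈ J, D (f t) (f1 t)) (h2 : ∀ t ∈ J, D (f1 t) (f2 t)) {M : ℝ} (hM : ∀ t ∈ J, nrm (f2 t) ≤ M) :
    ContinuousOn (fun p : ℝ × ℝ => f1 p.1 p.2) (J ×ˢ I) := by
  apply continuousOn_of_uniform_approx_of_continuousOn
  intro U hU
  obtain ⟨ε, hε, hεU⟩ := Metric.mem_uniformity_dist.1 hU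
  set l := ε / (1 + M ^ 2) with hl
  have hl0 : 0 < l := by positivity
  set n := min (1/2) (ε * l / 2) with hn
  have hn0 : 0 < n := by positivity
  have hn1 : n ≤ 1/2 := min_le_left _ _
  have hn2 : n ≤ ε * l / 2 := min_le_right _ _
  refine ⟨fun p => (f p.1 (p.2 * (1 - n) + n) - f p.1 (p.2 * (1 - n))) / n, ?_, ?_⟩
  · have c1 : ContinuousOn (fun p : ℝ × ℝ => f p.1 (p.2 * (1 - n) + n)) (J ×ˢ I) := by
      refine hf.comp (f := fun p : ℝ × ℝ => (p.1, p.2 * (1 - n) + n)) (by fun_prop) ?_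
      rintro ⟨t, x⟩ ⟨ht, hx⟩
      exact ⟨ht, by constructor <;> simp only <;> nlinarith [hx.1, hx.2]⟩
    have c2 : ContinuousOn (fun p : ℝ × ℝ => f p.1 (p.2 * (1 - n))) (J ×ˢ I) := by
      refine hf.comp (f := fun p : ℝ × ℝ => (p.1, p.2 * (1 - n))) (by fun_prop) ?_
      rintro ⟨t, x⟩ ⟨ht, hx⟩
      exact ⟨ht, by constructor <;> simp only <;> nlinarith [hx.1, hx.2]⟩
    exact (c1.sub c2).div_const _
  · rintro ⟨t, x⟩ ⟨ht, hx⟩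
    simp only at ht hx
    apply hεU
    simp only
    have y0 : x * (1 - n) ∈ I := by constructor <;> nlinarith [hx.1, hx.2]
    have y1 : x * (1 - n) + n ∈ I := by constructor <;> nlinarith [hx.1, hx.2]
    obtain ⟨z, hz, hz'⟩ := exists_hasDerivAt_eq_slope (f t) (f1 t) (show x * (1 - n) < x * (1 - n) + n by linarith)
      ((h1 t ht).cont.mono (Icc_subset_Icc y0.1 y1.2)) (fun z hz => (h1 t ht).hasDerivAt
        ⟨lt_of_le_of_lt y0.1 hz.1, lt_of_lt_of_le hz.2 y1.2⟩)
    have hzI : z ∈ I := ⟨y0.1.trans hz.1.le, hz.2.le.trans y1.2⟩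
    rw [add_sub_cancel_left] at hz'
    rw [← hz', Real.dist_eq]
    have hxz : |x - z| ≤ n := by
      rw [abs_le]; constructor <;> nlinarith [hx.1, hx.2, hz.1, hz.2]
    have := holder (h2 t ht) (hM t ht) hl0 hx hzI
    refine this.trans_lt ?_
    have e1 : |x - z| / l ≤ ε / 2 := by
      rw [div_le_iff₀ hl0]; linarith
    have e2 : l * M ^ 2 ≤ ε := by
      rw [hl, div_mul_eq_mul_div, div_le_iff₀ (by positivity)]; nlinarith
    linarith

lemma D.le_of_lip {f f' : ℝ → ℝ} (h : D f f') {x L : ℝ} (hx : x ∈ I) 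
    (hL : ∀ y ∈ I, |f y - f x| ≤ L * |y - x|) : |f' x| ≤ L := by
  have h1 := (hasDerivWithinAt_iff_tendsto_slope.1 (h.1 x hx)).abs
  have : (𝓝[I \ {x}] x).NeBot := by
    have := (uniqueDiffOn_Icc zero_lt_one x hx)
    rw [uniqueDiffWithinAt_iff_accPt, accPt_principal_iff_nhdsWithin] at this
    exact this
  apply le_of_tendsto h1
  filter_upwards [self_mem_nhdsWithin] with y hy
  have hne : y - x ≠ 0 := sub_ne_zero.2 hy.2
  rw [slope_def_field, abs_div, div_le_iff₀ (abs_pos.2 hne)]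
  exact hL y hy.1

lemma D.lip {f f' : ℝ → ℝ} (h : D f f') {L : ℝ} (hL : ∀ z ∈ I, |f' z| ≤ L) {x y : ℝ} (hx : x ∈ I) (hy : y ∈ I) :
    |f y - f x| ≤ L * |y - x| := by
  have := (convex_Icc (0:ℝ) 1).norm_image_sub_le_of_norm_hasDerivWithin_le (f := f) (f' := f') (C := L) h.1 hL hx hy
  simpa using this

lemma Dt {c d : ℝ} {f f1 g g1 : ℝ → ℝ → ℝ}
    (h : ∀ t ∈ Icc c d, ∀ x ∈ I, HasDerivWithinAt (fun s => f s x) (g t x) (Icc c d) t)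
    (hf : ∀ t ∈ Icc c d, D (f t) (f1 t)) (hg : ∀ t ∈ Icc c d, D (g t) (g1 t))
    (hc : ContinuousOn (fun p : ℝ × ℝ => g1 p.1 p.2) (Icc c d ×ˢ I)) :
    ∀ t ∈ Icc c d, UD (Icc c d) f1 (g1 t) t := by
  intro t ht κ hκ
  have hcomp : IsCompact (Icc c d ×ˢ I) := isCompact_Icc.prod isCompact_Icc
  have huc := hcomp.uniformContinuousOn_of_continuous hc
  rw [Metric.uniformContinuousOn_iff] at huc
  obtain ⟨δ, hδ, hu⟩ := huc κ hκ
  refine ⟨δ, hδ, fun s hs hst x hx => ?_⟩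
  have hw := ((hf s hs).sub (hf t ht)).sub ((hg t ht).smul (s - t))
  refine hw.le_of_lip hx (fun y hy => ?_)
  have hsub : uIcc t s ⊆ Icc c d := (convex_Icc c d).ordConnected.uIcc_subset ht hs
  have key := (convex_uIcc t s).norm_image_sub_le_of_norm_hasDerivWithin_le
    (f := fun σ => f σ y - f σ x - σ * (g t y - g t x)) (f' := fun σ => g σ y - g σ x - (g t y - g t x)) 
    (C := κ * |y - x|) (x := t) (y := s)
    (fun σ hσ => by
      have a := (h σ (hsub hσ) x hx).mono hsub
      have a' := (h σ (hsub hσ) y hy).mono hsub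
      have b := ((hasDerivWithinAt_id σ (uIcc t s)).mul_const (g t y - g t x))
      exact ((a'.sub a).sub b).congr_deriv (by simp))
    (fun σ hσ => by
      have hd := ((hg σ (hsub hσ)).sub (hg t ht)).lip (L := κ) (fun z hz => by
        have hd : dist (σ, z) (t, z) < δ := by
          rw [Prod.dist_eq, dist_self, Real.dist_eq]
          have : |σ - t| ≤ |s - t| := abs_sub_left_of_mem_uIcc hσ
          exact max_lt (this.trans_lt hst) hδ
        have := hu (σ, z) ⟨hsub hσ, hz⟩ (t, z) ⟨ht, hz⟩ hd
        rw [Real.dist_eq] at this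
        exact this.le) hx hy
      rw [Real.norm_eq_abs]
      refine le_trans (le_of_eq ?_) hd
      congr 1; ring) left_mem_uIcc right_mem_uIcc
  simp only [Real.norm_eq_abs] at key
  refine le_trans (le_of_eq ?_) (key.trans (le_of_eq ?_))
  · congr 1; ring
  · ring

lemma UD.hasDeriv {J : Set ℝ} {F : ℝ → ℝ → ℝ} {G : ℝ → ℝ} {t : ℝ} (h : UD J F G t) {x : ℝ} (hx : x ∈ I) :
    HasDerivWithinAt (fun s => F s x) (G x) J t := by
  rw [hasDerivWithinAt_iff_isLittleO, Asymptotics.isLittleO_iff]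
  intro κ hκ
  obtain ⟨δ, hδ, hu⟩ := h κ hκ
  rw [eventually_nhdsWithin_iff, Metric.eventually_nhds_iff]
  exact ⟨δ, hδ, fun s hs hsJ => by simpa using hu s hsJ (by simpa [Real.dist_eq] using hs) x hx⟩

/-- Leibniz expansion of the `n`-th derivative of a product -/
def lei (f g : ℕ → ℝ → ℝ) (n : ℕ) (x : ℝ) : ℝ :=
  ∑ p ∈ Finset.HasAntidiagonal.antidiagonal n, (n.choose p.1 : ℝ) * (f p.1 x * g p.2 x)

lemma D.sum {ι : Type*} (s : Finset ι) {f f' : ι → ℝ → ℝ} (h : ∀ i ∈ s, D (f i) (f' i)) :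
    D (fun x => ∑ i ∈ s, f i x) (fun x => ∑ i ∈ s, f' i x) := by
  classical
  induction s using Finset.induction_on with
  | empty => simpa using D.const 0
  | insert i s hi ih =>
    have := (h i (Finset.mem_insert_self _ _)).add (ih fun j hj => h j (Finset.mem_insert_of_mem hj))
    simpa [Finset.sum_insert hi] using this

lemma lei_D {f g : ℕ → ℝ → ℝ} {n : ℕ} (hf : ∀ j ≤ n, D (f j) (f (j+1))) (hg : ∀ j ≤ n, D (g j) (g (j+1))) :
    D (lei f g n) (lei f g (n+1)) := by
  have := D.sum (Finset.HasAntidiagonal.antidiagonal n) (fun p hp => 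
    ((hf p.1 (by have := Finset.HasAntidiagonal.mem_antidiagonal.1 hp; omega)).mul (hg p.2 (by have := Finset.HasAntidiagonal.mem_antidiagonal.1 hp; omega))).smul (n.choose p.1 : ℝ))
  refine this.congr (fun x _ => rfl) (fun x _ => ?_)
  unfold lei
  rw [Finset.sum_antidiagonal_choose_succ_mul (fun i j => f i x * g j x), ← Finset.sum_add_distrib]
  apply Finset.sum_congr rfl
  rintro ⟨i, j⟩ hij
  simp only
  rw [show n.choose j = n.choose i from (Nat.choose_symm_of_eq_add (Finset.HasAntidiagonal.mem_antidiagonal.1 hij).symm).symm]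
  ring

end SW
end

noncomputable section
open Set

namespace SW
open MeasureTheory Filter Topology
open intervalIntegral hiding integral_const_mul

/-- index set of the intermediate Leibniz terms -/
def ms (n : ℕ) : Finset (ℕ × ℕ) := (Finset.HasAntidiagonal.antidiagonal n).filter (fun p => 0 < p.1 ∧ 0 < p.2)

lemma mem_ms {n : ℕ} {p : ℕ × ℕ} (h : p ∈ ms n) : p.1 + p.2 = n ∧ 0 < p.1 ∧ 0 < p.2 := by
  rw [ms, Finset.mem_filter, Finset.HasAntidiagonal.mem_antidiagonal] at h
  exact h

def mid (f g : ℕ → ℝ → ℝ) (n : ℕ) (x : ℝ) : ℝ :=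
  ∑ p ∈ ms n, (n.choose p.1 : ℝ) * (f p.1 x * g p.2 x)
def mid1 (f g : ℕ → ℝ → ℝ) (n : ℕ) (x : ℝ) : ℝ :=
  ∑ p ∈ ms n, (n.choose p.1 : ℝ) * (f (p.1 + 1) x * g p.2 x + f p.1 x * g (p.2 + 1) x)
def mid2 (f g : ℕ → ℝ → ℝ) (n : ℕ) (x : ℝ) : ℝ :=
  ∑ p ∈ ms n, (n.choose p.1 : ℝ) * (f (p.1 + 2) x * g p.2 x + f (p.1 + 1) x * g (p.2 + 1) x + 
    (f (p.1 + 1) x * g (p.2 + 1) x + f p.1 x * g (p.2 + 2) x))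

lemma lei_eq (f g : ℕ → ℝ → ℝ) (n : ℕ) (x : ℝ) : 
    lei f g (n + 1) x = f 0 x * g (n + 1) x + f (n + 1) x * g 0 x + mid f g (n + 1) x := by
  rcases n with _ | n
  · have : ms 1 = ∅ := by decide
    simp [lei, mid, this, Finset.Nat.sum_antidiagonal_succ]
  · rw [lei, Finset.Nat.sum_antidiagonal_succ, Finset.Nat.sum_antidiagonal_succ', mid, ms, Finset.sum_filter,
      Finset.Nat.sum_antidiagonal_succ, Finset.Nat.sum_antidiagonal_succ']
    simp
    try ring

lemma mid_D {f g : ℕ → ℝ → ℝ} {n : ℕ} (hf : ∀ j < n, D (f j) (f (j+1))) (hg : ∀ j < n, D (g j) (g (j+1))) :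
    D (mid f g n) (mid1 f g n) :=
  D.sum (ms n) (fun p hp => by
    obtain ⟨h1, h2, h3⟩ := mem_ms hp
    exact ((hf p.1 (by omega)).mul (hg p.2 (by omega))).smul (n.choose p.1 : ℝ))

lemma mid1_D {f g : ℕ → ℝ → ℝ} {n : ℕ} (hf : ∀ j < n + 1, D (f j) (f (j+1))) (hg : ∀ j < n + 1, D (g j) (g (j+1))) :
    D (mid1 f g n) (mid2 f g n) :=
  D.sum (ms n) (fun p hp => by
    obtain ⟨h1, h2, h3⟩ := mem_ms hp
    exact (((hf (p.1 + 1) (by omega)).mul (hg p.2 (by omega))).add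
      ((hf p.1 (by omega)).mul (hg (p.2 + 1) (by omega)))).smul (n.choose p.1 : ℝ))

def bsum (n : ℕ) : ℝ := ∑ p ∈ ms n, (n.choose p.1 : ℝ)

lemma bsum_nonneg (n : ℕ) : 0 ≤ bsum n := Finset.sum_nonneg fun _ _ => by positivity

lemma nrm_sum {ι : Type*} (s : Finset ι) {f : ι → ℝ → ℝ} {B : ι → ℝ} (h : ∀ i ∈ s, ContinuousOn (f i) I)
    (hB : ∀ i ∈ s, nrm (f i) ≤ B i) :
    nrm (fun x => ∑ i ∈ s, f i x) ≤ ∑ i ∈ s, B i := by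
  classical
  induction s using Finset.induction_on with
  | empty => simp [nrm]
  | insert i s hi ih =>
    have c : ContinuousOn (fun x => ∑ i ∈ s, f i x) I := 
      continuousOn_finsetSum s fun j hj => h j (Finset.mem_insert_of_mem hj)
    have := nrm_add (h i (Finset.mem_insert_self _ _)) c
    simp only [Finset.sum_insert hi]
    refine this.trans (add_le_add (hB i (Finset.mem_insert_self _ _)) (ih ?_ ?_))
    · exact fun j hj => h j (Finset.mem_insert_of_mem hj)
    · exact fun j hj => hB j (Finset.mem_insert_of_mem hj)

lemma mid2_nrm {f g : ℕ → ℝ → ℝ} {n : ℕ} {K s : ℝ} (hK : 0 ≤ K) (hs : 0 ≤ s)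
    (hf : ∀ j < n + 2, D (f j) (f (j+1))) (hg : ∀ j < n + 2, D (g j) (g (j+1)))
    (kf : ∀ j < n + 2, nrm (f j) ≤ K) (kg : ∀ j < n + 2, nrm (g j) ≤ K)
    (kf' : nrm (f (n + 2)) ≤ s) (kg' : nrm (g (n + 2)) ≤ s) :
    nrm (mid2 f g (n + 1)) ≤ bsum (n + 1) * (8 * K * (K + s)) := by
  have cf' : ∀ j ≤ n + 2, ContinuousOn (f j) I := by
    intro j hj
    rcases hj.lt_or_eq with h | rfl
    · exact (hf j h).cont
    · exact (hf (n + 1) (by omega)).cont'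
  have cg : ∀ j ≤ n + 2, ContinuousOn (g j) I := by
    intro j hj
    rcases hj.lt_or_eq with h | rfl
    · exact (hg j h).cont
    · exact (hg (n + 1) (by omega)).cont'
  have nf : ∀ j ≤ n + 2, nrm (f j) ≤ K + s := by
    intro j hj
    rcases hj.lt_or_eq with h | rfl
    · linarith [kf j h]
    · linarith
  have ng : ∀ j ≤ n + 2, nrm (g j) ≤ K + s := by
    intro j hj
    rcases hj.lt_or_eq with h | rfl
    · linarith [kg j h]
    · linarith
  have sf : ∀ j ≤ n, ∀ x ∈ I, |f j x| ≤ 2 * K := fun j hj x hx => by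
    linarith [sup_le (hf j (by omega)) hx, kf j (by omega), kf (j + 1) (by omega)]
  have sg : ∀ j ≤ n, ∀ x ∈ I, |g j x| ≤ 2 * K := fun j hj x hx => by
    linarith [sup_le (hg j (by omega)) hx, kg j (by omega), kg (j + 1) (by omega)]
  have sf1 : ∀ j ≤ n + 1, ∀ x ∈ I, |f j x| ≤ 2 * K + s := fun j hj x hx => by
    linarith [sup_le (hf j (by omega)) hx, kf j (by omega), nf (j + 1) (by omega)]
  unfold mid2 bsum
  rw [Finset.sum_mul]
  apply nrm_sum
  · intro p hp
    obtain ⟨h1, h2, h3⟩ := mem_ms hp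
    have q1 := cf' p.1 (by omega)
    have q2 := cf' (p.1 + 1) (by omega)
    have q3 := cf' (p.1 + 2) (by omega)
    have q4 := cg p.2 (by omega)
    have q5 := cg (p.2 + 1) (by omega)
    have q6 := cg (p.2 + 2) (by omega)
    fun_prop
  · intro p hp
    obtain ⟨h1, h2, h3⟩ := mem_ms hp
    have q1 := cf' p.1 (by omega)
    have q2 := cf' (p.1 + 1) (by omega)
    have q3 := cf' (p.1 + 2) (by omega)
    have q4 := cg p.2 (by omega)
    have q5 := cg (p.2 + 1) (by omega)
    have q6 := cg (p.2 + 2) (by omega)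
    rw [nrm_smul, abs_of_nonneg (by positivity)]
    gcongr
    have e1 := nrm_mul_le (show 0 ≤ 2 * K by positivity) q4 q3 (sg p.2 (by omega))
    have e2 := nrm_mul_le (show 0 ≤ 2 * K + s by positivity) q2 q5 (sf1 (p.1 + 1) (by omega))
    have e3 := nrm_mul_le (show 0 ≤ 2 * K by positivity) q1 q6 (sf p.1 (by omega))
    have b1 := mul_le_mul_of_nonneg_left (nf (p.1 + 2) (by omega)) (show 0 ≤ 2 * K by positivity)
    have b2 := mul_le_mul_of_nonneg_left (kg (p.2 + 1) (by omega)) (show 0 ≤ 2 * K + s by positivity)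
    have b3 := mul_le_mul_of_nonneg_left (ng (p.2 + 2) (by omega)) (show 0 ≤ 2 * K by positivity)
    have a1 := nrm_add (f := fun x => f (p.1 + 2) x * g p.2 x + f (p.1 + 1) x * g (p.2 + 1) x)
      (g := fun x => f (p.1 + 1) x * g (p.2 + 1) x + f p.1 x * g (p.2 + 2) x) (by fun_prop) (by fun_prop)
    have a2 := nrm_add (f := fun x => f (p.1 + 2) x * g p.2 x)
      (g := fun x => f (p.1 + 1) x * g (p.2 + 1) x) (by fun_prop) (by fun_prop)
    have a3 := nrm_add (f := fun x => f (p.1 + 1) x * g (p.2 + 1) x)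
      (g := fun x => f p.1 x * g (p.2 + 2) x) (by fun_prop) (by fun_prop)
    have e1' : nrm (fun x => f (p.1 + 2) x * g p.2 x) = nrm (fun x => g p.2 x * f (p.1 + 2) x) :=
      nrm_congr fun x _ => mul_comm _ _
    nlinarith [mul_nonneg hK hs]

/-- time derivative chains -/
def At (a u : ℕ → ℝ → ℝ) (j : ℕ) (x : ℝ) : ℝ := -(1/2) * lei u a (j + 1) x
def Ut (a u : ℕ → ℝ → ℝ) (j : ℕ) (x : ℝ) : ℝ := -((1/4) * lei a a (j + 1) x + (3/4) * lei u u (j + 1) x)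

lemma At_D {a u : ℕ → ℝ → ℝ} {j : ℕ} (ha : ∀ i ≤ j + 1, D (a i) (a (i+1))) (hu : ∀ i ≤ j + 1, D (u i) (u (i+1))) :
    D (At a u j) (At a u (j + 1)) := (lei_D hu ha).smul _
lemma Ut_D {a u : ℕ → ℝ → ℝ} {j : ℕ} (ha : ∀ i ≤ j + 1, D (a i) (a (i+1))) (hu : ∀ i ≤ j + 1, D (u i) (u (i+1))) :
    D (Ut a u j) (Ut a u (j + 1)) := (((lei_D ha ha).smul _).add ((lei_D hu hu).smul _)).neg

lemma lei_joint {J : Set ℝ} {f g : ℕ → ℝ → ℝ → ℝ} {n : ℕ} 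
    (hf : ∀ j ≤ n, ContinuousOn (fun p : ℝ × ℝ => f j p.1 p.2) (J ×ˢ I))
    (hg : ∀ j ≤ n, ContinuousOn (fun p : ℝ × ℝ => g j p.1 p.2) (J ×ˢ I)) : 
    ContinuousOn (fun p : ℝ × ℝ => lei (fun j => f j p.1) (fun j => g j p.1) n p.2) (J ×ˢ I) := by
  unfold lei
  apply continuousOn_finsetSum
  intro i hi
  have := Finset.HasAntidiagonal.mem_antidiagonal.1 hi
  exact continuousOn_const.mul ((hf _ (by omega)).mul (hg _ (by omega)))

lemma joint_all {J : Set ℝ} {f : ℕ → ℝ → ℝ → ℝ} {n : ℕ} {M : ℝ}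
    (h0 : ContinuousOn (fun p : ℝ × ℝ => f 0 p.1 p.2) (J ×ˢ I)) 
    (hD : ∀ t ∈ J, ∀ j < n + 1, D (f j t) (f (j + 1) t)) (hM : ∀ t ∈ J, ∀ j ≤ n + 1, nrm (f j t) ≤ M) :
    ∀ j ≤ n, ContinuousOn (fun p : ℝ × ℝ => f j p.1 p.2) (J ×ˢ I) := by
  intro j
  induction j with
  | zero => exact fun _ => h0
  | succ j ih =>
    intro hj
    exact JC (ih (by omega)) (fun t ht => hD t ht j (by omega)) (fun t ht => hD t ht (j+1) (by omega)) 
      (fun t ht => hM t ht (j + 2) (by omega))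

/-- everything known on a time window -/
structure Win (c d : ℝ) (n : ℕ) (a u : ℕ → ℝ → ℝ → ℝ) (K s : ℝ) : Prop where
  cd : c < d
  K0 : 0 ≤ K
  s0 : 0 ≤ s
  n0 : 1 ≤ n
  ha : ∀ t ∈ Icc c d, ∀ j < n + 2, D (a j t) (a (j + 1) t)
  hu : ∀ t ∈ Icc c d, ∀ j < n + 2, D (u j t) (u (j + 1) t)
  ka : ∀ t ∈ Icc c d, ∀ j < n + 2, nrm (a j t) ≤ K
  ku : ∀ t ∈ Icc c d, ∀ j < n + 2, nrm (u j t) ≤ K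
  ka' : ∀ t ∈ Icc c d, nrm (a (n + 2) t) ≤ s
  ku' : ∀ t ∈ Icc c d, nrm (u (n + 2) t) ≤ s
  ja : ContinuousOn (fun p : ℝ × ℝ => a 0 p.1 p.2) (Icc c d ×ˢ I)
  ju : ContinuousOn (fun p : ℝ × ℝ => u 0 p.1 p.2) (Icc c d ×ˢ I)
  da : ∀ t ∈ Icc c d, ∀ x ∈ I, HasDerivWithinAt (fun s => a 0 s x) (At (fun j => a j t) (fun j => u j t) 0 x) (Icc c d) t
  du : ∀ t ∈ Icc c d, ∀ x ∈ I, HasDerivWithinAt (fun s => u 0 s x) (Ut (fun j => a j t) (fun j => u j t) 0 x) (Icc c d) t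
  bd : ∀ t ∈ Icc c d, u 0 t 0 = 0 ∧ u 0 t 1 = 0

namespace Win
variable {c d : ℝ} {n : ℕ} {a u : ℕ → ℝ → ℝ → ℝ} {K s : ℝ}

lemma joint (w : Win c d n a u K s) : ∀ j ≤ n + 1, ContinuousOn (fun p : ℝ × ℝ => a j p.1 p.2) (Icc c d ×ˢ I) ∧ 
    ContinuousOn (fun p : ℝ × ℝ => u j p.1 p.2) (Icc c d ×ˢ I) := by
  have k0 := w.K0
  have s0 := w.s0
  have ha := joint_all (n := n + 1) (M := K + s) w.ja w.ha (fun t ht j hj => by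
    rcases hj.lt_or_eq with h | rfl
    · linarith [w.ka t ht j h]
    · linarith [w.ka' t ht])
  have hu := joint_all (n := n + 1) (M := K + s) w.ju w.hu (fun t ht j hj => by
    rcases hj.lt_or_eq with h | rfl
    · linarith [w.ku t ht j h]
    · linarith [w.ku' t ht])
  exact fun j hj => ⟨ha j hj, hu j hj⟩

lemma ud (w : Win c d n a u K s) : ∀ j ≤ n, (∀ t ∈ Icc c d, UD (Icc c d) (a j) (At (fun j => a j t) (fun j => u j t) j) t) ∧
    ∀ t ∈ Icc c d, UD (Icc c d) (u j) (Ut (fun j => a j t) (fun j => u j t) j) t := by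
  have cA : ∀ j ≤ n, ContinuousOn (fun p : ℝ × ℝ => At (fun j => a j p.1) (fun j => u j p.1) j p.2) (Icc c d ×ˢ I) := by
    intro j hj
    exact (lei_joint (fun i hi => (w.joint i (by omega)).2) (fun i hi => (w.joint i (by omega)).1)).const_smul (-(1/2):ℝ)
  have cU : ∀ j ≤ n, ContinuousOn (fun p : ℝ × ℝ => Ut (fun j => a j p.1) (fun j => u j p.1) j p.2) (Icc c d ×ˢ I) := by
    intro j hj
    have h1 := (lei_joint (n := j + 1) (fun i hi => (w.joint i (by omega)).2) (fun i hi => (w.joint i (by omega)).2))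
    have h2 := (lei_joint (n := j + 1) (fun i hi => (w.joint i (by omega)).1) (fun i hi => (w.joint i (by omega)).1))
    exact ((h2.const_smul (1/4:ℝ)).add (h1.const_smul (3/4:ℝ))).neg
  intro j
  induction j with
  | zero =>
    intro _
    exact ⟨UD_of_joint (Ft := fun t => At (fun j => a j t) (fun j => u j t) 0) w.da (cA 0 (by omega)), 
      UD_of_joint (Ft := fun t => Ut (fun j => a j t) (fun j => u j t) 0) w.du (cU 0 (by omega))⟩
  | succ j ih =>
    intro hj
    obtain ⟨i1, i2⟩ := ih (by omega)
    constructor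
    · exact Dt (g := fun t => At (fun j => a j t) (fun j => u j t) j) (g1 := fun t => At (fun j => a j t) (fun j => u j t) (j+1)) 
        (fun t ht x hx => (i1 t ht).hasDeriv hx) (fun t ht => w.ha t ht j (by omega))
        (fun t ht => At_D (fun i hi => w.ha t ht i (by omega)) (fun i hi => w.hu t ht i (by omega))) (cA (j+1) hj)
    · exact Dt (g := fun t => Ut (fun j => a j t) (fun j => u j t) j) (g1 := fun t => Ut (fun j => a j t) (fun j => u j t) (j+1)) 
        (fun t ht x hx => (i2 t ht).hasDeriv hx) (fun t ht => w.hu t ht j (by omega))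
        (fun t ht => Ut_D (fun i hi => w.ha t ht i (by omega)) (fun i hi => w.hu t ht i (by omega))) (cU (j+1) hj)

lemma zero_deriv (w : Win c d n a u K s) {F : ℝ → ℝ → ℝ} {G : ℝ → ℝ} {t x : ℝ} (ht : t ∈ Icc c d) (hx : x ∈ I)
    (h : UD (Icc c d) F G t) (h0 : ∀ t ∈ Icc c d, F t x = 0) : G x = 0 := by
  have d0 : HasDerivWithinAt (fun s => F s x) 0 (Icc c d) t :=
    (hasDerivWithinAt_const t (Icc c d) (0:ℝ)).congr_of_mem h0 ht
  exact (uniqueDiffOn_Icc w.cd t ht).eq_deriv _ (h.hasDeriv hx) d0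

lemma mid_zero {f g : ℕ → ℝ → ℝ} {n : ℕ} {x : ℝ} (h : ∀ p q, p + q = n → 0 < p → 0 < q → f p x = 0 ∨ g q x = 0) :
    mid f g n x = 0 := by
  apply Finset.sum_eq_zero
  intro p hp
  obtain ⟨h1, h2, h3⟩ := mem_ms hp
  rcases h _ _ h1 h2 h3 with h | h <;> simp [h]

lemma mid1_zero {f g : ℕ → ℝ → ℝ} {n : ℕ} {x : ℝ} (h : ∀ p q, p + q = n + 1 → p ≤ n → q ≤ n → f p x = 0 ∨ g q x = 0) :
    mid1 f g n x = 0 := by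
  apply Finset.sum_eq_zero
  intro p hp
  obtain ⟨h1, h2, h3⟩ := mem_ms hp
  have e1 : f (p.1 + 1) x * g p.2 x = 0 := by
    rcases h (p.1 + 1) p.2 (by omega) (by omega) (by omega) with h | h <;> simp [h]
  have e2 : f p.1 x * g (p.2 + 1) x = 0 := by
    rcases h p.1 (p.2 + 1) (by omega) (by omega) (by omega) with h | h <;> simp [h]
  rw [e1, e2]; simp

lemma parity (w : Win c d n a u K s) {z : ℝ} (hz : z ∈ I) (h0 : ∀ t ∈ Icc c d, a 0 t z ≠ 0) 
    (hu0 : ∀ t ∈ Icc c d, u 0 t z = 0) :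
    ∀ j ≤ n + 1, ∀ t ∈ Icc c d, (Odd j → a j t z = 0) ∧ (Even j → u j t z = 0) := by
  intro j
  induction j using Nat.strong_induction_on with
  | _ j ih =>
  intro hj t ht
  rcases j with _ | j
  · exact ⟨fun h => by simp at h, fun _ => hu0 t ht⟩
  constructor
  · intro ho
    have hev : Even j := by
      rcases Nat.even_or_odd j with h | h
      · exact h
      · exact absurd ho (Nat.not_odd_iff_even.2 h.add_one)
    have := w.zero_deriv ht hz ((w.ud j (by omega)).2 t ht) (fun t ht => (ih j (by omega) (by omega) t ht).2 hev)
    rw [Ut, lei_eq, lei_eq, mid_zero, mid_zero] at this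
    · simp only [hu0 t ht] at this
      have h3 : a 0 t z * a (j + 1) t z = 0 := by linarith
      exact (mul_eq_zero.1 h3).resolve_left (h0 t ht)
    · intro p q hpq hp hq
      rcases Nat.even_or_odd p with h | h
      · exact Or.inl ((ih p (by omega) (by omega) t ht).2 h)
      · right
        refine (ih q (by omega) (by omega) t ht).2 ?_
        by_contra hq'
        rw [Nat.not_even_iff_odd] at hq'
        exact absurd ho (Nat.not_odd_iff_even.2 (hpq ▸ h.add_odd hq'))
    · intro p q hpq hp hq
      rcases Nat.even_or_odd p with h | h
      · right
        refine (ih q (by omega) (by omega) t ht).1 ?_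
        by_contra hq'
        rw [Nat.not_odd_iff_even] at hq'
        exact absurd ho (Nat.not_odd_iff_even.2 (hpq ▸ h.add hq'))
      · exact Or.inl ((ih p (by omega) (by omega) t ht).1 h)
  · intro he
    have hod : Odd j := by
      rcases Nat.even_or_odd j with h | h
      · exact absurd he (Nat.not_even_iff_odd.2 h.add_one)
      · exact h
    have := w.zero_deriv ht hz ((w.ud j (by omega)).1 t ht) (fun t ht => (ih j (by omega) (by omega) t ht).1 hod)
    rw [At, lei_eq, mid_zero] at this
    · simp only [hu0 t ht] at this
      have h3 : a 0 t z * u (j + 1) t z = 0 := by linarith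
      exact (mul_eq_zero.1 h3).resolve_left (h0 t ht)
    · intro p q hpq hp hq
      rcases Nat.even_or_odd p with h | h
      · exact Or.inl ((ih p (by omega) (by omega) t ht).2 h)
      · right
        refine (ih q (by omega) (by omega) t ht).1 ?_
        by_contra hq'
        rw [Nat.not_odd_iff_even] at hq'
        exact absurd he (Nat.not_even_iff_odd.2 (hpq ▸ h.add_even hq'))

end Win

end SW
end

noncomputable section
open Set

namespace SW
open MeasureTheory Filter Topology
open intervalIntegral hiding integral_const_mul

def Gm (a u : ℕ → ℝ → ℝ) (n : ℕ) (x : ℝ) : ℝ × ℝ :=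
  ((1/2) * mid u a (n + 1) x, (1/4) * mid a a (n + 1) x + (3/4) * mid u u (n + 1) x)
def Gm1 (a u : ℕ → ℝ → ℝ) (n : ℕ) (x : ℝ) : ℝ × ℝ :=
  ((1/2) * mid1 u a (n + 1) x, (1/4) * mid1 a a (n + 1) x + (3/4) * mid1 u u (n + 1) x)
def Gm2 (a u : ℕ → ℝ → ℝ) (n : ℕ) (x : ℝ) : ℝ × ℝ :=
  ((1/2) * mid2 u a (n + 1) x, (1/4) * mid2 a a (n + 1) x + (3/4) * mid2 u u (n + 1) x)

namespace Win
variable {c d : ℝ} {n : ℕ} {a u : ℕ → ℝ → ℝ → ℝ} {K s : ℝ}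

lemma endtype (w : Win c d n a u K s) {z : ℝ} (hz : z ∈ I) (hu0 : ∀ t ∈ Icc c d, u 0 t z = 0)
    (hd : (∀ t ∈ Icc c d, a 0 t z = 0) ∨ (∀ t ∈ Icc c d, a 0 t z ≠ 0)) :
    ∃ b : Bool × Bool, ∀ t ∈ Icc c d, EndOK2 b (a 0 t z, u 0 t z) (a 1 t z, u 1 t z) (a (n + 1) t z, u (n + 1) t z)
      (Gm1 (fun j => a j t) (fun j => u j t) n z) := by
  rcases hd with hd | hd
  · refine ⟨(true, true), fun t ht => Or.inl ⟨rfl, ?_⟩⟩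
    rw [hd t ht, hu0 t ht]; rfl
  have par := w.parity hz hd hu0
  rcases Nat.even_or_odd n with hn | hn
  · refine ⟨(false, true), fun t ht => Or.inr ⟨hu0 t ht, (par 1 (by omega) t ht).1 odd_one, Or.inl ⟨rfl, 
      (par (n + 1) le_rfl t ht).1 hn.add_one, ?_⟩⟩⟩
    simp only [Gm1]
    rw [mid1_zero, mul_zero]
    intro p q hpq hp hq
    rcases Nat.even_or_odd p with h | h
    · exact Or.inl ((par p hp t ht).2 h)
    · right
      refine (par q hq t ht).1 ?_
      by_contra hq'
      rw [Nat.not_odd_iff_even] at hq'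
      have h1 := hpq ▸ h.add_even hq'
      have h2 : Even (n + 1 + 1) := hn.add_one.add_one
      exact absurd h1 (Nat.not_odd_iff_even.2 h2)
  · refine ⟨(true, false), fun t ht => Or.inr ⟨hu0 t ht, (par 1 (by omega) t ht).1 odd_one, Or.inr ⟨rfl, 
      (par (n + 1) le_rfl t ht).2 hn.add_one, ?_⟩⟩⟩
    have h2 : Odd (n + 1 + 1) := hn.add_one.add_one
    simp only [Gm1]
    rw [mid1_zero, mid1_zero]
    · simp
    · intro p q hpq hp hq
      rcases Nat.even_or_odd p with h | h
      · exact Or.inl ((par p hp t ht).2 h)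
      · right
        refine (par q hq t ht).2 ?_
        by_contra hq'
        rw [Nat.not_even_iff_odd] at hq'
        have h1 := hpq ▸ h.add_odd hq'
        exact absurd h2 (Nat.not_odd_iff_even.2 h1)
    · intro p q hpq hp hq
      rcases Nat.even_or_odd p with h | h
      · right
        refine (par q hq t ht).1 ?_
        by_contra hq'
        rw [Nat.not_odd_iff_even] at hq'
        have h1 := hpq ▸ h.add hq'
        exact absurd h2 (Nat.not_odd_iff_even.2 h1)
      · exact Or.inl ((par p hp t ht).1 h)

/-- constant for the window estimate -/
def wc (n : ℕ) (K : ℝ) : ℝ := 2 * K + 8 * K * (K + 1) * bsum (n + 1)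
def wC (n : ℕ) (K : ℝ) : ℝ := 2 * (12 * wc n K + (2 * wc n K + 1) * (2 + 2 * wc n K ^ 2))

lemma wc_nonneg (hK : 0 ≤ K) : 0 ≤ wc n K := by
  have := bsum_nonneg (n + 1)
  unfold wc; positivity
lemma wC_nonneg (hK : 0 ≤ K) : 0 ≤ wC n K := by
  have := wc_nonneg (n := n) hK
  unfold wC; positivity

lemma deriv_bound (w : Win c d n a u K s) {e : ℝ} (he : 0 < e) {b0 b1 : Bool × Bool}
    (e0 : ∀ t ∈ Icc c d, EndOK2 b0 (a 0 t 0, u 0 t 0) (a 1 t 0, u 1 t 0) (a (n + 1) t 0, u (n + 1) t 0)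
      (Gm1 (fun j => a j t) (fun j => u j t) n 0))
    (e1 : ∀ t ∈ Icc c d, EndOK2 b1 (a 0 t 1, u 0 t 1) (a 1 t 1, u 1 t 1) (a (n + 1) t 1, u (n + 1) t 1)
      (Gm1 (fun j => a j t) (fun j => u j t) n 1))
    {P P1 P2 : ℝ → ℝ → ℝ × ℝ}
    (hP : ∀ t ∈ Icc c d, Gr2 e b0 b1 (fun x => (a n t x, u n t x)) (a n t 0, u n t 0) (a n t 1, u n t 1) (P t) (P1 t) (P2 t)) :
    ∀ t ∈ Icc c d, ∃ E', HasDerivWithinAt (fun t => nrm (fun x => (P2 t x).1) ^ 2 + nrm (fun x => (P2 t x).2) ^ 2) E' (Icc c d) t ∧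
      |E'| ≤ wC n K * (1 + s) ^ 2 := by
  intro t ht
  have K0 := w.K0
  have s0 := w.s0
  have n0 := w.n0
  have hB := bsum_nonneg (n + 1)
  set av : ℕ → ℝ → ℝ := fun j => a j t with hav
  set uv : ℕ → ℝ → ℝ := fun j => u j t with huv
  obtain ⟨ua, uu⟩ := w.ud n le_rfl
  have ha := w.ha t ht
  have hu := w.hu t ht
  have dA : ContinuousOn (At av uv n) I := ((lei_D (fun j hj => hu j (by omega)) (fun j hj => ha j (by omega))).smul (-(1/2))).cont'
  have dU : ContinuousOn (Ut av uv n) I := 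
    ((((lei_D (fun j hj => ha j (by omega)) (fun j hj => ha j (by omega))).smul (1/4)).add 
      ((lei_D (fun j hj => hu j (by omega)) (fun j hj => hu j (by omega))).smul (3/4))).neg).cont'
  obtain ⟨R, R1, R2, hR⟩ := Gr2.exists' (g := fun x => (At av uv n x, Ut av uv n x)) he b0 b1 (dA.prodMk dU) 
    (At av uv n 0, Ut av uv n 0) (At av uv n 1, Ut av uv n 1)
  have d1 := time_deriv (lam := 1) he (by simp) ht (F := fun s => a n s) (ua t ht) (P := fun s x => (P s x).1)
    (P1 := fun s x => (P1 s x).1) (P2 := fun s x => (P2 s x).1)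
    (fun s hs => by simpa using (hP s hs).fst) (by simpa using hR.fst)
  have d2 := time_deriv (lam := 1) he (by simp) ht (F := fun s => u n s) (uu t ht) (P := fun s x => (P s x).2)
    (P1 := fun s x => (P1 s x).2) (P2 := fun s x => (P2 s x).2)
    (fun s hs => by simpa using (hP s hs).snd) (by simpa using hR.snd)
  have sup1 : ∀ j ≤ n, ∀ x ∈ I, |a j t x| ≤ wc n K ∧ |u j t x| ≤ wc n K := by
    intro j hj x hx
    have h1 := sup_le (ha j (by omega)) hx
    have h2 := sup_le (hu j (by omega)) hx
    have := w.ka t ht j (by omega)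
    have := w.ku t ht j (by omega)
    have := w.ka t ht (j + 1) (by omega)
    have := w.ku t ht (j + 1) (by omega)
    have h5 : 2 * K ≤ wc n K := by unfold wc; nlinarith [mul_nonneg (mul_nonneg K0 (by linarith : 0 ≤ K + 1)) hB]
    exact ⟨by linarith, by linarith⟩
  have Kw : K ≤ wc n K := by unfold wc; nlinarith [mul_nonneg (mul_nonneg K0 (by linarith : 0 ≤ K + 1)) hB]
  have mb : ∀ f g : ℕ → ℝ → ℝ, (∀ j < n + 2, D (f j) (f (j+1))) → (∀ j < n + 2, D (g j) (g (j+1))) →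
      (∀ j < n + 2, nrm (f j) ≤ K) → (∀ j < n + 2, nrm (g j) ≤ K) → nrm (f (n + 2)) ≤ s → nrm (g (n + 2)) ≤ s →
      nrm (mid2 f g (n + 1)) ≤ wc n K * (1 + s) := by
    intro f g f1 g1 f2 g2 f3 g3
    refine (mid2_nrm K0 s0 f1 g1 f2 g2 f3 g3).trans ?_
    unfold wc
    have : K + s ≤ (K + 1) * (1 + s) := by nlinarith
    calc bsum (n + 1) * (8 * K * (K + s)) ≤ bsum (n + 1) * (8 * K * ((K + 1) * (1 + s))) := by gcongr
      _ ≤ _ := by nlinarith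
  have m1 := mb uv av hu ha (w.ku t ht) (w.ka t ht) (w.ku' t ht) (w.ka' t ht)
  have m2 := mb av av ha ha (w.ka t ht) (w.ka t ht) (w.ka' t ht) (w.ka' t ht)
  have m3 := mb uv uv hu hu (w.ku t ht) (w.ku t ht) (w.ku' t ht) (w.ku' t ht)
  have w0 := wc_nonneg (n := n) K0
  have c2 : ∀ f g : ℕ → ℝ → ℝ, (∀ j < n + 2, D (f j) (f (j+1))) → (∀ j < n + 2, D (g j) (g (j+1))) →
      ContinuousOn (mid2 f g (n + 1)) I := fun f g hf hg => (mid1_D hf hg).cont'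
  have hG : D2 (Gm av uv n) (Gm1 av uv n) := by
    have h1 := mid_D (n := n + 1) (fun j hj => hu j (by omega)) (fun j hj => ha j (by omega))
    have h2 := mid_D (n := n + 1) (fun j hj => ha j (by omega)) (fun j hj => ha j (by omega))
    have h3 := mid_D (n := n + 1) (fun j hj => hu j (by omega)) (fun j hj => hu j (by omega))
    exact ⟨h1.smul (1/2), (h2.smul (1/4)).add (h3.smul (3/4))⟩
  have hG1 : D2 (Gm1 av uv n) (Gm2 av uv n) := by
    have h1 := mid1_D (n := n + 1) (fun j hj => hu j (by omega)) (fun j hj => ha j (by omega))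
    have h2 := mid1_D (n := n + 1) (fun j hj => ha j (by omega)) (fun j hj => ha j (by omega))
    have h3 := mid1_D (n := n + 1) (fun j hj => hu j (by omega)) (fun j hj => hu j (by omega))
    exact ⟨h1.smul (1/2), (h2.smul (1/4)).add (h3.smul (3/4))⟩
  have st := stage2_inst (e := e) (K := wc n K) (q := 1 + s) he w0 (by linarith) (b0 := b0) (b1 := b1)
    (A := fun x => (a 0 t x, u 0 t x)) (A1 := fun x => (a 1 t x, u 1 t x)) (A2 := fun x => (a 2 t x, u 2 t x))
    (F := fun x => (a n t x, u n t x)) (F1 := fun x => (a (n+1) t x, u (n+1) t x)) (F2 := fun x => (a (n+2) t x, u (n+2) t x))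
    (G := Gm av uv n) (G1 := Gm1 av uv n) (G2 := Gm2 av uv n)
    (P := P t) (P1 := P1 t) (P2 := P2 t) (Φ := fun x => (At av uv n x, Ut av uv n x)) (R := R) (R1 := R1) (R2 := R2)
    ⟨ha 0 (by omega), hu 0 (by omega)⟩ ⟨ha 1 (by omega), hu 1 (by omega)⟩ 
    ⟨ha n (by omega), hu n (by omega)⟩ ⟨ha (n+1) (by omega), hu (n+1) (by omega)⟩ hG hG1 (hP t ht) hR
    (fun x hx => by
      rw [At, Ut, lei_eq, lei_eq, lei_eq]
      ext <;> simp only [bm, Gm, Prod.fst_add, Prod.snd_add, Prod.fst_neg, Prod.snd_neg, hav, huv] <;> ring)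
    (e0 t ht) (e1 t ht) (fun x hx => sup1 1 n0 x hx) (fun x hx => sup1 n le_rfl x hx)
    ⟨(w.ka t ht 2 (by omega)).trans Kw, (w.ku t ht 2 (by omega)).trans Kw⟩
    ⟨(w.ka' t ht).trans (by linarith), (w.ku' t ht).trans (by linarith)⟩
    ⟨by
      refine (nrm_smul (1/2) (mid2 uv av (n + 1))).le.trans ?_
      rw [abs_of_pos (by norm_num)]
      nlinarith [mul_nonneg w0 (by linarith : 0 ≤ 1 + s)],
    by
      have := nrm_add (f := fun x => (1/4) * mid2 av av (n+1) x) (g := fun x => (3/4) * mid2 uv uv (n+1) x)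
        (continuousOn_const.mul (c2 _ _ ha ha)) (continuousOn_const.mul (c2 _ _ hu hu))
      rw [nrm_smul, nrm_smul, abs_of_pos (by norm_num), abs_of_pos (by norm_num)] at this
      refine this.trans ?_
      linarith⟩
  simp only at st
  set A1 := ∫ x in (0:ℝ)..1, (a n t x - (P t x).1) * (At av uv n x - (R x).1)
  set A2 := ∫ x in (0:ℝ)..1, (u n t x - (P t x).2) * (Ut av uv n x - (R x).2)
  refine ⟨(2 * A1 + 2 * A2) / e ^ 4, ?_, ?_⟩
  · refine ((d1.add d2).div_const (e ^ 4)).congr_of_mem (fun s hs => ?_) ht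
    have h4 := nrm_P2 he (hP s hs).fst.eq
    have h5 := nrm_P2 he (hP s hs).snd.eq
    simp only [Pi.add_apply]
    rw [← nrm_sq, ← nrm_sq, h4, h5]
    field_simp
  · rw [abs_div, abs_of_pos (show 0 < e ^ 4 by positivity), div_le_iff₀ (by positivity)]
    have : |2 * A1 + 2 * A2| = 2 * |A1 + A2| := by
      rw [← mul_add, abs_mul, abs_of_pos (by norm_num : (0:ℝ) < 2)]
    rw [this]
    unfold wC
    linarith

lemma est (w : Win c d n a u K s)
    (hd0 : (∀ t ∈ Icc c d, a 0 t 0 = 0) ∨ (∀ t ∈ Icc c d, a 0 t 0 ≠ 0))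
    (hd1 : (∀ t ∈ Icc c d, a 0 t 1 = 0) ∨ (∀ t ∈ Icc c d, a 0 t 1 ≠ 0)) 
    {t t' : ℝ} (ht : t ∈ Icc c d) (ht' : t' ∈ Icc c d) :
    nrm (a (n + 2) t) ^ 2 ≤ nrm (a (n + 2) t') ^ 2 + nrm (u (n + 2) t') ^ 2 + wC n K * (1 + s) ^ 2 * |t - t'| ∧ 
    nrm (u (n + 2) t) ^ 2 ≤ nrm (a (n + 2) t') ^ 2 + nrm (u (n + 2) t') ^ 2 + wC n K * (1 + s) ^ 2 * |t - t'| := by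
  obtain ⟨b0, e0⟩ := w.endtype zero_mem (fun t ht => (w.bd t ht).1) hd0
  obtain ⟨b1, e1⟩ := w.endtype one_mem (fun t ht => (w.bd t ht).2) hd1
  set Q := nrm (a (n + 2) t') ^ 2 + nrm (u (n + 2) t') ^ 2 + wC n K * (1 + s) ^ 2 * |t - t'| with hQ
  have hw := wC_nonneg (n := n) w.K0
  have hQ0 : 0 ≤ Q := by positivity
  have main : ∀ e > 0, ∃ P P1 P2 : ℝ → ℝ × ℝ, Gr2 e b0 b1 (fun x => (a n t x, u n t x)) (a n t 0, u n t 0) (a n t 1, u n t 1) P P1 P2 ∧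
      nrm (fun x => (P2 x).1) ^ 2 + nrm (fun x => (P2 x).2) ^ 2 ≤ Q := by
    intro e he
    have ex1 : ∀ t, ∃ P P1 P2, t ∈ Icc c d → Gr2 e b0 b1 (fun x => (a n t x, u n t x)) (a n t 0, u n t 0) (a n t 1, u n t 1) P P1 P2 := by
      intro t
      by_cases ht : t ∈ Icc c d
      · obtain ⟨P, P1, P2, h⟩ := Gr2.exists' (g := fun x => (a n t x, u n t x)) he b0 b1 
          ((w.ha t ht n (by omega)).cont.prodMk (w.hu t ht n (by omega)).cont) (a n t 0, u n t 0) (a n t 1, u n t 1)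
        exact ⟨P, P1, P2, fun _ => h⟩
      · exact ⟨0, 0, 0, fun h => absurd h ht⟩
    choose P P1 P2 hP using ex1
    refine ⟨P t, P1 t, P2 t, hP t ht, ?_⟩
    have dd := w.deriv_bound he e0 e1 hP
    choose! E' hE' using dd
    have lip := (convex_Icc c d).norm_image_sub_le_of_norm_hasDerivWithin_le 
      (f := fun t => nrm (fun x => (P2 t x).1) ^ 2 + nrm (fun x => (P2 t x).2) ^ 2) (f' := E') (C := wC n K * (1 + s) ^ 2)
      (fun s hs => (hE' s hs).1) (fun s hs => (hE' s hs).2) ht' ht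
    simp only [Real.norm_eq_abs] at lip
    have lip := (abs_le.1 lip).2
    have r1 := (hP t' ht').fst.reg he (w.ha t' ht' n (by omega)) (w.ha t' ht' (n+1) (by omega))
      (fun _ => rfl) (fun hb => ((e0 t' ht').regF.1 hb).1) (fun _ => rfl) (fun hb => ((e1 t' ht').regF.1 hb).1)
    have r2 := (hP t' ht').snd.reg he (w.hu t' ht' n (by omega)) (w.hu t' ht' (n+1) (by omega))
      (fun _ => rfl) (fun hb => ((e0 t' ht').regF.2 hb).1) (fun _ => rfl) (fun hb => ((e1 t' ht').regF.2 hb).1)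
    have s1 := pow_le_pow_left₀ (nrm_nonneg _) r1 2
    have s2 := pow_le_pow_left₀ (nrm_nonneg _) r2 2
    linarith
  constructor
  · have : nrm (a (n + 2) t) ≤ √Q := by
      apply limit_lemma (f := fun j => a (n + j) t) (fun j hj => w.ha t ht (n + j) (by omega)) (Real.sqrt_nonneg _)
      intro e he
      obtain ⟨P, P1, P2, h1, h3⟩ := main e he
      exact ⟨_, _, _, h1.fst.h1, h1.fst.h2, h1.fst.eq, Real.le_sqrt_of_sq_le (by nlinarith [sq_nonneg (nrm fun x => (P2 x).2)])⟩
    calc _ ≤ (√Q) ^ 2 := pow_le_pow_left₀ (nrm_nonneg _) this 2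
      _ = Q := Real.sq_sqrt hQ0
  · have : nrm (u (n + 2) t) ≤ √Q := by
      apply limit_lemma (f := fun j => u (n + j) t) (fun j hj => w.hu t ht (n + j) (by omega)) (Real.sqrt_nonneg _)
      intro e he
      obtain ⟨P, P1, P2, h1, h3⟩ := main e he
      exact ⟨_, _, _, h1.snd.h1, h1.snd.h2, h1.snd.eq, Real.le_sqrt_of_sq_le (by nlinarith [sq_nonneg (nrm fun x => (P2 x).1)])⟩
    calc _ ≤ (√Q) ^ 2 := pow_le_pow_left₀ (nrm_nonneg _) this 2
      _ = Q := Real.sq_sqrt hQ0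

end Win

end SW
end

noncomputable section
open Set

namespace SW
open MeasureTheory Filter Topology
open intervalIntegral hiding integral_const_mul

lemma gron {f f' : ℝ → ℝ} {T C t0 : ℝ} (hf : ∀ t ∈ Icc 0 T, HasDerivWithinAt f (f' t) (Icc 0 T) t)
    (hb : ∀ t ∈ Icc 0 T, |f' t| ≤ C * |f t|) (ht0 : t0 ∈ Icc 0 T) (h0 : f t0 = 0) : 
    ∀ t ∈ Icc 0 T, f t = 0 := by
  have hc : ContinuousOn f (Icc 0 T) := fun x hx => (hf x hx).continuousWithinAt
  have hd : ∀ σ : ℝ, ∀ t ∈ interior (Icc 0 T), HasDerivWithinAt (fun s => f s ^ 2 * Real.exp (σ * s)) 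
      ((2 * f t * f' t + σ * f t ^ 2) * Real.exp (σ * t)) (interior (Icc 0 T)) t := by
    intro σ t ht
    have h1 := (hf t (interior_subset ht)).mono interior_subset
    have h2 : HasDerivWithinAt (fun s => Real.exp (σ * s)) (Real.exp (σ * t) * σ) (interior (Icc 0 T)) t := by
      have : HasDerivAt (fun s : ℝ => σ * s) σ t := by simpa using (hasDerivAt_id t).const_mul σ
      exact this.exp.hasDerivWithinAt
    refine ((h1.pow 2).mul h2).congr_deriv ?_
    simp; ring
  have bb : ∀ t ∈ Icc 0 T, |2 * f t * f' t| ≤ 2 * C * f t ^ 2 := by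
    intro t ht
    rw [abs_mul, abs_mul, ← sq_abs (f t), abs_of_pos (by norm_num : (0:ℝ) < 2)]
    nlinarith [hb t ht, abs_nonneg (f t)]
  have mono : MonotoneOn (fun s => f s ^ 2 * Real.exp ((2 * C) * s)) (Icc 0 T) :=
    monotoneOn_of_hasDerivWithinAt_nonneg (convex_Icc 0 T) (by fun_prop) (hd (2 * C)) (fun t ht => by
      have := (abs_le.1 (bb t (interior_subset ht))).1
      exact mul_nonneg (by linarith) (Real.exp_nonneg _))
  have anti : AntitoneOn (fun s => f s ^ 2 * Real.exp ((-(2 * C)) * s)) (Icc 0 T) :=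
    antitoneOn_of_hasDerivWithinAt_nonpos (convex_Icc 0 T) (by fun_prop) (hd (-(2 * C))) (fun t ht => by
      have := (abs_le.1 (bb t (interior_subset ht))).2
      exact mul_nonpos_of_nonpos_of_nonneg (by linarith) (Real.exp_nonneg _))
  intro t ht
  rcases le_total t t0 with h | h
  · have := mono ht ht0 h
    simp only [h0] at this
    have e := Real.exp_pos (2 * C * t)
    by_contra hne
    have : 0 < f t ^ 2 := by positivity
    nlinarith
  · have := anti ht0 ht h
    simp only [h0] at this
    have e := Real.exp_pos (-(2 * C) * t)
    by_contra hne
    have : 0 < f t ^ 2 := by positivity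
    nlinarith

lemma low_bounds {T : ℝ} {f : ℕ → ℝ → ℝ → ℝ} {r : ℕ} (hr : 2 ≤ r) (hD : ∀ t ∈ Icc 0 T, ∀ j < r, D (f j t) (f (j+1) t))
    (hj : ContinuousOn (fun p : ℝ × ℝ => f 0 p.1 p.2) (Icc 0 T ×ˢ I)) {K : ℝ}
    (hK : ∀ t ∈ Icc 0 T, nrm (f 2 t) ≤ K) : ∃ L, 0 ≤ L ∧ ∀ t ∈ Icc 0 T, ∀ j < 3, nrm (f j t) ≤ L := by
  obtain ⟨M, hM⟩ := (isCompact_Icc.prod isCompact_Icc).exists_bound_of_continuousOn hj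
  have hM' : ∀ t ∈ Icc 0 T, ∀ x ∈ I, |f 0 t x| ≤ |M| := fun t ht x hx => (hM (t, x) ⟨ht, hx⟩).trans (le_abs_self _)
  refine ⟨2 * |M| + |K|, by positivity, fun t ht j hj => ?_⟩
  have a1 := abs_nonneg M
  have a2 := abs_nonneg K
  have a3 := le_abs_self K
  have k2 := hK t ht
  have h1 := hD t ht 0 (by omega)
  have h2 := hD t ht 1 (by omega)
  simp only [zero_add, Nat.reduceAdd] at h1 h2
  interval_cases j
  · exact (nrm_le_sup a1 h1.cont (hM' t ht)).trans (by linarith)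
  · obtain ⟨z, hz, hz'⟩ := exists_hasDerivAt_eq_slope _ _ zero_lt_one h1.cont (fun x hx => h1.hasDerivAt hx)
    have hzI := Ioo_subset_Icc_self hz
    have h3 : |f 1 t z| ≤ 2 * |M| := by
      rw [hz']
      have := abs_sub (f 0 t 1) (f 0 t 0)
      have h0 := hM' t ht 0 zero_mem
      have h1 := hM' t ht 1 one_mem
      norm_num
      linarith
    refine nrm_le_sup (by positivity) h1.cont' (fun x hx => ?_)
    have o := osc_le h2 hx hzI
    have := abs_sub_abs_le_abs_sub (f 1 t x) (f 1 t z)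
    linarith
  · linarith

lemma lei_one (f g : ℕ → ℝ → ℝ) (x : ℝ) : lei f g 1 x = f 0 x * g 1 x + f 1 x * g 0 x := by
  have := lei_eq f g 0 x
  rw [this, Win.mid_zero]
  · simp
  · intro p q h1 h2 h3; omega

lemma step {T : ℝ} {r : ℕ} {a u : ℕ → ℝ → ℝ → ℝ} {av uv : ℝ → ℝ → ℝ}
    (h : Sol T r a u av uv) {n : ℕ} (hn : 1 ≤ n) (hnr : n + 2 ≤ r) {K : ℝ} (hK : 0 ≤ K)
    (ka : ∀ t ∈ Icc 0 T, ∀ j < n + 2, nrm (a j t) ≤ K) (ku : ∀ t ∈ Icc 0 T, ∀ j < n + 2, nrm (u j t) ≤ K) :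
    ∃ K', ∀ t ∈ Icc 0 T, nrm (a (n + 2) t) ≤ K' ∧ nrm (u (n + 2) t) ≤ K' := by
  have dA : ∀ t ∈ Icc 0 T, ∀ x ∈ I, HasDerivWithinAt (fun s => a 0 s x) (At (fun j => a j t) (fun j => u j t) 0 x) (Icc 0 T) t := by
    intro t ht x hx
    refine (h.da t ht x hx).congr_deriv ?_
    rw [At, zero_add, lei_one, h.ea t ht x hx]; ring
  have dU : ∀ t ∈ Icc 0 T, ∀ x ∈ I, HasDerivWithinAt (fun s => u 0 s x) (Ut (fun j => a j t) (fun j => u j t) 0 x) (Icc 0 T) t := by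
    intro t ht x hx
    refine (h.du t ht x hx).congr_deriv ?_
    rw [Ut, zero_add, lei_one, lei_one, h.eu t ht x hx]; ring
  have deg : ∀ z ∈ I, (∀ t ∈ Icc 0 T, u 0 t z = 0) → (∀ t ∈ Icc 0 T, a 0 t z = 0) ∨ (∀ t ∈ Icc 0 T, a 0 t z ≠ 0) := by
    intro z hz hu0
    by_cases hh : ∃ t0 ∈ Icc 0 T, a 0 t0 z = 0
    · obtain ⟨t0, ht0, h0⟩ := hh
      left
      refine gron (C := K) (fun t ht => h.da t ht z hz) (fun t ht => ?_) ht0 h0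
      rw [h.ea t ht z hz, hu0 t ht]
      have h1 := sup_le (h.cu t ht 1 (by omega)) hz
      have h2 := ku t ht 1 (by omega)
      have h3 := ku t ht 2 (by omega)
      simp only [Nat.reduceAdd] at h1
      rw [zero_mul, add_zero, abs_mul, abs_mul, abs_neg, abs_of_pos (by norm_num : (0:ℝ) < 1/2)]
      nlinarith [abs_nonneg (a 0 t z)]
    · right; push Not at hh; exact hh
  have deg0 := deg 0 zero_mem (fun t ht => (h.bd t ht).1)
  have deg1 := deg 1 one_mem (fun t ht => (h.bd t ht).2)
  have hwC := Win.wC_nonneg (n := n) hK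
  set Y : ℝ → ℝ := fun t => max (nrm (a (n + 2) t) ^ 2) (nrm (u (n + 2) t) ^ 2) with hY
  have Y0 : ∀ t, 0 ≤ Y t := fun t => le_max_of_le_left (sq_nonneg _)
  have hcl : ∀ B : ℝ, IsClosed {t | t ∈ Icc 0 T ∧ Y t ≤ B} := by
    intro B
    by_cases hB : 0 ≤ B
    · have c1 := closed_lemma (T := T) (f := a) (m := n + 2) (fun t ht j hj => h.ca t ht j (by omega)) (by omega) h.ja (Real.sqrt_nonneg B)
      have c2 := closed_lemma (T := T) (f := u) (m := n + 2) (fun t ht j hj => h.cu t ht j (by omega)) (by omega) h.ju (Real.sqrt_nonneg B)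
      convert c1.inter c2 using 1
      ext t
      simp only [mem_ofPred_eq, mem_inter_iff, hY, max_le_iff]
      rw [Real.le_sqrt (nrm_nonneg _) hB, Real.le_sqrt (nrm_nonneg _) hB]
      tauto
    · convert isClosed_empty using 1
      ext t
      simp only [mem_ofPred_eq, mem_empty_iff_false, iff_false, not_and]
      intro _ h2
      exact hB ((Y0 t).trans h2)
  have hest : ∀ c d S, 0 ≤ c → c ≤ d → d ≤ T → (∀ s ∈ Icc c d, Y s ≤ S) →
      ∀ s ∈ Icc c d, ∀ s2 ∈ Icc c d, Y s ≤ 2 * Y s2 + 2 * Win.wC n K * (S + 1) * |s - s2| := by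
    intro c d S hc hcd hd hS t ht t' ht'
    rcases hcd.eq_or_lt with rfl | hlt
    · have : t = t' := by rw [Icc_self, mem_singleton_iff] at ht ht'; rw [ht, ht']
      subst this
      have := Y0 t
      simp; linarith
    have hS0 : 0 ≤ S := (Y0 t).trans (hS t ht)
    have sub : Icc c d ⊆ Icc 0 T := Icc_subset_Icc hc hd
    have sub2 : Icc c d ×ˢ I ⊆ Icc 0 T ×ˢ I := prod_mono sub subset_rfl
    have w : Win c d n a u K √S := {
      cd := hlt
      K0 := hK
      s0 := Real.sqrt_nonneg _
      n0 := hn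
      ha := fun t ht j hj => h.ca t (sub ht) j (by omega)
      hu := fun t ht j hj => h.cu t (sub ht) j (by omega)
      ka := fun t ht => ka t (sub ht)
      ku := fun t ht => ku t (sub ht)
      ka' := fun t ht => Real.le_sqrt_of_sq_le ((le_max_left _ _).trans (hS t ht))
      ku' := fun t ht => Real.le_sqrt_of_sq_le ((le_max_right _ _).trans (hS t ht))
      ja := h.ja.mono sub2
      ju := h.ju.mono sub2
      da := fun t ht x hx => (dA t (sub ht) x hx).mono sub
      du := fun t ht x hx => (dU t (sub ht) x hx).mono sub
      bd := fun t ht => h.bd t (sub ht) }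
    have est := w.est (deg0.imp (fun h t ht => h t (sub ht)) (fun h t ht => h t (sub ht)))
      (deg1.imp (fun h t ht => h t (sub ht)) (fun h t ht => h t (sub ht))) ht ht'
    have q1 : (1 + √S) ^ 2 ≤ 2 * (S + 1) := by nlinarith [Real.sq_sqrt hS0, sq_nonneg (1 - √S)]
    have q2 : Win.wC n K * (1 + √S) ^ 2 * |t - t'| ≤ 2 * Win.wC n K * (S + 1) * |t - t'| := by
      have := mul_le_mul_of_nonneg_right (mul_le_mul_of_nonneg_left q1 hwC) (abs_nonneg (t - t'))
      linarith
    have q3 : nrm (a (n + 2) t') ^ 2 ≤ Y t' := le_max_left _ _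
    have q4 : nrm (u (n + 2) t') ^ 2 ≤ Y t' := le_max_right _ _
    exact max_le (by linarith [est.1]) (by linarith [est.2])
  obtain ⟨B, hB⟩ := baire Y0 (by positivity) hcl hest
  refine ⟨√B, fun t ht => ⟨Real.le_sqrt_of_sq_le ((le_max_left _ _).trans (hB t ht)), 
      Real.le_sqrt_of_sq_le ((le_max_right _ _).trans (hB t ht))⟩⟩

/-- all spatial derivatives are bounded in L², uniformly in time -/
lemma all_bounds {T : ℝ} {r : ℕ} {a u : ℕ → ℝ → ℝ → ℝ} {av uv : ℝ → ℝ → ℝ}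
    (h : Sol T r a u av uv) (hr : 2 ≤ r) : ∃ K, 0 ≤ K ∧ ∀ t ∈ Icc 0 T, ∀ j ≤ r, nrm (a j t) ≤ K ∧ nrm (u j t) ≤ K := by
  obtain ⟨K, hK0, hK⟩ := stage1 h hr
  obtain ⟨L, hL0, hL⟩ := low_bounds hr h.ca h.ja (fun t ht => (hK t ht).1)
  obtain ⟨L', hL0', hL'⟩ := low_bounds hr h.cu h.ju (fun t ht => (hK t ht).2)
  have key : ∀ n, n + 2 ≤ r → ∃ K, 0 ≤ K ∧ ∀ t ∈ Icc 0 T, ∀ j < n + 3, nrm (a j t) ≤ K ∧ nrm (u j t) ≤ K := by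
    intro n
    induction n with
    | zero => 
      intro _
      refine ⟨L + L', by positivity, fun t ht j hj => ⟨by linarith [hL t ht j hj], by linarith [hL' t ht j hj]⟩⟩
    | succ n ih =>
      intro hn
      obtain ⟨K, hK0, hK⟩ := ih (by omega)
      obtain ⟨K', hK'⟩ := step h (n := n + 1) (by omega) hn hK0 (fun t ht j hj => (hK t ht j hj).1) (fun t ht j hj => (hK t ht j hj).2)
      refine ⟨max K K', le_max_of_le_left hK0, fun t ht j hj => ?_⟩
      rcases (Nat.lt_succ_iff.1 hj).lt_or_eq with hj | rfl
      · exact ⟨(hK t ht j hj).1.trans (le_max_left _ _), (hK t ht j hj).2.trans (le_max_left _ _)⟩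
      · exact ⟨(hK' t ht).1.trans (le_max_right _ _), (hK' t ht).2.trans (le_max_right _ _)⟩
  obtain ⟨K, h1, h2⟩ := key (r - 2) (by omega)
  exact ⟨K, h1, fun t ht j hj => h2 t ht j (by omega)⟩

end SW
end

noncomputable section
open Set
namespace SW
open MeasureTheory Filter Topology
open intervalIntegral hiding integral_const_mul

/-- Lebesgue measure on the unit interval -/
abbrev nu : Measure ℝ := volume.restrict (Ioc (0:ℝ) 1)

/-- essentially bounded measurable functions on the unit interval -/
def BL (f : ℝ → ℝ) : Prop := AEStronglyMeasurable f nu ∧ ∃ K : ℝ, ∀ᵐ y ∂nu, |f y| ≤ K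

namespace BL
variable {f g : ℝ → ℝ}

lemma of_cont (h : ContinuousOn f I) : BL f := by
  refine ⟨(h.aestronglyMeasurable measurableSet_Icc).mono_measure (Measure.restrict_mono Ioc_subset_Icc_self le_rfl), ?_⟩
  obtain ⟨K, hK⟩ := isCompact_Icc.exists_bound_of_continuousOn h
  refine ⟨K, ?_⟩
  filter_upwards [ae_restrict_mem measurableSet_Ioc] with y hy
  exact hK y (Ioc_subset_Icc_self hy)

lemma add (hf : BL f) (hg : BL g) : BL (fun y => f y + g y) := by
  obtain ⟨m, K, hK⟩ := hf
  obtain ⟨m', K', hK'⟩ := hg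
  refine ⟨m.add m', K + K', ?_⟩
  filter_upwards [hK, hK'] with y h1 h2
  exact (abs_add_le _ _).trans (add_le_add h1 h2)

lemma neg (hf : BL f) : BL (fun y => - f y) := by
  obtain ⟨m, K, hK⟩ := hf
  refine ⟨m.neg, K, ?_⟩
  filter_upwards [hK] with y h1
  rwa [abs_neg]

lemma sub (hf : BL f) (hg : BL g) : BL (fun y => f y - g y) := by
  simpa [sub_eq_add_neg] using hf.add hg.neg

lemma mul (hf : BL f) (hg : BL g) : BL (fun y => f y * g y) := by
  obtain ⟨m, K, hK⟩ := hf
  obtain ⟨m', K', hK'⟩ := hg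
  refine ⟨m.mul m', K * K', ?_⟩
  filter_upwards [hK, hK'] with y h1 h2
  rw [abs_mul]
  exact mul_le_mul h1 h2 (abs_nonneg _) ((abs_nonneg _).trans h1)

lemma const (c : ℝ) : BL (fun _ => c) := of_cont continuousOn_const

lemma smul (c : ℝ) (hf : BL f) : BL (fun y => c * f y) := (const c).mul hf

lemma abs (hf : BL f) : BL (fun y => |f y|) := by
  obtain ⟨m, K, hK⟩ := hf
  refine ⟨m.norm, K, ?_⟩
  filter_upwards [hK] with y h1
  rwa [abs_abs]

lemma sq (hf : BL f) : BL (fun y => f y ^ 2) := by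
  simpa [pow_two] using hf.mul hf

lemma sum {ι : Type*} (s : Finset ι) {F : ι → ℝ → ℝ} (h : ∀ i ∈ s, BL (F i)) : BL (fun y => ∑ i ∈ s, F i y) := by
  classical
  induction s using Finset.induction_on with
  | empty => simpa using const 0
  | insert a s ha ih =>
    simp only [Finset.sum_insert ha]
    exact (h a (Finset.mem_insert_self _ _)).add (ih fun i hi => h i (Finset.mem_insert_of_mem hi))

lemma congr (hf : BL f) (h : ∀ᵐ y ∂nu, g y = f y) : BL g := by
  obtain ⟨m, K, hK⟩ := hf
  refine ⟨m.congr (h.mono fun y hy => hy.symm), K, ?_⟩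
  filter_upwards [hK, h] with y h1 h2
  rwa [h2]

lemma ii (hf : BL f) : IntervalIntegrable f volume 0 1 := by
  obtain ⟨m, K, hK⟩ := hf
  rw [intervalIntegrable_iff_integrableOn_Ioc_of_le zero_le_one]
  exact Integrable.of_bound m K hK

lemma ii' (hf : BL f) {a b : ℝ} (ha : a ∈ I) (hb : b ∈ I) : IntervalIntegrable f volume a b := by
  refine hf.ii.mono_set ?_
  rw [uIcc_of_le (zero_le_one)]
  exact uIcc_subset_Icc ha hb

lemma cs (hf : BL f) (hg : BL g) : |∫ x in (0:ℝ)..1, f x * g x| ≤ nrm f * nrm g :=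
  cs_gen hf.sq.ii hg.sq.ii (hf.mul hg).ii

lemma nrm_add (hf : BL f) (hg : BL g) : nrm (fun x => f x + g x) ≤ nrm f + nrm g := by
  apply nrm_le_of_sq (add_nonneg (nrm_nonneg _) (nrm_nonneg _))
  have e : ∀ x, (f x + g x) ^ 2 = f x ^ 2 + 2 * (f x * g x) + g x ^ 2 := by intro x; ring
  simp only [e]
  rw [integral_add (hf.sq.add ((hf.mul hg).smul 2)).ii hg.sq.ii,
    integral_add hf.sq.ii ((hf.mul hg).smul 2).ii, intervalIntegral.integral_const_mul,
    ← nrm_sq, ← nrm_sq]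
  have := le_of_abs_le (cs hf hg)
  nlinarith

lemma nrm_sub (hf : BL f) (hg : BL g) : nrm (fun x => f x - g x) ≤ nrm f + nrm g := by
  have := hf.nrm_add hg.neg
  rw [SW.nrm_neg] at this
  simpa [sub_eq_add_neg] using this

lemma nrm_mul_le {K : ℝ} (hK : 0 ≤ K) (hf : BL f) (hg : BL g)
    (h : ∀ x ∈ I, |f x| ≤ K) : nrm (fun x => f x * g x) ≤ K * nrm g := by
  apply nrm_le_of_sq (mul_nonneg hK (nrm_nonneg _))
  rw [mul_pow, nrm_sq, ← intervalIntegral.integral_const_mul]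
  apply integral_mono_on zero_le_one (hf.mul hg).sq.ii (hg.sq.smul _).ii
  intro x hx
  rw [mul_pow, ← sq_abs (f x)]
  exact mul_le_mul_of_nonneg_right (pow_le_pow_left₀ (abs_nonneg _) (h x hx) 2) (sq_nonneg _)

end BL

lemma nu_congr {f g : ℝ → ℝ} (h : ∀ᵐ y ∂nu, f y = g y) : ∫ x in (0:ℝ)..1, f x = ∫ x in (0:ℝ)..1, g x := by
  rw [integral_of_le zero_le_one, integral_of_le zero_le_one]
  exact MeasureTheory.integral_congr_ae h

lemma nrm_congr_ae {f g : ℝ → ℝ} (h : ∀ᵐ y ∂nu, f y = g y) : nrm f = nrm g := by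
  unfold nrm; congr 1
  apply nu_congr
  filter_upwards [h] with y hy
  rw [hy]

lemma nu_off {s : Set ℝ} (hs : s.Countable) : ∀ᵐ y ∂nu, y ∈ Ioo (0:ℝ) 1 \ s := by
  have h1 : ∀ᵐ y ∂nu, y ∉ insert (1:ℝ) s := by
    have : (volume : Measure ℝ) (insert (1:ℝ) s) = 0 := (hs.insert 1).measure_zero _
    exact ae_restrict_of_ae (measure_eq_zero_iff_ae_notMem.1 this)
  filter_upwards [h1, ae_restrict_mem measurableSet_Ioc] with y h2 h3
  simp only [mem_insert_iff, not_or] at h2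
  exact ⟨⟨h3.1, lt_of_le_of_ne h3.2 h2.1⟩, h2.2⟩

/-- continuous functions with bounded derivative off a countable set -/
def W (f f' : ℝ → ℝ) : Prop :=
  ContinuousOn f I ∧ BL f' ∧ ∃ s : Set ℝ, s.Countable ∧ ∀ y ∈ Ioo (0:ℝ) 1 \ s, HasDerivAt f (f' y) y

lemma D.toW {f f' : ℝ → ℝ} (h : D f f') : W f f' :=
  ⟨h.cont, BL.of_cont h.2, ∅, countable_empty, fun _ hy => h.hasDerivAt hy.1⟩

namespace W
variable {f f' g g' : ℝ → ℝ}

lemma bl (h : W f f') : BL f := BL.of_cont h.1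

lemma add (hf : W f f') (hg : W g g') : W (fun x => f x + g x) (fun x => f' x + g' x) := by
  obtain ⟨c, b, s, hs, h⟩ := hf
  obtain ⟨c', b', s', hs', h'⟩ := hg
  exact ⟨c.add c', b.add b', s ∪ s', hs.union hs', fun y hy => 
    (h y ⟨hy.1, fun q => hy.2 (Or.inl q)⟩).add (h' y ⟨hy.1, fun q => hy.2 (Or.inr q)⟩)⟩

lemma neg (hf : W f f') : W (fun x => - f x) (fun x => - f' x) := by
  obtain ⟨c, b, s, hs, h⟩ := hf
  exact ⟨c.neg, b.neg, s, hs, fun y hy => (h y hy).neg⟩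

lemma sub (hf : W f f') (hg : W g g') : W (fun x => f x - g x) (fun x => f' x - g' x) := by
  simpa [sub_eq_add_neg] using hf.add hg.neg

lemma mul (hf : W f f') (hg : W g g') :
    W (fun x => f x * g x) (fun x => f' x * g x + f x * g' x) := by
  obtain ⟨c, b, s, hs, h⟩ := id hf
  obtain ⟨c', b', s', hs', h'⟩ := id hg
  exact ⟨c.mul c', (b.mul hg.bl).add (hf.bl.mul b'), s ∪ s', hs.union hs', fun y hy => 
    (h y ⟨hy.1, fun q => hy.2 (Or.inl q)⟩).mul (h' y ⟨hy.1, fun q => hy.2 (Or.inr q)⟩)⟩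

lemma const (c : ℝ) : W (fun _ => c) (fun _ => 0) := (D.const c).toW

lemma smul (c : ℝ) (hf : W f f') : W (fun x => c * f x) (fun x => c * f' x) := by
  simpa using (const c).mul hf

lemma sum {ι : Type*} (s : Finset ι) {F F' : ι → ℝ → ℝ} (h : ∀ i ∈ s, W (F i) (F' i)) :
    W (fun y => ∑ i ∈ s, F i y) (fun y => ∑ i ∈ s, F' i y) := by
  classical
  induction s using Finset.induction_on with
  | empty => simpa using const 0
  | insert a s ha ih =>
    simp only [Finset.sum_insert ha]
    exact (h a (Finset.mem_insert_self _ _)).add (ih fun i hi => h i (Finset.mem_insert_of_mem hi))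

lemma congr (hf : W f f') (h1 : ∀ x, g x = f x) (h2 : ∀ x, g' x = f' x) : W g g' := by
  obtain rfl : g = f := funext h1
  obtain rfl : g' = f' := funext h2
  exact hf

lemma ae_deriv (hf : W f f') : ∀ᵐ y ∂nu, deriv f y = f' y := by
  obtain ⟨c, b, s, hs, h⟩ := hf
  filter_upwards [nu_off hs] with y hy
  exact (h y hy).deriv

lemma int_ab (hf : W f f') {a b : ℝ} (ha : a ∈ I) (hb : b ∈ I) :
    ∫ x in a..b, f' x = f b - f a := by
  obtain ⟨c, bl, s, hs, h⟩ := hf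
  refine integral_eq_of_hasDerivAt_off_countable f f' hs (c.mono (uIcc_subset_Icc ha hb)) ?_ (bl.ii' ha hb)
  intro y hy
  refine h y ⟨⟨lt_of_le_of_lt (le_min ha.1 hb.1) hy.1.1, lt_of_lt_of_le hy.1.2 (max_le ha.2 hb.2)⟩, hy.2⟩

lemma abs_sub_le (h : W f f') {a b y : ℝ} (ha : a ∈ I) (hb : b ∈ I) (hy : y ∈ Icc a b) :
    |f y - f a| ≤ ∫ t in a..b, |f' t| := by
  have hyI : y ∈ I := ⟨ha.1.trans hy.1, hy.2.trans hb.2⟩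
  rw [← h.int_ab ha hyI]
  refine (abs_integral_le_integral_abs hy.1).trans ?_
  exact integral_mono_interval le_rfl hy.1 hy.2 (Filter.Eventually.of_forall fun _ => abs_nonneg _)
    (h.2.1.abs.ii' ha hb)

lemma osc_le (h : W f f') {x y : ℝ} (hx : x ∈ I) (hy : y ∈ I) :
    |f x - f y| ≤ nrm f' := by
  have h2 := (BL.const 1).cs h.2.1.abs
  have h3 : nrm (fun _ => (1:ℝ)) = 1 := by simp [nrm]
  have h4 : nrm (fun x => |f' x|) = nrm f' := by simp [nrm]
  rw [h3, h4] at h2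
  have h5 : ∫ t in (0:ℝ)..1, |f' t| ≤ nrm f' := by simpa using le_of_abs_le h2
  have key : ∀ a ∈ I, ∀ b ∈ I, a ≤ b → |f b - f a| ≤ nrm f' := by
    intro a ha b hb hab
    refine (h.abs_sub_le ha hb ⟨hab, le_rfl⟩).trans (le_trans ?_ h5)
    exact integral_mono_interval ha.1 hab hb.2 (Filter.Eventually.of_forall fun _ => abs_nonneg _)
        h.2.1.abs.ii
  rcases le_total x y with hh | hh
  · rw [abs_sub_comm]; exact key x hx y hy hh
  · exact key y hy x hx hh

lemma sup_le (h : W f f') {x : ℝ} (hx : x ∈ I) : |f x| ≤ nrm f + nrm f' := by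
  obtain ⟨z, hz, h1⟩ := exists_le_nrm h.1
  have h2 := h.osc_le hx hz
  have := abs_sub_abs_le_abs_sub (f x) (f z)
  linarith

end W
end SW
end

noncomputable section
open Set
namespace SW
open MeasureTheory Filter Topology
open intervalIntegral hiding integral_const_mul

/-- truncated power -/
def tpw (m : ℕ) (z y : ℝ) : ℝ := if z ≤ y then (y - z) ^ m else 0

lemma tpw_of_le {m : ℕ} {z y : ℝ} (h : z ≤ y) : tpw m z y = (y - z) ^ m := if_pos h
lemma tpw_of_lt {m : ℕ} {z y : ℝ} (h : y < z) : tpw m z y = 0 := if_neg (not_le.2 h)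
lemma tpw_of_ge {m : ℕ} {z y : ℝ} (h : y ≤ z) : tpw (m + 1) z y = 0 := by
  rcases h.eq_or_lt with rfl | h
  · rw [tpw_of_le le_rfl]; simp
  · exact tpw_of_lt h
lemma tpw_max (m : ℕ) (z y : ℝ) : tpw (m + 1) z y = (max (y - z) 0) ^ (m + 1) := by
  rcases le_total z y with h | h
  · rw [tpw_of_le h, max_eq_left (by linarith)]
  · rw [tpw_of_ge h, max_eq_right (by linarith)]; simp

lemma tpw_cont (m : ℕ) (z : ℝ) : Continuous (tpw (m + 1) z) := by
  have : tpw (m + 1) z = fun y => (max (y - z) 0) ^ (m + 1) := funext (tpw_max m z)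
  rw [this]; fun_prop

lemma tpw_deriv (m : ℕ) {z y : ℝ} (h : y ≠ z) : HasDerivAt (tpw (m + 1) z) ((m + 1) * tpw m z y) y := by
  rcases lt_or_gt_of_ne h with h | h
  · rw [tpw_of_lt h, mul_zero]
    refine (hasDerivAt_const y (0:ℝ)).congr_of_eventuallyEq ?_
    filter_upwards [Iio_mem_nhds h] with s hs
    exact tpw_of_lt hs
  · rw [tpw_of_le h.le]
    have h1 : HasDerivAt (fun s => (s - z) ^ (m + 1)) (((m + 1 : ℕ) : ℝ) * (y - z) ^ m * 1) y := by
      simpa using ((hasDerivAt_id y).sub_const z).fun_pow (m + 1)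
    have h2 := h1.congr_of_eventuallyEq (f₁ := tpw (m + 1) z) (by
      filter_upwards [Ioi_mem_nhds h] with s hs
      exact tpw_of_le (le_of_lt hs))
    refine h2.congr_deriv ?_
    push_cast; ring

lemma tpw_bl (m : ℕ) (z : ℝ) : BL (tpw m z) := by
  refine ⟨?_, ?_⟩
  · apply Measurable.aestronglyMeasurable
    unfold tpw
    exact Measurable.ite measurableSet_Ici (by fun_prop) measurable_const
  · obtain ⟨K, hK⟩ := (BL.of_cont (f := fun y => (y - z) ^ m) (by fun_prop)).2
    refine ⟨K, ?_⟩
    filter_upwards [hK] with y hy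
    unfold tpw
    split_ifs
    · exact hy
    · simpa using (abs_nonneg _).trans hy

lemma tpw_W (m : ℕ) (z : ℝ) : W (fun y => tpw (m + 1) z y / (m + 1)) (tpw m z) := by
  refine ⟨((tpw_cont m z).div_const _).continuousOn, tpw_bl m z, {z}, countable_singleton z, ?_⟩
  intro y hy
  have := (tpw_deriv m (z := z) (y := y) (by simpa using hy.2)).div_const ((m:ℝ) + 1)
  refine this.congr_deriv ?_
  have hm : ((m : ℝ) + 1) ≠ 0 := by positivity
  field_simp

/-- splines of degree `m` with knots `x 0, …, x N` -/
def Spl (m N : ℕ) (x : ℕ → ℝ) (φ : ℝ → ℝ) : Prop :=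
  ∃ d c : ℕ → ℝ, ∀ y, φ y = ∑ i ∈ Finset.range (m + 1), d i * y ^ i
    + ∑ i ∈ Finset.range (N + 1), c i * tpw m (x i) y

namespace Spl
variable {m N : ℕ} {x : ℕ → ℝ} {φ ψ : ℝ → ℝ}

lemma add (h : Spl m N x φ) (h' : Spl m N x ψ) : Spl m N x (fun y => φ y + ψ y) := by
  obtain ⟨d, c, e⟩ := h
  obtain ⟨d', c', e'⟩ := h'
  refine ⟨fun i => d i + d' i, fun i => c i + c' i, fun y => ?_⟩
  simp only [e, e', add_mul, Finset.sum_add_distrib]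
  ring

lemma smul (a : ℝ) (h : Spl m N x φ) : Spl m N x (fun y => a * φ y) := by
  obtain ⟨d, c, e⟩ := h
  refine ⟨fun i => a * d i, fun i => a * c i, fun y => ?_⟩
  simp only [e, mul_add, Finset.mul_sum, mul_assoc]

lemma zero : Spl m N x (fun _ => 0) := ⟨fun _ => 0, fun _ => 0, fun y => by simp⟩

lemma sum {ι : Type*} (s : Finset ι) {F : ι → ℝ → ℝ} (h : ∀ i ∈ s, Spl m N x (F i)) :
    Spl m N x (fun y => ∑ i ∈ s, F i y) := by
  classical
  induction s using Finset.induction_on with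
  | empty => simpa using zero
  | insert a s ha ih =>
    simp only [Finset.sum_insert ha]
    exact (h a (Finset.mem_insert_self _ _)).add (ih fun i hi => h i (Finset.mem_insert_of_mem hi))

lemma tpw {i : ℕ} (hi : i ≤ N) : Spl m N x (SW.tpw m (x i)) := by
  refine ⟨fun _ => 0, fun j => if j = i then 1 else 0, fun y => ?_⟩
  simp [Nat.lt_succ_of_le hi]

lemma bl (h : Spl m N x φ) : BL φ := by
  obtain ⟨d, c, e⟩ := h
  have : φ = _ := funext e
  rw [this]
  exact (BL.of_cont (by fun_prop)).add (BL.sum _ fun i _ => (tpw_bl m (x i)).smul _)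

lemma int (h : Spl m N x φ) (v : ℝ) : ∃ Φ, Spl (m + 1) N x Φ ∧ Φ 0 = v ∧ W Φ φ := by
  obtain ⟨d, c, e⟩ := h
  set v0 := ∑ i ∈ Finset.range (N + 1), c i / (m + 1) * SW.tpw (m + 1) (x i) 0 with hv
  refine ⟨fun y => ∑ i ∈ Finset.range (m + 2), (if i = 0 then v - v0 else d (i - 1) / i) * y ^ i
    + ∑ i ∈ Finset.range (N + 1), c i / (m + 1) * SW.tpw (m + 1) (x i) y, ⟨_, _, fun y => rfl⟩, ?_, ?_⟩
  · simp only
    rw [Finset.sum_range_succ']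
    simp [← hv]
  · have hp : W (fun y => ∑ i ∈ Finset.range (m + 2), (if i = 0 then v - v0 else d (i - 1) / i) * y ^ i)
        (fun y => ∑ i ∈ Finset.range (m + 1), d i * y ^ i) := by
      refine ⟨by fun_prop, BL.of_cont (by fun_prop), ∅, countable_empty, fun y _ => ?_⟩
      have e1 : (fun y : ℝ => ∑ i ∈ Finset.range (m + 2), (if i = 0 then v - v0 else d (i - 1) / i) * y ^ i) =
          fun y => ∑ i ∈ Finset.range (m + 1), (d i / ((i : ℝ) + 1)) * y ^ (i + 1) + (v - v0) := by
        funext y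
        rw [Finset.sum_range_succ']
        simp
      rw [e1]
      apply HasDerivAt.add_const
      apply HasDerivAt.fun_sum
      intro i _
      have := (hasDerivAt_pow (i + 1) y).const_mul (d i / ((i : ℝ) + 1))
      refine this.congr_deriv ?_
      have : ((i : ℝ) + 1) ≠ 0 := by positivity
      push_cast
      field_simp
    refine (hp.add (W.sum (Finset.range (N + 1)) (fun i _ => (tpw_W m (x i)).smul (c i)))).congr (fun y => ?_) e
    congr 1
    exact Finset.sum_congr rfl fun i _ => by ring

end Spl

/-- B-spline bump -/
lemma bump (m : ℕ) {z : ℕ → ℝ} {g L : ℝ} (hg : 0 < g) (hL : 0 ≤ L) (hz : ∀ l < m + 1, g ≤ z (l + 1) - z l) :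
    ∃ w : ℕ → ℝ, (∀ y < z 0, ∑ l ∈ Finset.range (m + 2), w l * tpw m (z l) y = 0) ∧
      (∀ y, z (m + 1) ≤ y → ∑ l ∈ Finset.range (m + 2), w l * tpw m (z l) y = 0) ∧
      (∀ y, y - z 0 ≤ L → |∑ l ∈ Finset.range (m + 2), w l * tpw m (z l) y| ≤ (m + 2) * ((m + 1) / g ^ (m + 1) * L ^ m)) ∧
      (∀ q ∈ I, z 0 ∈ I → z (m + 1) ≤ q → ∫ y in z 0..q, ∑ l ∈ Finset.range (m + 2), w l * tpw m (z l) y = 1) := by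
  have mono : ∀ l j, l < j → j ≤ m + 1 → g ≤ z j - z l := by
    intro l j hlj
    induction j with
    | zero => omega
    | succ j ih =>
      intro hj
      have h1 := hz j (by omega)
      rcases (Nat.lt_succ_iff.1 hlj).eq_or_lt with rfl | h
      · exact h1
      · have := ih h (by omega); linarith
  have mono0 : ∀ l ≤ m + 1, z 0 ≤ z l := by
    intro l hl
    rcases Nat.eq_zero_or_pos l with rfl | h
    · exact le_rfl
    · have := mono 0 l h hl; linarith
  have monoE : ∀ l ≤ m + 1, z l ≤ z (m + 1) := by
    intro l hl
    rcases hl.eq_or_lt with rfl | h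
    · exact le_rfl
    · have := mono l (m + 1) h le_rfl; linarith
  have sep : ∀ l ∈ Finset.range (m + 2), ∀ j ∈ Finset.range (m + 2), j ≠ l → g ≤ |z l - z j| := by
    intro l hl j hj hne
    rw [Finset.mem_range] at hl hj
    rcases lt_or_gt_of_ne hne with h | h
    · exact (mono j l h (by omega)).trans (le_abs_self _)
    · rw [abs_sub_comm]; exact (mono l j h (by omega)).trans (le_abs_self _)
  have inj : Set.InjOn z (Finset.range (m + 2)) := by
    intro l hl j hj h
    by_contra hne
    have := sep l hl j hj (Ne.symm hne)
    rw [h, sub_self, abs_zero] at this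
    linarith
  set om : ℕ → ℝ := fun l => 1 / ∏ j ∈ (Finset.range (m + 2)).erase l, (z l - z j) with hom
  have omb : ∀ l ∈ Finset.range (m + 2), |om l| ≤ 1 / g ^ (m + 1) := by
    intro l hl
    rw [hom]; simp only
    rw [abs_div, abs_one, Finset.abs_prod]
    apply one_div_le_one_div_of_le (by positivity)
    have : ∏ j ∈ (Finset.range (m + 2)).erase l, g ≤ ∏ j ∈ (Finset.range (m + 2)).erase l, |z l - z j| :=
      Finset.prod_le_prod (fun _ _ => hg.le) (fun j hj => sep l hl j (Finset.mem_of_mem_erase hj) (Finset.ne_of_mem_erase hj))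
    rwa [Finset.prod_const, Finset.card_erase_of_mem hl, Finset.card_range] at this
  have dd : ∀ (P : Polynomial ℝ), P.natDegree ≤ m + 1 → ∑ l ∈ Finset.range (m + 2), om l * P.eval (z l) = P.coeff (m + 1) := by
    intro P hP
    have h1 : P.degree < ((Finset.range (m + 2)).card : WithBot ℕ) := by
      rw [Finset.card_range]
      refine lt_of_le_of_lt Polynomial.degree_le_natDegree ?_
      exact_mod_cast Nat.lt_succ_of_le hP
    have h2 := Lagrange.coeff_eq_sum inj h1
    rw [Finset.card_range] at h2
    rw [show m + 1 = m + 2 - 1 from rfl, h2]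
    refine Finset.sum_congr rfl fun l _ => ?_
    rw [hom]; simp only; ring
  have d0 : ∀ q, ∑ l ∈ Finset.range (m + 2), om l * (q - z l) ^ m = 0 := by
    intro q
    have hd : ((Polynomial.C q - Polynomial.X) ^ m : Polynomial ℝ).natDegree ≤ m := by
      refine Polynomial.natDegree_pow_le.trans ?_
      have : (Polynomial.C q - Polynomial.X : Polynomial ℝ).natDegree ≤ 1 := by compute_degree
      nlinarith
    have := dd ((Polynomial.C q - Polynomial.X) ^ m) (by omega)
    rw [Polynomial.coeff_eq_zero_of_natDegree_lt (by omega)] at this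
    simpa using this
  have d1 : ∀ q, ∑ l ∈ Finset.range (m + 2), om l * (q - z l) ^ (m + 1) = (-1) ^ (m + 1) := by
    intro q
    have hd : ((Polynomial.C q - Polynomial.X) ^ (m + 1) : Polynomial ℝ).natDegree ≤ m + 1 := by
      refine Polynomial.natDegree_pow_le.trans ?_
      have : (Polynomial.C q - Polynomial.X : Polynomial ℝ).natDegree ≤ 1 := by compute_degree
      nlinarith
    have := dd ((Polynomial.C q - Polynomial.X) ^ (m + 1)) hd
    rw [show (Polynomial.C q - Polynomial.X : Polynomial ℝ) = Polynomial.C (-1) * (Polynomial.X - Polynomial.C q) by simp,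
      mul_pow, ← Polynomial.C_pow, Polynomial.coeff_C_mul] at this
    have h3 := (Polynomial.monic_X_sub_C q).pow (m + 1)
    have h4 : ((Polynomial.X - Polynomial.C q) ^ (m + 1) : Polynomial ℝ).coeff (m + 1) = 1 := by
      have := h3.coeff_natDegree
      rwa [Polynomial.natDegree_pow, Polynomial.natDegree_X_sub_C, mul_one] at this
    rw [h4, mul_one] at this
    rw [← this]
    refine Finset.sum_congr rfl fun l _ => ?_
    simp [← mul_pow]
  set s : ℝ := (-1) ^ (m + 1) * (m + 1) with hs
  have sabs : |s| = m + 1 := by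
    rw [hs, abs_mul, abs_pow, abs_neg, abs_one, one_pow, one_mul, abs_of_pos (by positivity)]
  refine ⟨fun l => s * om l, ?_, ?_, ?_, ?_⟩
  · intro y hy
    refine Finset.sum_eq_zero fun l hl => ?_
    rw [tpw_of_lt (lt_of_lt_of_le hy (mono0 l (by rw [Finset.mem_range] at hl; omega))), mul_zero]
  · intro y hy
    have := d0 y
    calc _ = s * ∑ l ∈ Finset.range (m + 2), om l * (y - z l) ^ m := by
            rw [Finset.mul_sum]
            refine Finset.sum_congr rfl fun l hl => ?_
            rw [tpw_of_le ((monoE l (by rw [Finset.mem_range] at hl; omega)).trans hy)]; ring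
      _ = 0 := by rw [this, mul_zero]
  · intro y hy
    refine (Finset.abs_sum_le_sum_abs _ _).trans ?_
    refine (Finset.sum_le_card_nsmul _ _ ((m + 1) / g ^ (m + 1) * L ^ m) ?_).trans ?_
    · intro l hl
      rw [abs_mul, abs_mul, sabs]
      have h1 := omb l hl
      have h2 : |tpw m (z l) y| ≤ L ^ m := by
        unfold tpw
        split_ifs with h
        · rw [abs_pow, abs_of_nonneg (by linarith)]
          apply pow_le_pow_left₀ (by linarith)
          have := mono0 l (by rw [Finset.mem_range] at hl; omega)
          linarith
        · simp; positivity
      calc _ ≤ (m + 1) * (1 / g ^ (m + 1)) * L ^ m := by gcongr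
        _ = _ := by ring
    · rw [Finset.card_range, nsmul_eq_mul]; push_cast; exact le_rfl
  · intro q hq hz0 hzq
    have hW := W.sum (Finset.range (m + 2)) (fun l _ => (tpw_W m (z l)).smul (s * om l))
    rw [hW.int_ab hz0 hq]
    have e0 : ∑ l ∈ Finset.range (m + 2), s * om l * (tpw (m + 1) (z l) (z 0) / (m + 1)) = 0 := by
      refine Finset.sum_eq_zero fun l hl => ?_
      rw [tpw_of_ge (mono0 l (by rw [Finset.mem_range] at hl; omega))]; simp
    rw [e0, sub_zero]
    have hm : ((m : ℝ) + 1) ≠ 0 := by positivity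
    calc _ = s / (m + 1) * ∑ l ∈ Finset.range (m + 2), om l * (q - z l) ^ (m + 1) := by
            rw [Finset.mul_sum]
            refine Finset.sum_congr rfl fun l hl => ?_
            rw [tpw_of_le ((monoE l (by rw [Finset.mem_range] at hl; omega)).trans hzq)]; ring
      _ = 1 := by
        rw [d1, hs]
        field_simp
        rw [← pow_mul, mul_comm, pow_mul]; simp

end SW
end

noncomputable section
open Set
namespace SW
open MeasureTheory Filter Topology
open intervalIntegral hiding integral_const_mul

/-- a coarse grid, each cell of which contains at least `Q` cells of the fine grid -/
structure Blk (N : ℕ) (x : ℕ → ℝ) (h γ : ℝ) (Q B : ℕ) (Y : ℕ → ℝ) : Prop where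
  h0 : 0 < h
  g0 : 0 < γ
  Y0 : Y 0 = 0
  YB : Y B = 1
  mono : ∀ b < B, Y b ≤ Y (b + 1)
  len : ∀ b < B, Y (b + 1) - Y b ≤ 2 * Q * h
  knot : ∀ b ≤ B, ∃ i ≤ N, Y b = x i
  node : ∀ b < B, ∃ i, i + Q ≤ N ∧ Y b = x i ∧ (∀ l ≤ Q, x (i + l) ≤ Y (b + 1)) ∧
    ∀ l < Q, h ≤ γ * (x (i + l + 1) - x (i + l))

lemma int_congr_Ioo' {f g : ℝ → ℝ} {a b : ℝ} (hab : a ≤ b) (h : ∀ y ∈ Ioo a b, f y = g y) :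
    ∫ y in a..b, f y = ∫ y in a..b, g y := by
  rw [integral_of_le hab, integral_of_le hab, ← setIntegral_congr_set Ioo_ae_eq_Ioc,
    ← setIntegral_congr_set Ioo_ae_eq_Ioc]
  exact setIntegral_congr_fun measurableSet_Ioo h

lemma loc_cs {g : ℝ → ℝ} (hg : BL g) {a b : ℝ} (ha : a ∈ I) (hb : b ∈ I) (hab : a ≤ b) :
    (∫ y in a..b, |g y|) ^ 2 ≤ (b - a) * ∫ y in a..b, g y ^ 2 := by
  rcases hab.eq_or_lt with rfl | hlt
  · simp
  set A := ∫ y in a..b, |g y|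
  set G := ∫ y in a..b, g y ^ 2
  have key : ∀ s : ℝ, 0 ≤ G - 2 * s * A + s ^ 2 * (b - a) := by
    intro s
    have : ∫ y in a..b, (|g y| - s) ^ 2 = G - 2 * s * A + s ^ 2 * (b - a) := by
      have e : ∀ y, (|g y| - s) ^ 2 = (g y ^ 2 - (2 * s) * |g y|) + s ^ 2 := by
        intro y; rw [sub_sq, sq_abs]; ring
      simp only [e]
      rw [integral_add ((hg.sq.sub (hg.abs.smul _)).ii' ha hb) ((BL.const _).ii' ha hb),
        integral_sub (hg.sq.ii' ha hb) ((hg.abs.smul _).ii' ha hb), intervalIntegral.integral_const_mul]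
      simp [A, G]; ring
    rw [← this]
    exact integral_nonneg hab fun _ _ => sq_nonneg _
  have h1 := key (A / (b - a))
  have h2 : 0 < b - a := by linarith
  have h3 : G - 2 * (A / (b - a)) * A + (A / (b - a)) ^ 2 * (b - a) = G - A ^ 2 / (b - a) := by
    field_simp; ring
  rw [h3, sub_nonneg, div_le_iff₀ h2] at h1
  linarith

namespace Blk
variable {N : ℕ} {x : ℕ → ℝ} {h γ : ℝ} {Q B : ℕ} {Y : ℕ → ℝ}

lemma mono' (k : Blk N x h γ Q B Y) {b b' : ℕ} (hb : b ≤ b') (hB : b' ≤ B) : Y b ≤ Y b' := by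
  induction b', hb using Nat.le_induction with
  | base => exact le_rfl
  | succ n hn ih => exact (ih (by omega)).trans (k.mono n (by omega))

lemma memI (k : Blk N x h γ Q B Y) {b : ℕ} (hb : b ≤ B) : Y b ∈ I := by
  constructor
  · rw [← k.Y0]; exact k.mono' (Nat.zero_le _) hb
  · rw [← k.YB]; exact k.mono' hb le_rfl

lemma local_sum (k : Blk N x h γ Q B Y) {F : ℕ → ℝ → ℝ} (h1 : ∀ b < B, ∀ y < Y b, F b y = 0)
    (h2 : ∀ b < B, ∀ y, Y (b + 1) ≤ y → F b y = 0) {b : ℕ} (hb : b < B) {y : ℝ}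
    (hy : y ∈ Ico (Y b) (Y (b + 1))) : ∑ b' ∈ Finset.range B, F b' y = F b y := by
  refine Finset.sum_eq_single b ?_ (fun hn => absurd (Finset.mem_range.2 hb) hn)
  intro b' hb' hne
  rw [Finset.mem_range] at hb'
  rcases lt_or_gt_of_ne hne with hlt | hlt
  · exact h2 b' hb' y ((k.mono' (Nat.succ_le_of_lt hlt) hb.le).trans hy.1)
  · exact h1 b' hb' y (lt_of_lt_of_le hy.2 (k.mono' (Nat.succ_le_of_lt hlt) hb'.le))

lemma bound (k : Blk N x h γ Q B Y) {e g : ℝ → ℝ} (he : BL e) (hg : BL g) {c : ℝ} (hc : 0 ≤ c)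
    (H : ∀ b < B, ∀ y ∈ Ico (Y b) (Y (b + 1)), |e y| ≤ c * ∫ t in Y b..Y (b + 1), |g t|) :
    nrm e ≤ c * (2 * Q * h) * nrm g := by
  have hh := k.h0
  apply nrm_le_of_sq (by have := nrm_nonneg g; positivity)
  rw [mul_pow, nrm_sq]
  have s1 := sum_integral_adjacent_intervals (f := fun y => e y ^ 2) (a := Y) (n := B) (μ := volume)
    (fun b hb => he.sq.ii' (k.memI (by omega)) (k.memI (by omega)))
  have s2 := sum_integral_adjacent_intervals (f := fun y => g y ^ 2) (a := Y) (n := B) (μ := volume)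
    (fun b hb => hg.sq.ii' (k.memI (by omega)) (k.memI (by omega)))
  rw [k.Y0, k.YB] at s1 s2
  rw [← s1, ← s2, Finset.mul_sum]
  refine Finset.sum_le_sum fun b hb => ?_
  rw [Finset.mem_range] at hb
  have mb := k.memI hb.le
  have mb1 := k.memI (b := b + 1) hb
  have hle := k.mono b hb
  set A := ∫ t in Y b..Y (b + 1), |g t|
  have cs := loc_cs hg mb mb1 hle
  have hl := k.len b hb
  have hG : 0 ≤ ∫ t in Y b..Y (b + 1), g t ^ 2 := integral_nonneg hle fun _ _ => sq_nonneg _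
  have i1 : ∫ t in Y b..Y (b + 1), e t ^ 2 ≤ ∫ t in Y b..Y (b + 1), (c * A) ^ 2 := by
    apply integral_mono_on_of_le_Ioo hle (he.sq.ii' mb mb1) ((BL.const _).ii' mb mb1)
    intro y hy
    rw [← sq_abs]
    exact pow_le_pow_left₀ (abs_nonneg _) (H b hb y (Ioo_subset_Ico_self hy)) 2
  refine i1.trans ?_
  rw [intervalIntegral.integral_const, smul_eq_mul]
  set G := ∫ t in Y b..Y (b + 1), g t ^ 2
  set L := Y (b + 1) - Y b
  have hL : 0 ≤ L := sub_nonneg.2 hle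
  calc L * (c * A) ^ 2 = L * c ^ 2 * A ^ 2 := by ring
    _ ≤ L * c ^ 2 * (L * G) := by gcongr
    _ = c ^ 2 * L ^ 2 * G := by ring
    _ ≤ c ^ 2 * (2 * Q * h) ^ 2 * G := by gcongr
    _ = _ := by ring

/-- bump size -/
def c1 (m Q : ℕ) (γ : ℝ) : ℝ := (m + 2) * ((m + 1) * γ ^ (m + 1) * (2 * Q) ^ m)

lemma bumps (k : Blk N x h γ Q B Y) {m : ℕ} (hm : m + 1 ≤ Q) {b : ℕ} (hb : b < B) :
    ∃ F : ℝ → ℝ, Spl m N x F ∧ (∀ y < Y b, F y = 0) ∧ (∀ y, Y (b + 1) ≤ y → F y = 0) ∧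
      (∀ y ∈ Ico (Y b) (Y (b + 1)), |F y| ≤ c1 m Q γ / h) ∧ ∫ y in Y b..Y (b + 1), F y = 1 := by
  obtain ⟨i, hiQ, hY, hl, hgap⟩ := k.node b hb
  have h0 := k.h0
  have g0 := k.g0
  obtain ⟨w, w1, w2, w3, w4⟩ := bump m (z := fun l => x (i + l)) (g := h / γ) (L := 2 * Q * h) (by positivity) (by positivity)
    (fun l hl => by
      rw [div_le_iff₀ k.g0, mul_comm]
      exact hgap l (by omega))
  simp only [add_zero, ← hY] at w1 w2 w3 w4
  refine ⟨fun y => ∑ l ∈ Finset.range (m + 2), w l * tpw m (x (i + l)) y, ?_, w1, ?_, ?_, ?_⟩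
  · refine Spl.sum _ fun l hl => (Spl.tpw ?_).smul _
    rw [Finset.mem_range] at hl
    omega
  · intro y hy
    exact w2 y ((hl (m + 1) hm).trans hy)
  · intro y hy
    refine (w3 y (by have := k.len b hb; linarith [hy.2])).trans (le_of_eq ?_)
    unfold c1
    rw [div_pow, mul_pow]
    field_simp
    ring
  · exact w4 _ (k.memI hb) (k.memI hb.le) (hl (m + 1) hm)

/-- stability constant -/
def c2 (m Q : ℕ) (γ : ℝ) : ℝ := 1 + c1 m Q γ * (2 * Q)

lemma c1_nonneg {m Q : ℕ} {γ : ℝ} (hγ : 0 < γ) : 0 ≤ c1 m Q γ := by unfold c1; positivity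
lemma c2_nonneg {m Q : ℕ} {γ : ℝ} (hγ : 0 < γ) : 0 ≤ c2 m Q γ := by
  have := c1_nonneg (m := m) (Q := Q) hγ
  unfold c2; positivity

lemma step (k : Blk N x h γ Q B Y) {m : ℕ} (hm : m + 1 ≤ Q) {G g φ : ℝ → ℝ} (hG : D G g) (hφ : Spl m N x φ) :
    ∃ Φ φ' : ℝ → ℝ, Spl (m + 1) N x Φ ∧ W Φ φ' ∧ Φ 0 = G 0 ∧ Φ 1 = G 1 ∧
      nrm (fun y => G y - Φ y) ≤ c2 m Q γ * (2 * Q * h) * nrm (fun y => g y - φ y) ∧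
      nrm (fun y => g y - φ' y) ≤ c2 m Q γ * nrm (fun y => g y - φ y) := by
  have h0 := k.h0
  have hc1 := c1_nonneg (m := m) (Q := Q) k.g0
  have hc2 := c2_nonneg (m := m) (Q := Q) k.g0
  have ex : ∀ b, ∃ F : ℝ → ℝ, b < B → Spl m N x F ∧ (∀ y < Y b, F y = 0) ∧ (∀ y, Y (b + 1) ≤ y → F y = 0) ∧
      (∀ y ∈ Ico (Y b) (Y (b + 1)), |F y| ≤ c1 m Q γ / h) ∧ ∫ y in Y b..Y (b + 1), F y = 1 := by
    intro b
    by_cases hb : b < B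
    · obtain ⟨F, hF⟩ := k.bumps hm hb
      exact ⟨F, fun _ => hF⟩
    · exact ⟨0, fun h => absurd h hb⟩
  choose F hF using ex
  set e : ℝ → ℝ := fun y => g y - φ y with he
  have ble : BL e := (BL.of_cont hG.2).sub hφ.bl
  set c : ℕ → ℝ := fun b => ∫ y in Y b..Y (b + 1), e y with hc
  set S : ℝ → ℝ := fun y => ∑ b ∈ Finset.range B, c b * F b y with hS
  have splS : Spl m N x S := Spl.sum _ fun b hb => (hF b (Finset.mem_range.1 hb)).1.smul _
  have locS : ∀ b < B, ∀ y ∈ Ico (Y b) (Y (b + 1)), S y = c b * F b y := by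
    intro b hb y hy
    refine k.local_sum (F := fun b y => c b * F b y) ?_ ?_ hb hy
    · intro b hb y hy; rw [(hF b hb).2.1 y hy, mul_zero]
    · intro b hb y hy; rw [(hF b hb).2.2.1 y hy, mul_zero]
  have cb : ∀ b < B, |c b| ≤ ∫ t in Y b..Y (b + 1), |e t| := fun b hb =>
    abs_integral_le_integral_abs (k.mono b hb)
  have bS : ∀ b < B, ∀ y ∈ Ico (Y b) (Y (b + 1)), |S y| ≤ c1 m Q γ / h * ∫ t in Y b..Y (b + 1), |e t| := by
    intro b hb y hy
    rw [locS b hb y hy, abs_mul, mul_comm]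
    exact mul_le_mul ((hF b hb).2.2.2.1 y hy) (cb b hb) (abs_nonneg _) (by positivity)
  have splφ : Spl m N x (fun y => φ y + S y) := hφ.add splS
  obtain ⟨Φ, hΦ, hΦ0, hΦW⟩ := splφ.int (G 0)
  have hE : W (fun y => G y - Φ y) (fun y => g y - (φ y + S y)) := hG.toW.sub hΦW
  have hz : ∀ b ≤ B, G (Y b) - Φ (Y b) = 0 := by
    intro b
    induction b with
    | zero => intro _; rw [k.Y0, hΦ0, sub_self]
    | succ b ih =>
      intro hb
      have hb' : b < B := hb
      have i1 := hE.int_ab (k.memI hb'.le) (k.memI hb)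
      have i2 : ∫ y in Y b..Y (b + 1), (g y - (φ y + S y)) = 0 := by
        have : ∫ y in Y b..Y (b + 1), (g y - (φ y + S y)) = ∫ y in Y b..Y (b + 1), (e y - c b * F b y) := by
          refine int_congr_Ioo' (k.mono b hb') fun y hy => ?_
          rw [locS b hb' y (Ioo_subset_Ico_self hy), he]; ring
        rw [this, integral_sub (ble.ii' (k.memI hb'.le) (k.memI hb))
          (((hF b hb').1.bl.smul _).ii' (k.memI hb'.le) (k.memI hb)), intervalIntegral.integral_const_mul,
          (hF b hb').2.2.2.2, mul_one, hc]
        simp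
      rw [i2] at i1
      linarith [ih hb'.le]
  refine ⟨Φ, _, hΦ, hΦW, hΦ0, ?_, ?_, ?_⟩
  · have := hz B le_rfl
    rw [k.YB] at this; linarith
  · refine k.bound hE.bl ble hc2 ?_
    intro b hb y hy
    have mb := k.memI hb.le
    have mb1 := k.memI (b := b + 1) hb
    have a1 := hE.abs_sub_le mb mb1 (Ico_subset_Icc_self hy)
    simp only [hz b hb.le, sub_zero] at a1
    refine a1.trans ?_
    set A := ∫ t in Y b..Y (b + 1), |e t| with hA
    have hA0 : 0 ≤ A := integral_nonneg (k.mono b hb) fun _ _ => abs_nonneg _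
    have a2 : ∫ t in Y b..Y (b + 1), |g t - (φ t + S t)| ≤ ∫ t in Y b..Y (b + 1), (|e t| + c1 m Q γ / h * A) := by
      refine integral_mono_on_of_le_Ioo (k.mono b hb) (hE.2.1.abs.ii' mb mb1) ((ble.abs.add (BL.const _)).ii' mb mb1) ?_
      intro t ht
      have := bS b hb t (Ioo_subset_Ico_self ht)
      have e1 : g t - (φ t + S t) = e t - S t := by rw [he]; ring
      rw [e1]
      exact (abs_sub _ _).trans (by linarith)
    refine a2.trans ?_
    rw [integral_add (ble.abs.ii' mb mb1) ((BL.const _).ii' mb mb1), intervalIntegral.integral_const, smul_eq_mul, ← hA]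
    have hl := k.len b hb
    have : (Y (b + 1) - Y b) * (c1 m Q γ / h * A) ≤ (2 * Q * h) * (c1 m Q γ / h * A) :=
      mul_le_mul_of_nonneg_right hl (by positivity)
    have e2 : (2 * Q * h) * (c1 m Q γ / h * A) = c1 m Q γ * (2 * Q) * A := by field_simp
    unfold c2
    linarith
  · have n1 : nrm (fun y => g y - (φ y + S y)) ≤ nrm e + nrm S := by
      have := ble.nrm_sub splS.bl
      refine le_trans (le_of_eq ?_) this
      congr 1; funext y; rw [he]; ring
    have n2 := k.bound splS.bl ble (c := c1 m Q γ / h) (by positivity) bS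
    have e2 : c1 m Q γ / h * (2 * Q * h) = c1 m Q γ * (2 * Q) := by field_simp
    rw [e2] at n2
    unfold c2
    linarith

end Blk

lemma approx0 {Q : ℕ} {γ : ℝ} (m : ℕ) (hm : m ≤ Q) : ∃ C, 0 ≤ C ∧ ∀ N x h B Y, Blk N x h γ Q B Y → 
    ∀ g : ℕ → ℝ → ℝ, (∀ j ≤ m, D (g j) (g (j + 1))) →
    ∃ φ, Spl m N x φ ∧ nrm (fun y => g 0 y - φ y) ≤ C * h ^ (m + 1) * nrm (g (m + 1)) := by
  induction m with
  | zero =>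
    refine ⟨2 * Q, by positivity, fun N x h B Y k g hg => ?_⟩
    set φ : ℝ → ℝ := fun y => ∑ b ∈ Finset.range B, g 0 (Y b) * (tpw 0 (Y b) y + (-1) * tpw 0 (Y (b + 1)) y) with hφ
    have sp : Spl 0 N x φ := by
      refine Spl.sum _ fun b hb => Spl.smul _ ?_
      rw [Finset.mem_range] at hb
      obtain ⟨i, hi, e⟩ := k.knot b hb.le
      obtain ⟨i', hi', e'⟩ := k.knot (b + 1) hb
      rw [e, e']
      exact (Spl.tpw hi).add ((Spl.tpw hi').smul (-1))
    refine ⟨φ, sp, ?_⟩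
    have hD := hg 0 le_rfl
    have := k.bound (e := fun y => g 0 y - φ y) (g := g 1) (c := 1) ((BL.of_cont hD.cont).sub sp.bl) (BL.of_cont hD.2) zero_le_one ?_
    · simpa using this
    intro b hb y hy
    have e1 : φ y = g 0 (Y b) := by
      rw [hφ]; simp only
      rw [k.local_sum (F := fun b y => g 0 (Y b) * (tpw 0 (Y b) y + (-1) * tpw 0 (Y (b + 1)) y)) ?_ ?_ hb hy]
      · rw [tpw_of_le hy.1, tpw_of_lt hy.2]; simp
      · intro b hb y hy
        rw [tpw_of_lt hy, tpw_of_lt (lt_of_lt_of_le hy (k.mono b hb))]; simp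
      · intro b hb y hy
        rw [tpw_of_le hy, tpw_of_le ((k.mono b hb).trans hy)]; simp
    rw [e1, one_mul]
    exact hD.toW.abs_sub_le (k.memI hb.le) (k.memI hb) (Ico_subset_Icc_self hy)
  | succ m ih =>
    obtain ⟨C, hC, H⟩ := ih (by omega)
    by_cases hγ : 0 < γ
    · have hc2 := Blk.c2_nonneg (m := m) (Q := Q) hγ
      refine ⟨Blk.c2 m Q γ * (2 * Q) * C, by positivity, fun N x h B Y k g hg => ?_⟩
      obtain ⟨φ, hφ, b⟩ := H N x h B Y k (fun j => g (j + 1)) (fun j hj => hg (j + 1) (by omega))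
      obtain ⟨Φ, φ', h1, -, -, -, h2, -⟩ := k.step (m := m) hm (hg 0 (by omega)) hφ
      refine ⟨Φ, h1, h2.trans ?_⟩
      have h0 := k.h0
      calc _ ≤ Blk.c2 m Q γ * (2 * Q * h) * (C * h ^ (m + 1) * nrm (g (m + 1 + 1))) := by gcongr
        _ = _ := by ring
    · exact ⟨0, le_rfl, fun N x h B Y k => absurd k.g0 hγ⟩

end SW
end

noncomputable section
open Set
namespace SW
open MeasureTheory Filter Topology
open intervalIntegral hiding integral_const_mul

lemma tpw_deriv' (m : ℕ) (z y : ℝ) : HasDerivAt (tpw (m + 2) z) ((m + 2) * tpw (m + 1) z y) y := by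
  have hc : Continuous (fun y => ((m:ℝ) + 2) * tpw (m + 1) z y) := continuous_const.mul (tpw_cont m z)
  by_cases h : y = z
  · subst h
    refine hasDerivAt_of_hasDerivAt_of_ne (g := fun s => ((m:ℝ) + 2) * tpw (m + 1) y s) (fun s hs => ?_) (tpw_cont _ _).continuousAt hc.continuousAt
    refine (tpw_deriv (m + 1) hs).congr_deriv ?_
    push_cast; ring
  · refine (tpw_deriv (m + 1) h).congr_deriv ?_
    push_cast; ring

lemma tpw_contDiff (m : ℕ) (z : ℝ) : ContDiff ℝ m (tpw (m + 1) z) := by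
  induction m with
  | zero => simpa using tpw_cont 0 z
  | succ m ih =>
    have hd : deriv (tpw (m + 2) z) = fun y => ((m:ℝ) + 2) * tpw (m + 1) z y := funext fun y => (tpw_deriv' m z y).deriv
    rw [Nat.cast_succ, contDiff_succ_iff_deriv]
    refine ⟨fun y => (tpw_deriv' m z y).differentiableAt, by simp, ?_⟩
    rw [hd]
    exact contDiff_const.mul ih

section part
variable {N : ℕ} {x : ℕ → ℝ} {h γ : ℝ}

lemma part_mono (hp : IsPartition N x) {i j : ℕ} (hij : i ≤ j) (hj : j ≤ N) : x i ≤ x j := by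
  induction j, hij using Nat.le_induction with
  | base => exact le_rfl
  | succ n hn ih => exact (ih (by omega)).trans (hp.2.2 n (by omega)).le

lemma part_mem (hp : IsPartition N x) {i : ℕ} (hi : i ≤ N) : x i ∈ I := by
  constructor
  · rw [← hp.1]; exact part_mono hp (Nat.zero_le _) hi
  · rw [← hp.2.1]; exact part_mono hp hi le_rfl

lemma part_len (hm : IsMeshSize N x h) (i l : ℕ) (hj : i + l ≤ N) : x (i + l) - x i ≤ l * h := by
  induction l with
  | zero => simp
  | succ l ih =>
    have h1 := ih (by omega)
    have h2 := hm.1 (i + l) (by omega)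
    rw [← add_assoc]; push_cast; linarith

lemma mesh_pos (hp : IsPartition N x) (hm : IsMeshSize N x h) : 0 < h := by
  obtain ⟨i, hi, e⟩ := hm.2
  have := hp.2.2 i hi
  linarith

lemma mesh_le (hp : IsPartition N x) (hm : IsMeshSize N x h) : h ≤ 1 := by
  obtain ⟨i, hi, e⟩ := hm.2
  have h1 := part_mem hp (i := i + 1) hi
  have h2 := part_mem hp hi.le
  linarith [h1.2, h2.1]

lemma part_find (hp : IsPartition N x) {y : ℝ} (hy : y ∈ Ioo (0:ℝ) 1) (hne : y ∉ range x) :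
    ∃ j < N, y ∈ Ioo (x j) (x (j + 1)) := by
  classical
  have ex : ∃ j, j ≤ N ∧ y < x j := ⟨N, le_rfl, by rw [hp.2.1]; exact hy.2⟩
  have hs := Nat.find_spec ex
  have hmin := fun m (hm : m < Nat.find ex) => Nat.find_min ex hm
  set j := Nat.find ex
  have hj0 : j ≠ 0 := by
    intro h0
    rw [h0, hp.1] at hs
    linarith [hs.2, hy.1]
  obtain ⟨i, hi⟩ := Nat.exists_eq_succ_of_ne_zero hj0
  have h1 := hmin i (by omega)
  have h2 : x i ≤ y := by
    by_contra hc
    exact h1 ⟨by omega, not_le.1 hc⟩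
  refine ⟨i, by omega, lt_of_le_of_ne h2 (fun e => hne ⟨i, e⟩), ?_⟩
  have := hs.2
  rwa [hi] at this

lemma mkBlk (hγ : 1 ≤ γ) (hp : IsPartition N x) (hm : IsMeshSize N x h) (hq : QuasiUniform N x h γ)
    {Q : ℕ} (hQ : 0 < Q) (hQN : Q ≤ N) : ∃ B Y, Blk N x h γ Q B Y := by
  have hB : 0 < N / Q := Nat.div_pos hQN hQ
  have hBQ : N / Q * Q ≤ N := Nat.div_mul_le_self N Q
  have hlt : N < (N / Q + 1) * Q := by
    have := Nat.lt_mul_div_succ N hQ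
    rw [mul_comm] at this; exact this
  have hh := mesh_pos hp hm
  generalize N / Q = B at *
  have hbq : ∀ b < B, b * Q + Q ≤ N := by
    intro b hb
    have : (b + 1) * Q ≤ B * Q := Nat.mul_le_mul_right Q hb
    nlinarith
  have hle : ∀ b < B, ∀ l ≤ Q, x (b * Q + l) ≤ (if b + 1 < B then x ((b + 1) * Q) else x N) := by
    intro b hb l hl
    split_ifs with h1
    · apply part_mono hp
      · rw [add_mul, one_mul]; omega
      · have := hbq (b + 1) h1; omega
    · apply part_mono hp _ le_rfl
      have := hbq b hb; omega
  refine ⟨B, fun b => if b < B then x (b * Q) else x N, hh, by linarith, ?_, ?_, ?_, ?_, ?_, ?_⟩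
  · simp [hB, hp.1]
  · simp [hp.2.1]
  · intro b hb
    have := hle b hb 0 (by omega)
    simpa [hb] using this
  · intro b hb
    simp only [hb, if_true]
    split_ifs with h1
    · have := part_len hm (b * Q) Q (hbq b hb)
      rw [show (b + 1) * Q = b * Q + Q by ring]
      have : (0:ℝ) ≤ Q * h := by positivity
      nlinarith
    · have e : B = b + 1 := by omega
      obtain ⟨l, hl⟩ : ∃ l, N = b * Q + l := Nat.exists_eq_add_of_le (by have := hbq b hb; omega)
      have h2 := part_len hm (b * Q) l (by omega)
      rw [← hl] at h2
      have h3 : l ≤ 2 * Q := by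
        rw [e, hl] at hlt
        nlinarith
      have h4 : (l:ℝ) ≤ 2 * Q := by exact_mod_cast h3
      exact h2.trans (mul_le_mul_of_nonneg_right h4 hh.le)
  · intro b hb
    by_cases h1 : b < B
    · exact ⟨b * Q, by have := hbq b h1; omega, by simp [h1]⟩
    · exact ⟨N, le_rfl, by simp [h1]⟩
  · intro b hb
    refine ⟨b * Q, hbq b hb, by simp [hb], hle b hb, fun l hl => hq (b * Q + l) (by have := hbq b hb; omega)⟩

lemma Spl.mem_Sh (hp : IsPartition N x) {m k : ℕ} (hk : k ≤ m) {φ : ℝ → ℝ} (hφ : Spl (m + 1) N x φ) :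
    φ ∈ Sh N (m + 2) k x := by
  obtain ⟨d, c, e⟩ := hφ
  constructor
  · have : φ = _ := funext e
    rw [this]
    apply ContDiff.contDiffOn
    apply ContDiff.add
    · fun_prop
    · apply ContDiff.sum
      intro i _
      exact contDiff_const.mul ((tpw_contDiff m (x i)).of_le (by exact_mod_cast hk))
  · intro j hj
    refine ⟨∑ i ∈ Finset.range (m + 2), Polynomial.C (d i) * Polynomial.X ^ i
      + ∑ i ∈ Finset.range (N + 1), if i ≤ j then Polynomial.C (c i) * (Polynomial.X - Polynomial.C (x i)) ^ (m + 1) else 0, ?_, ?_⟩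
    · refine (Polynomial.natDegree_add_le _ _).trans (max_le ?_ ?_)
      · refine Polynomial.natDegree_sum_le_of_forall_le _ _ fun i hi => ?_
        rw [Finset.mem_range] at hi
        exact (Polynomial.natDegree_C_mul_X_pow_le _ _).trans (by omega)
      · refine Polynomial.natDegree_sum_le_of_forall_le _ _ fun i hi => ?_
        split_ifs
        · refine (Polynomial.natDegree_C_mul_le _ _).trans ?_
          rw [Polynomial.natDegree_pow, Polynomial.natDegree_X_sub_C]; omega
        · simp
    · intro y hy
      rw [e, Polynomial.eval_add, Polynomial.eval_finsetSum, Polynomial.eval_finsetSum]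
      congr 1
      · simp
      · refine Finset.sum_congr rfl fun i hi => ?_
        rw [Finset.mem_range] at hi
        split_ifs with h1
        · rw [tpw_of_le ((part_mono hp h1 hj.le).trans hy.1)]; simp
        · rw [tpw_of_ge (hy.2.trans (part_mono hp (by omega) (by omega)))]; simp

/-- piecewise polynomials have bounded derivatives -/
lemma Sh_W {r k : ℕ} (hp : IsPartition N x) {φ : ℝ → ℝ} (hφ : φ ∈ Sh N r k x) : W φ (deriv φ) := by
  obtain ⟨hc, hpoly⟩ := hφ
  have ex : ∀ j, ∃ p : Polynomial ℝ, j < N → ∀ y ∈ Icc (x j) (x (j + 1)), φ y = p.eval y := by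
    intro j
    by_cases hj : j < N
    · obtain ⟨p, -, e⟩ := hpoly j hj
      exact ⟨p, fun _ => e⟩
    · exact ⟨0, fun h => absurd h hj⟩
  choose p hP using ex
  have hd : ∀ j < N, ∀ y ∈ Ioo (x j) (x (j + 1)), HasDerivAt φ ((p j).derivative.eval y) y := by
    intro j hj y hy
    refine ((p j).hasDerivAt y).congr_of_eventuallyEq ?_
    filter_upwards [Icc_mem_nhds hy.1 hy.2] with s hs
    exact hP j hj s hs
  have ex2 : ∀ j, ∃ K, ∀ y ∈ I, |(p j).derivative.eval y| ≤ K := by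
    intro j
    obtain ⟨K, hK⟩ := isCompact_Icc.exists_bound_of_continuousOn (s := I) (f := fun y => (p j).derivative.eval y) (by fun_prop)
    exact ⟨K, hK⟩
  choose K hK using ex2
  have K0 : ∀ j, 0 ≤ K j := fun j => (abs_nonneg _).trans (hK j 0 zero_mem)
  refine ⟨hc.continuousOn, ⟨(measurable_deriv φ).aestronglyMeasurable, ∑ j ∈ Finset.range N, K j, ?_⟩, range x, countable_range x, ?_⟩
  · filter_upwards [nu_off (countable_range x)] with y hy
    obtain ⟨j, hj, hyj⟩ := part_find hp hy.1 hy.2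
    rw [(hd j hj y hyj).deriv]
    refine (hK j y (Ioo_subset_Icc_self hy.1)).trans ?_
    exact Finset.single_le_sum (f := K) (fun i _ => K0 i) (Finset.mem_range.2 hj)
  · intro y hy
    obtain ⟨j, hj, hyj⟩ := part_find hp hy.1 hy.2
    exact (hd j hj y hyj).differentiableAt.hasDerivAt

lemma Sh_sub {r k : ℕ} {φ ψ : ℝ → ℝ} (h1 : φ ∈ Sh N r k x) (h2 : ψ ∈ Sh N r k x) :
    (fun y => φ y - ψ y) ∈ Sh N r k x := by
  refine ⟨h1.1.sub h2.1, fun j hj => ?_⟩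
  obtain ⟨p, dp, e⟩ := h1.2 j hj
  obtain ⟨q, dq, e'⟩ := h2.2 j hj
  exact ⟨p - q, (Polynomial.natDegree_sub_le _ _).trans (max_le dp dq), fun y hy => by
    show φ y - ψ y = _
    rw [e y hy, e' y hy, Polynomial.eval_sub]⟩

lemma Sh0_sub {r k : ℕ} {φ ψ : ℝ → ℝ} (h1 : φ ∈ Sh0 N r k x) (h2 : ψ ∈ Sh0 N r k x) :
    (fun y => φ y - ψ y) ∈ Sh0 N r k x :=
  ⟨Sh_sub h1.1 h2.1, by simp [h1.2.1, h2.2.1], by simp [h1.2.2, h2.2.2]⟩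

lemma zero_mem_Sh {r k : ℕ} : (fun _ => (0:ℝ)) ∈ Sh N r k x :=
  ⟨contDiffOn_const, fun j _ => ⟨0, by simp, by simp⟩⟩

end part
end SW
end

noncomputable section
open Set
namespace SW
open MeasureTheory Filter Topology
open intervalIntegral hiding integral_const_mul

lemma inv_unit (d : ℕ) : ∃ C : ℝ, 0 ≤ C ∧ ∀ p : Polynomial ℝ, p.natDegree ≤ d →
    ∫ y in (0:ℝ)..1, (p.derivative.eval y) ^ 2 ≤ C * ∫ y in (0:ℝ)..1, (p.eval y) ^ 2 := by
  set P : (Fin (d + 1) → ℝ) → Polynomial ℝ := fun c => ∑ i, Polynomial.C (c i) * Polynomial.X ^ (i : ℕ) with hP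
  have Pev : ∀ c y, (P c).eval y = ∑ i, c i * y ^ (i : ℕ) := by
    intro c y; simp [hP, Polynomial.eval_finsetSum]
  have Pdev : ∀ c y, (P c).derivative.eval y = ∑ i, c i * (((i : ℕ) : ℝ) * y ^ ((i : ℕ) - 1)) := by
    intro c y; simp [hP, Polynomial.eval_finsetSum, Polynomial.derivative_sum, Polynomial.derivative_X_pow]
  have cA : Continuous fun c => ∫ y in (0:ℝ)..1, ((P c).eval y) ^ 2 := by
    apply continuous_parametric_intervalIntegral_of_continuous'
    simp only [Pev, Function.uncurry_def]
    fun_prop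
  have cB : Continuous fun c => ∫ y in (0:ℝ)..1, ((P c).derivative.eval y) ^ 2 := by
    apply continuous_parametric_intervalIntegral_of_continuous'
    simp only [Pdev, Function.uncurry_def]
    fun_prop
  have hS : IsCompact (Metric.sphere (0 : Fin (d + 1) → ℝ) 1) := isCompact_sphere _ _
  have hne : (Metric.sphere (0 : Fin (d + 1) → ℝ) 1).Nonempty := NormedSpace.sphere_nonempty.2 zero_le_one
  obtain ⟨c0, hc0, hmin⟩ := hS.exists_isMinOn hne cA.continuousOn
  obtain ⟨c1, hc1, hmax⟩ := hS.exists_isMaxOn hne cB.continuousOn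
  set μ := ∫ y in (0:ℝ)..1, ((P c0).eval y) ^ 2 with hμd
  set K := ∫ y in (0:ℝ)..1, ((P c1).derivative.eval y) ^ 2 with hKd
  have hμ : 0 < μ := by
    have hP0 : P c0 ≠ 0 := by
      intro h
      have : c0 = 0 := by
        ext i
        have h1 : (P c0).coeff (i : ℕ) = c0 i := by
          simp only [hP, Polynomial.finsetSum_coeff, Polynomial.coeff_C_mul_X_pow]
          rw [Finset.sum_eq_single i]
          · simp
          · intro b _ hb
            rw [if_neg]
            intro e; exact hb (Fin.ext e.symm)
          · simp
        rw [← h1, h]; simp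
      rw [this] at hc0
      simp at hc0
    have hex : ∃ y ∈ Icc (0:ℝ) 1, (P c0).eval y ≠ 0 := by
      by_contra hno
      push Not at hno
      apply hP0
      apply Polynomial.eq_zero_of_infinite_isRoot
      exact (Set.Icc_infinite (zero_lt_one' ℝ)).mono fun y hy => hno y hy
    obtain ⟨y, hy, hy0⟩ := hex
    apply intervalIntegral.integral_pos zero_lt_one
    · exact ((P c0).continuous.pow 2).continuousOn
    · intro z _; exact sq_nonneg _
    · exact ⟨y, hy, by positivity⟩
  have hK : 0 ≤ K := int_nonneg fun _ _ => sq_nonneg _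
  refine ⟨K / μ, by positivity, fun p hp => ?_⟩
  set c : Fin (d + 1) → ℝ := fun i => p.coeff i with hc
  have hpc : p = P c := by
    rw [hP]
    simp only [hc]
    rw [Fin.sum_univ_eq_sum_range (fun i => Polynomial.C (p.coeff i) * Polynomial.X ^ i)]
    exact p.as_sum_range_C_mul_X_pow' (by omega)
  rw [hpc]
  by_cases h0 : c = 0
  · rw [h0]
    have : P 0 = 0 := by simp [hP]
    rw [this]; simp
  have hn : 0 < ‖c‖ := norm_pos_iff.2 h0
  set e : Fin (d + 1) → ℝ := ‖c‖⁻¹ • c with he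
  have hes : e ∈ Metric.sphere (0 : Fin (d + 1) → ℝ) 1 := by
    rw [mem_sphere_zero_iff_norm, he, norm_smul, norm_inv, norm_norm, inv_mul_cancel₀ hn.ne']
  have hce : c = ‖c‖ • e := by rw [he, smul_smul, mul_inv_cancel₀ hn.ne', one_smul]
  have s1 : ∀ y, (P c).eval y = ‖c‖ * (P e).eval y := by
    intro y
    rw [Pev, Pev, Finset.mul_sum]
    refine Finset.sum_congr rfl fun i _ => ?_
    conv_lhs => rw [hce]
    simp [mul_assoc]
  have s2 : ∀ y, (P c).derivative.eval y = ‖c‖ * (P e).derivative.eval y := by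
    intro y
    rw [Pdev, Pdev, Finset.mul_sum]
    refine Finset.sum_congr rfl fun i _ => ?_
    conv_lhs => rw [hce]
    simp [mul_assoc]
  simp only [s1, s2, mul_pow]
  rw [intervalIntegral.integral_const_mul, intervalIntegral.integral_const_mul]
  have m1 : μ ≤ ∫ y in (0:ℝ)..1, ((P e).eval y) ^ 2 := hmin hes
  have m2 : ∫ y in (0:ℝ)..1, ((P e).derivative.eval y) ^ 2 ≤ K := hmax hes
  have m3 : K ≤ K / μ * ∫ y in (0:ℝ)..1, ((P e).eval y) ^ 2 := by
    calc K = K / μ * μ := by field_simp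
      _ ≤ _ := by gcongr
  have := mul_le_mul_of_nonneg_left (m2.trans m3) (sq_nonneg ‖c‖)
  linarith

end SW
end

noncomputable section
open Set
namespace SW
open MeasureTheory Filter Topology
open intervalIntegral hiding integral_const_mul

lemma inv_scaled (d : ℕ) : ∃ C : ℝ, 0 ≤ C ∧ ∀ p : Polynomial ℝ, p.natDegree ≤ d → ∀ a b : ℝ, a < b →
    (b - a) ^ 2 * ∫ y in a..b, (p.derivative.eval y) ^ 2 ≤ C * ∫ y in a..b, (p.eval y) ^ 2 := by
  obtain ⟨C, C0, hC⟩ := inv_unit d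
  refine ⟨C, C0, fun p hp a b hab => ?_⟩
  have hc : 0 < b - a := by linarith
  set q : Polynomial ℝ := p.comp (Polynomial.C a + Polynomial.C (b - a) * Polynomial.X) with hq
  have hl : (Polynomial.C a + Polynomial.C (b - a) * Polynomial.X).natDegree ≤ 1 := by
    compute_degree
  have hqd : q.natDegree ≤ d := by
    rw [hq]
    refine Polynomial.natDegree_comp_le.trans ?_
    calc p.natDegree * _ ≤ p.natDegree * 1 := by gcongr
      _ ≤ d := by omega
  have e1 : ∀ y, q.eval y = p.eval (a + (b - a) * y) := by intro y; simp [hq]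
  have e2 : ∀ y, q.derivative.eval y = (b - a) * p.derivative.eval (a + (b - a) * y) := by
    intro y; rw [hq, Polynomial.derivative_comp]; simp
  have key := hC q hqd
  simp only [e1, e2, mul_pow] at key
  rw [intervalIntegral.integral_const_mul,
    intervalIntegral.integral_comp_add_mul (fun y => (p.derivative.eval y) ^ 2) hc.ne',
    intervalIntegral.integral_comp_add_mul (fun y => (p.eval y) ^ 2) hc.ne'] at key
  have ha : a + (b - a) * 0 = a := by ring
  have hb : a + (b - a) * 1 = b := by ring
  rw [ha, hb, smul_eq_mul, smul_eq_mul] at key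
  have := mul_le_mul_of_nonneg_left key hc.le
  calc _ = (b - a) * ((b - a) ^ 2 * ((b - a)⁻¹ * ∫ y in a..b, (p.derivative.eval y) ^ 2)) := by field_simp
    _ ≤ _ := this
    _ = _ := by field_simp

lemma inv_glob (r k : ℕ) {γ : ℝ} (hγ : 1 ≤ γ) : ∃ C : ℝ, 0 ≤ C ∧ ∀ N x h, IsPartition N x → IsMeshSize N x h →
    QuasiUniform N x h γ → ∀ ψ ∈ Sh N r k x, h * nrm (deriv ψ) ≤ C * nrm ψ := by
  obtain ⟨C, C0, hC⟩ := inv_scaled (r - 1)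
  refine ⟨√(γ ^ 2 * C), Real.sqrt_nonneg _, fun N x h hp hm hq ψ hψ => ?_⟩
  have h0 := mesh_pos hp hm
  have hW := Sh_W hp hψ
  have hn := nrm_nonneg ψ
  have hs : h ^ 2 * ∫ y in (0:ℝ)..1, deriv ψ y ^ 2 ≤ γ ^ 2 * C * ∫ y in (0:ℝ)..1, ψ y ^ 2 := by
    have s1 := sum_integral_adjacent_intervals (f := fun y => deriv ψ y ^ 2) (μ := volume) (a := x) (n := N)
      (fun j hj => hW.2.1.sq.ii' (part_mem hp hj.le) (part_mem hp hj))
    have s2 := sum_integral_adjacent_intervals (f := fun y => ψ y ^ 2) (μ := volume) (a := x) (n := N)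
      (fun j hj => hW.bl.sq.ii' (part_mem hp hj.le) (part_mem hp hj))
    rw [hp.1, hp.2.1] at s1 s2
    rw [← s1, ← s2, Finset.mul_sum, Finset.mul_sum]
    refine Finset.sum_le_sum fun j hj => ?_
    have hj := Finset.mem_range.1 hj
    have hlt := hp.2.2 j hj
    obtain ⟨p, dp, e⟩ := hψ.2 j hj
    have a1 : ∫ y in x j..x (j + 1), deriv ψ y ^ 2 = ∫ y in x j..x (j + 1), (p.derivative.eval y) ^ 2 := by
      refine int_congr_Ioo' hlt.le fun y hy => ?_
      have : deriv ψ y = p.derivative.eval y := by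
        have he : ψ =ᶠ[𝓝 y] fun z => p.eval z := by
          filter_upwards [Icc_mem_nhds hy.1 hy.2] with z hz
          exact e z hz
        rw [he.deriv_eq, Polynomial.deriv]
      rw [this]
    have a2 : ∫ y in x j..x (j + 1), ψ y ^ 2 = ∫ y in x j..x (j + 1), (p.eval y) ^ 2 := by
      refine int_congr_Ioo' hlt.le fun y hy => ?_
      rw [e y (Ioo_subset_Icc_self hy)]
    rw [a1, a2]
    have hh : h ^ 2 ≤ γ ^ 2 * (x (j + 1) - x j) ^ 2 := by
      rw [← mul_pow]; exact pow_le_pow_left₀ h0.le (hq j hj) 2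
    have nn : 0 ≤ ∫ y in x j..x (j + 1), (p.derivative.eval y) ^ 2 :=
      intervalIntegral.integral_nonneg hlt.le fun _ _ => sq_nonneg _
    calc _ ≤ γ ^ 2 * (x (j + 1) - x j) ^ 2 * ∫ y in x j..x (j + 1), (p.derivative.eval y) ^ 2 := by gcongr
      _ = γ ^ 2 * ((x (j + 1) - x j) ^ 2 * ∫ y in x j..x (j + 1), (p.derivative.eval y) ^ 2) := by ring
      _ ≤ γ ^ 2 * (C * ∫ y in x j..x (j + 1), (p.eval y) ^ 2) :=
        mul_le_mul_of_nonneg_left (hC p dp _ _ hlt) (sq_nonneg _)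
      _ = _ := by ring
  rw [← nrm_sq, ← nrm_sq] at hs
  refine le_of_sq_le_sq ?_ (by positivity)
  rw [mul_pow, mul_pow, Real.sq_sqrt (by positivity)]
  exact hs

lemma approx (r k : ℕ) (hr : 2 ≤ r) (hk : k ≤ r - 2) {γ : ℝ} (hγ : 1 ≤ γ) : ∃ C : ℝ, 0 ≤ C ∧ ∀ N x h,
    IsPartition N x → IsMeshSize N x h → QuasiUniform N x h γ →
    ∀ f : ℕ → ℝ → ℝ, (∀ j < r, D (f j) (f (j + 1))) → ∀ K, (∀ j ≤ r, nrm (f j) ≤ K) →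
    ∃ χ χ' : ℝ → ℝ, χ ∈ Sh N r k x ∧ (f 0 0 = 0 → f 0 1 = 0 → χ ∈ Sh0 N r k x) ∧ W χ χ' ∧
      nrm (fun y => f 0 y - χ y) ≤ C * K * h ^ r ∧ nrm (fun y => f 1 y - χ' y) ≤ C * K * h ^ (r - 1) := by
  obtain ⟨m, rfl⟩ : ∃ m, r = m + 2 := ⟨r - 2, by omega⟩
  obtain ⟨C1, C10, H⟩ := approx0 (Q := m + 1) (γ := γ) m (by omega)
  have hγ0 : 0 < γ := by linarith
  have hc2 := Blk.c2_nonneg (m := m) (Q := m + 1) hγ0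
  set c := Blk.c2 m (m + 1) γ with hcd
  set CA := c * (2 * (m + 1)) * C1 + c * C1 with hCA
  set CB : ℝ := (m + 1) ^ (m + 2) with hCB
  have CA0 : 0 ≤ CA := by positivity
  have CB0 : 0 ≤ CB := by positivity
  refine ⟨CA + CB, by positivity, fun N x h hp hm hq f hf K hK => ?_⟩
  have h0 := mesh_pos hp hm
  have h1 := mesh_le hp hm
  have K0 : 0 ≤ K := (nrm_nonneg _).trans (hK 0 (by omega))
  by_cases hN : m + 1 ≤ N
  · obtain ⟨B, Y, blk⟩ := mkBlk hγ hp hm hq (Q := m + 1) (by omega) hN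
    obtain ⟨φ, hφ, b1⟩ := H N x h B Y blk (fun j => f (j + 1)) (fun j hj => hf (j + 1) (by omega))
    obtain ⟨Φ, φ', s1, s2, s3, s4, s5, s6⟩ := blk.step (m := m) le_rfl (hf 0 (by omega)) hφ
    have b2 : nrm (fun y => f 1 y - φ y) ≤ C1 * h ^ (m + 1) * K := by
      refine b1.trans ?_
      have := hK (m + 1 + 1) (by omega)
      show C1 * h ^ (m + 1) * nrm (f (m + 1 + 1)) ≤ _
      gcongr
    have mem := s1.mem_Sh hp (k := k) (m := m) (by omega)
    refine ⟨Φ, φ', mem, fun e0 e1 => ⟨mem, by rw [s3, e0], by rw [s4, e1]⟩, s2, ?_, ?_⟩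
    · refine s5.trans ?_
      calc _ ≤ c * (2 * ((m + 1 : ℕ) : ℝ) * h) * (C1 * h ^ (m + 1) * K) := by gcongr
        _ = (c * (2 * (m + 1)) * C1) * K * h ^ (m + 2) := by push_cast; ring
        _ ≤ (CA + CB) * K * h ^ (m + 2) := by
          have : 0 ≤ c * C1 := by positivity
          gcongr; linarith
    · refine s6.trans ?_
      calc _ ≤ c * (C1 * h ^ (m + 1) * K) := by gcongr
        _ = (c * C1) * K * h ^ (m + 1) := by ring
        _ ≤ (CA + CB) * K * h ^ (m + 1) := by
          have : 0 ≤ c * (2 * (m + 1)) * C1 := by positivity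
          gcongr; linarith
  · push Not at hN
    have hl := part_len hm 0 N (by omega)
    rw [zero_add, hp.1, hp.2.1, sub_zero] at hl
    have hNr : (N : ℝ) ≤ m + 1 := by exact_mod_cast hN.le
    have hl2 : 1 ≤ (m + 1) * h := hl.trans (by gcongr)
    have p2 : 1 ≤ CB * h ^ (m + 2) := by rw [hCB, ← mul_pow]; exact one_le_pow₀ hl2
    have p1 : 1 ≤ CB * h ^ (m + 1) := p2.trans (by
      have : h ^ (m + 2) ≤ h ^ (m + 1) := pow_le_pow_of_le_one h0.le h1 (by omega)
      gcongr)
    refine ⟨fun _ => 0, fun _ => 0, zero_mem_Sh, fun _ _ => ⟨zero_mem_Sh, rfl, rfl⟩, W.const 0, ?_, ?_⟩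
    · simp only [sub_zero]
      have := hK 0 (by omega)
      calc nrm (f 0) ≤ K * 1 := by linarith
        _ ≤ K * ((CA + CB) * h ^ (m + 2)) := by
          refine mul_le_mul_of_nonneg_left (p2.trans ?_) K0
          gcongr; linarith
        _ = _ := by ring
    · simp only [sub_zero]
      have := hK 1 (by omega)
      calc nrm (f 1) ≤ K * 1 := by linarith
        _ ≤ K * ((CA + CB) * h ^ (m + 1)) := by
          refine mul_le_mul_of_nonneg_left (p1.trans ?_) K0
          gcongr; linarith
        _ = _ := by simp; ring

lemma pyth {f H χ : ℝ → ℝ} (hf : BL f) (hH : BL H) (hχ : BL χ)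
    (ho : ip (fun y => f y - H y) (fun y => H y - χ y) = 0) :
    nrm (fun y => f y - H y) ≤ nrm (fun y => f y - χ y) ∧ nrm (fun y => H y - χ y) ≤ nrm (fun y => f y - χ y) := by
  have key : nrm (fun y => f y - χ y) ^ 2 = nrm (fun y => f y - H y) ^ 2 + nrm (fun y => H y - χ y) ^ 2 := by
    rw [nrm_sq, nrm_sq, nrm_sq]
    have b1 := hf.sub hH
    have b2 := hH.sub hχ
    have e : ∀ y, (f y - χ y) ^ 2 = (f y - H y) ^ 2 + 2 * ((f y - H y) * (H y - χ y)) + (H y - χ y) ^ 2 := by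
      intro y; ring
    simp only [e]
    rw [integral_add (b1.sq.add ((b1.mul b2).smul 2)).ii b2.sq.ii,
      integral_add b1.sq.ii ((b1.mul b2).smul 2).ii, intervalIntegral.integral_const_mul]
    unfold ip at ho
    rw [ho]; ring
  constructor
  · refine le_of_sq_le_sq ?_ (nrm_nonneg _)
    rw [key]; linarith [sq_nonneg (nrm (fun y => H y - χ y))]
  · refine le_of_sq_le_sq ?_ (nrm_nonneg _)
    rw [key]; linarith [sq_nonneg (nrm (fun y => f y - H y))]

lemma proj (r k : ℕ) (hr : 2 ≤ r) (hk : k ≤ r - 2) {γ : ℝ} (hγ : 1 ≤ γ) : ∃ C : ℝ, 0 ≤ C ∧ ∀ N x h,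
    IsPartition N x → IsMeshSize N x h → QuasiUniform N x h γ →
    ∀ f : ℕ → ℝ → ℝ, (∀ j < r, D (f j) (f (j + 1))) → ∀ K, (∀ j ≤ r, nrm (f j) ≤ K) →
    ∀ H, (IsL2ProjOn (Sh N r k x) (f 0) H ∨ (f 0 0 = 0 ∧ f 0 1 = 0 ∧ IsL2ProjOn (Sh0 N r k x) (f 0) H)) →
    W H (deriv H) ∧ nrm (fun y => H y - f 0 y) ≤ C * K * h ^ (r - 1) ∧
      nrm (fun y => deriv H y - f 1 y) ≤ C * K * h ^ (r - 1) := by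
  obtain ⟨C1, C10, A⟩ := approx r k hr hk hγ
  obtain ⟨C2, C20, B⟩ := inv_glob r k hγ
  refine ⟨(C2 + 1) * C1, by positivity, fun N x h hp hm hq f hf K hK H hH => ?_⟩
  have h0 := mesh_pos hp hm
  have h1 := mesh_le hp hm
  have K0 : 0 ≤ K := (nrm_nonneg _).trans (hK 0 (by omega))
  obtain ⟨χ, χ', c1, c2, c3, c4, c5⟩ := A N x h hp hm hq f hf K hK
  have hHS : H ∈ Sh N r k x := by
    rcases hH with hH | hH
    · exact hH.1
    · exact hH.2.2.1.1
  have ho : ip (fun y => f 0 y - H y) (fun y => H y - χ y) = 0 := by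
    rcases hH with hH | hH
    · exact hH.2 _ (Sh_sub hH.1 c1)
    · exact hH.2.2.2 _ (Sh0_sub hH.2.2.1 (c2 hH.1 hH.2.1))
  have hW := Sh_W hp hHS
  have Df := hf 0 (by omega)
  have bf := Df.toW
  obtain ⟨p1, p2⟩ := pyth bf.bl hW.bl c3.bl ho
  have hhr : h ^ r = h ^ (r - 1) * h := by
    rw [← pow_succ]; congr 1; omega
  have hhr' : h ^ r ≤ h ^ (r - 1) := pow_le_pow_of_le_one h0.le h1 (by omega)
  refine ⟨hW, ?_, ?_⟩
  · have e : nrm (fun y => H y - f 0 y) = nrm (fun y => f 0 y - H y) := by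
      rw [← nrm_neg]; simp
    rw [e]
    refine (p1.trans c4).trans ?_
    gcongr
    nlinarith
  · have hS := Sh_sub hHS c1
    have inv := B N x h hp hm hq _ hS
    have WS := Sh_W hp hS
    have ed : nrm (deriv fun y => H y - χ y) = nrm (fun y => deriv H y - χ' y) :=
      nrm_congr_ae ((hW.sub c3).ae_deriv)
    rw [ed] at inv
    have i2 : nrm (fun y => deriv H y - χ' y) ≤ C2 * (C1 * K * h ^ (r - 1)) := by
      have : h * nrm (fun y => deriv H y - χ' y) ≤ h * (C2 * (C1 * K * h ^ (r - 1))) := by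
        refine inv.trans ?_
        calc _ ≤ C2 * (C1 * K * h ^ r) := by gcongr; exact p2.trans c4
          _ = _ := by rw [hhr]; ring
      exact le_of_mul_le_mul_left this h0
    have tri := (hW.2.1.sub c3.2.1).nrm_sub (bf.2.1.sub c3.2.1)
    have e : nrm (fun y => deriv H y - f 1 y) = nrm (fun y => deriv H y - χ' y - (f 1 y - χ' y)) := by
      congr 1; funext y; ring
    rw [e]
    refine (tri.trans (add_le_add i2 c5)).trans (le_of_eq ?_)
    ring

end SW
end

noncomputable section
open Set
namespace SW
open MeasureTheory Filter Topology
open intervalIntegral hiding integral_const_mul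

/-- spatial derivatives of a smooth chain -/
def sd (fs : ℕ → ℝ → ℝ → ℝ) (j : ℕ) (t : ℝ) : ℝ → ℝ := iteratedDerivWithin j (fun y => fs 0 y t) I

lemma sd_zero (fs : ℕ → ℝ → ℝ → ℝ) (t : ℝ) : sd fs 0 t = fun y => fs 0 y t := by
  funext y; simp [sd]

lemma sd_D {T : ℝ} {r : ℕ} {fs : ℕ → ℝ → ℝ → ℝ} (h : SmoothChain T r 2 fs) {t : ℝ} (ht : t ∈ Icc 0 T)
    {j : ℕ} (hj : j < r) : D (sd fs j t) (sd fs (j + 1) t) := by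
  have hc := h.2.1 0 (by norm_num) t ht
  have hu : UniqueDiffOn ℝ I := uniqueDiffOn_Icc zero_lt_one
  refine ⟨fun x hx => ?_, hc.continuousOn_iteratedDerivWithin (by exact_mod_cast hj) hu⟩
  have := (hc.differentiableOn_iteratedDerivWithin (m := j) (by exact_mod_cast hj) hu x hx).hasDerivWithinAt
  unfold sd
  rw [iteratedDerivWithin_succ]
  exact this

lemma sd_one {fs : ℕ → ℝ → ℝ → ℝ} {t x : ℝ} :
    derivWithin (fun z => fs 0 z t) (Icc (0:ℝ) 1) x = sd fs 1 t x := by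
  simp [sd, iteratedDerivWithin_one]

/-- shifted elevation -/
def sh2 (fs : ℕ → ℝ → ℝ → ℝ) (j : ℕ) (t : ℝ) : ℝ → ℝ := fun x => sd fs j t x + if j = 0 then 2 else 0

lemma pde {T : ℝ} {r : ℕ} (hr : 2 ≤ r) {ηs us : ℕ → ℝ → ℝ → ℝ} (hη : SmoothChain T r 2 ηs)
    (hu : SmoothChain T r 2 us) (hs : SSW T (ηs 0) (us 0) (ηs 1) (us 1)) {t x : ℝ} (ht : t ∈ Icc 0 T) (hx : x ∈ I) :
    ηs 1 x t + sd us 1 t x + (1/2) * (sd us 0 t x * sd ηs 1 t x + sd ηs 0 t x * sd us 1 t x) = 0 ∧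
    us 1 x t + sd ηs 1 t x + (3/2) * (sd us 0 t x * sd us 1 t x) + (1/2) * (sd ηs 0 t x * sd ηs 1 t x) = 0 := by
  obtain ⟨h1, h2⟩ := hs.1 x hx t ht
  have d1 := sd_D hη ht (j := 0) (by omega)
  have d2 := sd_D hu ht (j := 0) (by omega)
  have e := ((d1.mul d2).1 x hx).derivWithin (uniqueDiffOn_Icc zero_lt_one x hx)
  simp only [sd_zero] at e ⊢
  rw [e, sd_one] at h1
  rw [sd_one, sd_one] at h2
  exact ⟨by linarith, by linarith⟩

lemma joint {T : ℝ} {r j : ℕ} {fs : ℕ → ℝ → ℝ → ℝ} (h : SmoothChain T r 2 fs) (hj : j ≤ 2) :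
    ContinuousOn (fun p : ℝ × ℝ => fs j p.2 p.1) (Icc 0 T ×ˢ I) :=
  (h.2.2 j hj).comp (f := fun p : ℝ × ℝ => (p.2, p.1)) (by fun_prop) fun p hp => ⟨hp.2, hp.1⟩

lemma mkSol {T : ℝ} (hT : 0 < T) {r : ℕ} (hr : 2 ≤ r) {ηs us : ℕ → ℝ → ℝ → ℝ} (hη : SmoothChain T r 2 ηs)
    (hu : SmoothChain T r 2 us) (hs : SSW T (ηs 0) (us 0) (ηs 1) (us 1)) :
    Sol T r (sh2 ηs) (sd us) (fun t x => ηs 1 x t) (fun t x => us 1 x t) where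
  hT := hT
  ca := by
    intro t ht j hj
    have := (sd_D hη ht hj).add (D.const (if j = 0 then 2 else 0))
    refine this.congr (fun _ _ => rfl) fun x _ => ?_
    simp [sh2]
  cu := fun t ht j hj => sd_D hu ht hj
  ja := by
    have := (joint hη (j := 0) (by norm_num)).add (continuousOn_const (c := (2:ℝ)))
    exact this.congr fun p _ => by simp [sh2, sd_zero]
  ju := by
    have := joint hu (j := 0) (by norm_num)
    simpa [sd_zero] using this
  jav := joint hη (j := 1) (by norm_num)
  juv := joint hu (j := 1) (by norm_num)
  da := by
    intro t ht x hx
    have := (hη.1 0 (by norm_num) x hx t ht).add_const 2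
    simpa [sh2, sd_zero] using this
  du := by
    intro t ht x hx
    have := (hu.1 0 (by norm_num) x hx t ht)
    simpa [sd_zero] using this
  ea := by
    intro t ht x hx
    have := (pde hr hη hu hs ht hx).1
    simp only [sh2]
    simp
    linarith
  eu := by
    intro t ht x hx
    have := (pde hr hη hu hs ht hx).2
    simp only [sh2]
    simp
    linarith
  bd := by
    intro t ht
    have := hs.2 t ht
    simpa [sd_zero] using this

lemma bounds {T : ℝ} (hT : 0 < T) {r : ℕ} (hr : 2 ≤ r) {ηs us : ℕ → ℝ → ℝ → ℝ} (hη : SmoothChain T r 2 ηs)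
    (hu : SmoothChain T r 2 us) (hs : SSW T (ηs 0) (us 0) (ηs 1) (us 1)) :
    ∃ K, 0 ≤ K ∧ ∀ t ∈ Icc 0 T, ∀ j ≤ r, nrm (sd ηs j t) ≤ K ∧ nrm (sd us j t) ≤ K := by
  obtain ⟨K, K0, h⟩ := all_bounds (mkSol hT hr hη hu hs) hr
  refine ⟨K + 2, by linarith, fun t ht j hj => ⟨?_, by linarith [(h t ht j hj).2]⟩⟩
  have h1 := (h t ht j hj).1
  have hc : ContinuousOn (sd ηs j t) I := by
    rcases Nat.lt_or_ge j r with hj' | hj'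
    · exact (sd_D hη ht hj').cont
    · obtain ⟨i, rfl⟩ : ∃ i, j = i + 1 := ⟨j - 1, by omega⟩
      exact (sd_D hη ht (j := i) (by omega)).2
  set c : ℝ := if j = 0 then 2 else 0 with hcd
  have c2 : |c| ≤ 2 := by rw [hcd]; split_ifs <;> norm_num
  have hc' : ContinuousOn (sh2 ηs j t) I := hc.add continuousOn_const
  have h2 := nrm_sub hc' (continuousOn_const (c := c))
  have h3 : nrm (fun _ : ℝ => c) ≤ 2 := nrm_le_sup (by norm_num) continuousOn_const fun _ _ => c2
  have e : nrm (fun x => sh2 ηs j t x - c) = nrm (sd ηs j t) := by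
    congr 1; funext x; simp [sh2, hcd]
  rw [e] at h2
  linarith

lemma taylor {T B : ℝ} {f f' f'' : ℝ → ℝ} (h1 : ∀ t ∈ Icc 0 T, HasDerivWithinAt f (f' t) (Icc 0 T) t)
    (h2 : ∀ t ∈ Icc 0 T, HasDerivWithinAt f' (f'' t) (Icc 0 T) t) (hB : ∀ t ∈ Icc 0 T, |f'' t| ≤ B)
    {t s : ℝ} (ht : t ∈ Icc 0 T) (hs : s ∈ Icc 0 T) (hts : t ≤ s) :
    |f s - f t - (s - t) * f' t| ≤ B * (s - t) ^ 2 := by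
  have B0 : 0 ≤ B := (abs_nonneg _).trans (hB t ht)
  have hsub : Icc t s ⊆ Icc 0 T := Icc_subset_Icc ht.1 hs.2
  have a1 : ∀ z ∈ Icc t s, |f' z - f' t| ≤ B * (s - t) := by
    intro z hz
    have := (convex_Icc (0:ℝ) T).norm_image_sub_le_of_norm_hasDerivWithin_le (f := f') (f' := f'') (C := B) h2 hB ht (hsub hz)
    rw [Real.norm_eq_abs, Real.norm_eq_abs, abs_of_nonneg (by linarith [hz.1] : 0 ≤ z - t)] at this
    refine this.trans ?_
    gcongr; exact hz.2
  have a2 := (convex_Icc t s).norm_image_sub_le_of_norm_hasDerivWithin_le (f := fun z => f z - z * f' t)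
    (f' := fun z => f' z - 1 * f' t) (C := B * (s - t))
    (fun z hz => ((h1 z (hsub hz)).mono hsub).sub ((hasDerivWithinAt_id z _).mul_const _))
    (fun z hz => by rw [one_mul]; exact a1 z hz) (left_mem_Icc.2 hts) (right_mem_Icc.2 hts)
  rw [Real.norm_eq_abs, Real.norm_eq_abs, abs_of_nonneg (by linarith : 0 ≤ s - t)] at a2
  have e : f s - f t - (s - t) * f' t = f s - s * f' t - (f t - t * f' t) := by ring
  rw [e]
  linarith

lemma tdiff {T : ℝ} (hT : 0 < T) {r : ℕ} {fs : ℕ → ℝ → ℝ → ℝ} (h : SmoothChain T r 2 fs) :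
    ∃ B, 0 ≤ B ∧ ∀ t ∈ Icc 0 T, ∀ s ∈ Icc 0 T, t ≤ s →
      nrm (fun y => fs 0 y s - fs 0 y t - (s - t) * fs 1 y t) ≤ B * (s - t) ^ 2 := by
  obtain ⟨B, hB⟩ := (isCompact_Icc.prod isCompact_Icc).exists_bound_of_continuousOn (h.2.2 2 le_rfl)
  have hT0 : (0:ℝ) ∈ Icc 0 T := ⟨le_rfl, hT.le⟩
  have B0 : 0 ≤ B := (norm_nonneg _).trans (hB (0, 0) ⟨zero_mem, hT0⟩)
  refine ⟨B, B0, fun t ht s hs hts => ?_⟩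
  refine nrm_le_sup (by positivity) ?_ fun x hx => ?_
  · exact (((h.2.1 0 (by norm_num) s hs).continuousOn).sub ((h.2.1 0 (by norm_num) t ht).continuousOn)).sub
      (continuousOn_const.mul ((h.2.1 1 (by norm_num) t ht).continuousOn))
  · exact taylor (f := fun z => fs 0 x z) (f' := fun z => fs 1 x z) (f'' := fun z => fs 2 x z)
      (fun t ht => h.1 0 (by norm_num) x hx t ht) (fun t ht => h.1 1 (by norm_num) x hx t ht)
      (fun t ht => hB (x, t) ⟨hx, ht⟩) ht hs hts

lemma half {F F' f f' G' g' : ℝ → ℝ} {E K L : ℝ} (hF : W F F') (hf : D f f') (hG : BL G') (hg : BL g')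
    (h1 : nrm (fun y => F y - f y) ≤ E) (h2 : nrm (fun y => F' y - f' y) ≤ E)
    (h3 : nrm (fun y => G' y - g' y) ≤ E) (h4 : nrm g' ≤ K) (L0 : 0 ≤ L) (h5 : ∀ x ∈ I, |F x| ≤ L) :
    nrm (fun y => F y * G' y - f y * g' y) ≤ (L + 2 * K) * E := by
  have E0 : 0 ≤ E := (nrm_nonneg _).trans h1
  have Wd := hF.sub hf.toW
  have a1 := hF.bl.nrm_mul_le L0 (hG.sub hg) h5
  have a2 := Wd.bl.nrm_mul_le (K := E + E) (by linarith) hg fun x hx => (Wd.sup_le hx).trans (add_le_add h1 h2)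
  have a3 := (hF.bl.mul (hG.sub hg)).nrm_add (Wd.bl.mul hg)
  have e : nrm (fun y => F y * G' y - f y * g' y) = nrm (fun y => F y * (G' y - g' y) + (F y - f y) * g' y) := by
    congr 1; funext y; ring
  rw [e]
  have b1 : L * nrm (fun y => G' y - g' y) ≤ L * E := by gcongr
  have b2 : (E + E) * nrm g' ≤ (E + E) * K := by gcongr
  linarith

lemma tst {δ R : ℝ → ℝ} (hδ : BL δ) (hR : BL R) (h : ip δ δ = ip R δ) : nrm δ ≤ nrm R := by
  have h1 : nrm δ ^ 2 ≤ nrm R * nrm δ := by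
    rw [nrm_sq]
    have e : ∫ x in (0:ℝ)..1, δ x ^ 2 = ip δ δ := by unfold ip; congr 1; funext x; ring
    rw [e, h]
    exact (le_abs_self _).trans (hR.cs hδ)
  rcases (nrm_nonneg δ).eq_or_lt with h0 | h0
  · rw [← h0]; exact nrm_nonneg _
  · rw [pow_two] at h1
    exact le_of_mul_le_mul_right h1 h0

lemma ip_add {f g φ : ℝ → ℝ} (hf : BL f) (hg : BL g) (hφ : BL φ) :
    ip (fun y => f y + g y) φ = ip f φ + ip g φ := by
  unfold ip
  rw [← integral_add (hf.mul hφ).ii (hg.mul hφ).ii]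
  congr 1; funext y; ring

lemma ip_sub {f g φ : ℝ → ℝ} (hf : BL f) (hg : BL g) (hφ : BL φ) :
    ip (fun y => f y - g y) φ = ip f φ - ip g φ := by
  unfold ip
  rw [← integral_sub (hf.mul hφ).ii (hg.mul hφ).ii]
  congr 1; funext y; ring

lemma ip_smul (c : ℝ) (f φ : ℝ → ℝ) : ip (fun y => c * f y) φ = c * ip f φ := by
  unfold ip
  rw [← intervalIntegral.integral_const_mul]
  congr 1; funext y; ring

lemma ip_congr_ae {f g φ : ℝ → ℝ} (h : ∀ᵐ y ∂nu, f y = g y) : ip f φ = ip g φ := by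
  unfold ip
  apply nu_congr
  filter_upwards [h] with y hy
  rw [hy]

/-- the projection may be dropped against test functions -/
lemma proj_diff {S : Set (ℝ → ℝ)} {f g F G φ : ℝ → ℝ} (hF : IsL2ProjOn S f F) (hG : IsL2ProjOn S g G) (hφ : φ ∈ S)
    (bf : BL f) (bg : BL g) (bF : BL F) (bG : BL G) (bφ : BL φ) :
    ip (fun y => F y - G y) φ = ip (fun y => f y - g y) φ := by
  have h1 := hF.2 φ hφ
  have h2 := hG.2 φ hφ
  rw [ip_sub bf bF bφ] at h1
  rw [ip_sub bg bG bφ] at h2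
  rw [ip_sub bF bG bφ, ip_sub bf bg bφ]
  linarith

end SW
end

/-- **Consistency estimate for the explicit Euler full discretization of (SSW):**
the local truncation errors are `O(k(k + h^{r-1}))`. -/
theorem stmt_15 (r k : ℕ) (hr : 2 ≤ r) (hk : k ≤ r - 2)
    (γ T : ℝ) (hγ : 1 ≤ γ) (hT : 0 < T)
    (ηs us : ℕ → ℝ → ℝ → ℝ)
    (hηsm : SmoothChain T r 2 ηs) (husm : SmoothChain T r 2 us)
    (hsol : SSW T (ηs 0) (us 0) (ηs 1) (us 1)) :
    ∃ C : ℝ, ∀ (N : ℕ) (x : ℕ → ℝ) (h : ℝ),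
      IsPartition N x → IsMeshSize N x h → QuasiUniform N x h γ →
      ∀ (M : ℕ) (τ : ℝ), 0 < M → τ = T / M →
      ∀ Hn Un δ1 δ2 : ℕ → ℝ → ℝ,
      (∀ n ≤ M, IsL2ProjOn (Sh N r k x) (fun y => ηs 0 y ((n : ℝ) * τ)) (Hn n) ∧
          IsL2ProjOn (Sh0 N r k x) (fun y => us 0 y ((n : ℝ) * τ)) (Un n)) →
      (∀ n < M, δ1 n ∈ Sh N r k x ∧ ∀ φ ∈ Sh N r k x,
        ip (δ1 n) φ = ip (fun y => Hn (n+1) y - Hn n y) φ + τ * ip (deriv (Un n)) φ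
          + (τ/2) * ip (deriv (fun y => Hn n y * Un n y)) φ) →
      (∀ n < M, δ2 n ∈ Sh0 N r k x ∧ ∀ χ ∈ Sh0 N r k x,
        ip (δ2 n) χ = ip (fun y => Un (n+1) y - Un n y) χ + τ * ip (deriv (Hn n)) χ
          + (τ/2) * ip (fun y => Hn n y * deriv (Hn n) y) χ
          + (3*τ/2) * ip (fun y => Un n y * deriv (Un n) y) χ) →
      ∀ n < M, nrm (δ1 n) + nrm (δ2 n) ≤ C * τ * (τ + h ^ (r - 1)) := by
  obtain ⟨K, K0, hK⟩ := SW.bounds hT hr hηsm husm hsol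
  obtain ⟨B1, B10, hB1⟩ := SW.tdiff hT hηsm
  obtain ⟨B2, B20, hB2⟩ := SW.tdiff hT husm
  obtain ⟨C0, C00, hC0⟩ := SW.proj r k hr hk hγ
  set L := 2 * K + 2 * (C0 * K) with hL
  have L0 : 0 ≤ L := by positivity
  refine ⟨B1 + B2 + C0 * K * (2 + 3 * (L + 2 * K)), fun N x h hp hm hq M τ hM hτ Hn Un δ1 δ2 hproj hδ1 hδ2 n hn => ?_⟩
  have h0 := SW.mesh_pos hp hm
  have h1 := SW.mesh_le hp hm
  have hM' : (0:ℝ) < M := by exact_mod_cast hM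
  have hτ0 : 0 < τ := by rw [hτ]; positivity
  have hMT : (M:ℝ) * τ = T := by rw [hτ]; field_simp
  have tm : ∀ n ≤ M, (n:ℝ) * τ ∈ Icc (0:ℝ) T := by
    intro n hn
    have : (n:ℝ) ≤ M := by exact_mod_cast hn
    refine ⟨by positivity, ?_⟩
    rw [← hMT]; gcongr
  set t := (n:ℝ) * τ with htd
  set s := ((n + 1 : ℕ) : ℝ) * τ with hsd
  have ht : t ∈ Icc (0:ℝ) T := tm n hn.le
  have hs : s ∈ Icc (0:ℝ) T := tm (n + 1) hn
  have hst : s - t = τ := by rw [hsd, htd]; push_cast; ring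
  have hts : t ≤ s := by linarith
  set E := C0 * K * h ^ (r - 1) with hE
  have E0 : 0 ≤ E := by positivity
  have hh1 : h ^ (r - 1) ≤ 1 := pow_le_one₀ h0.le h1
  have E1 : E ≤ C0 * K := by
    rw [hE]; exact mul_le_of_le_one_right (by positivity) hh1
  have bdu : ∀ t ∈ Icc (0:ℝ) T, SW.sd us 0 t 0 = 0 ∧ SW.sd us 0 t 1 = 0 := by
    intro t ht; simpa [SW.sd_zero] using hsol.2 t ht
  -- projection facts
  have pH : ∀ n ≤ M, IsL2ProjOn (Sh N r k x) (SW.sd ηs 0 ((n:ℝ) * τ)) (Hn n) := by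
    intro n hn; rw [SW.sd_zero]; exact (hproj n hn).1
  have pU : ∀ n ≤ M, IsL2ProjOn (Sh0 N r k x) (SW.sd us 0 ((n:ℝ) * τ)) (Un n) := by
    intro n hn; rw [SW.sd_zero]; exact (hproj n hn).2
  obtain ⟨WH, H1, H2⟩ := hC0 N x h hp hm hq (fun j => SW.sd ηs j t) (fun j hj => SW.sd_D hηsm ht hj) K
    (fun j hj => (hK t ht j hj).1) (Hn n) (Or.inl (pH n hn.le))
  obtain ⟨WU, U1, U2⟩ := hC0 N x h hp hm hq (fun j => SW.sd us j t) (fun j hj => SW.sd_D husm ht hj) K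
    (fun j hj => (hK t ht j hj).2) (Un n) (Or.inr ⟨(bdu t ht).1, (bdu t ht).2, pU n hn.le⟩)
  rw [← hE] at H1 H2 U1 U2
  set H := Hn n with hHd
  set U := Un n with hUd
  have WH' := SW.Sh_W hp (pH (n + 1) hn).1
  have WU' := SW.Sh_W hp (pU (n + 1) hn).1.1
  have De := SW.sd_D hηsm ht (j := 0) (by omega)
  have Du := SW.sd_D husm ht (j := 0) (by omega)
  have De' := SW.sd_D hηsm hs (j := 0) (by omega)
  have Du' := SW.sd_D husm hs (j := 0) (by omega)
  rw [zero_add] at De Du De' Du'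
  have be := De.toW.bl
  have be1 := De.toW.2.1
  have bu := Du.toW.bl
  have bu1 := Du.toW.2.1
  have be' := De'.toW.bl
  have bu' := Du'.toW.bl
  have bH := WH.bl
  have bH1 := WH.2.1
  have bU := WU.bl
  have bU1 := WU.2.1
  -- sup bounds
  have supH : ∀ y ∈ SW.I, |H y| ≤ L := by
    intro y hy
    have a1 := (bH.sub be).nrm_add be
    have a2 := (bH1.sub be1).nrm_add be1
    simp only [sub_add_cancel] at a1 a2
    have := WH.sup_le hy
    have k1 := (hK t ht 0 (by omega)).1
    have k2 := (hK t ht 1 (by omega)).1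
    linarith
  have supU : ∀ y ∈ SW.I, |U y| ≤ L := by
    intro y hy
    have a1 := (bU.sub bu).nrm_add bu
    have a2 := (bU1.sub bu1).nrm_add bu1
    simp only [sub_add_cancel] at a1 a2
    have := WU.sup_le hy
    have k1 := (hK t ht 0 (by omega)).2
    have k2 := (hK t ht 1 (by omega)).2
    linarith
  have kE := (hK t ht 1 (by omega)).1
  have kU := (hK t ht 1 (by omega)).2
  have q1 := SW.half WH De bU1 bu1 H1 H2 U2 kU L0 supH
  have q2 := SW.half WU Du bH1 be1 U1 U2 H2 kE L0 supU
  have q3 := SW.half WH De bH1 be1 H1 H2 H2 kE L0 supH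
  have q4 := SW.half WU Du bU1 bu1 U1 U2 U2 kU L0 supU
  -- time differences
  have bηt : SW.BL (fun y => ηs 1 y t) := SW.BL.of_cont (hηsm.2.1 1 (by norm_num) t ht).continuousOn
  have but : SW.BL (fun y => us 1 y t) := SW.BL.of_cont (husm.2.1 1 (by norm_num) t ht).continuousOn
  have d1 : nrm (fun y => SW.sd ηs 0 s y - SW.sd ηs 0 t y - τ * ηs 1 y t) ≤ B1 * τ ^ 2 := by
    have := hB1 t ht s hs hts
    rw [hst] at this
    simpa only [SW.sd_zero] using this
  have d2 : nrm (fun y => SW.sd us 0 s y - SW.sd us 0 t y - τ * us 1 y t) ≤ B2 * τ ^ 2 := by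
    have := hB2 t ht s hs hts
    rw [hst] at this
    simpa only [SW.sd_zero] using this
  -- first residual
  have main1 : nrm (δ1 n) ≤ B1 * τ ^ 2 + τ * E + τ * ((L + 2 * K) * E) := by
    obtain ⟨mem, hte⟩ := hδ1 n hn
    have bδ := (SW.Sh_W hp mem).bl
    have e1 := hte _ mem
    rw [SW.proj_diff (pH (n + 1) hn) (pH n hn.le) mem be' be WH'.bl bH bδ,
      SW.ip_congr_ae (WH.mul WU).ae_deriv, ← SW.ip_smul, ← SW.ip_smul,
      ← SW.ip_add (be'.sub be) (bU1.smul τ) bδ,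
      ← SW.ip_add ((be'.sub be).add (bU1.smul τ)) (((WH.mul WU).2.1).smul (τ / 2)) bδ] at e1
    have b := SW.tst bδ (((be'.sub be).add (bU1.smul τ)).add (((WH.mul WU).2.1).smul (τ / 2))) e1
    refine b.trans ?_
    have c1 := (be'.sub be).sub (bηt.smul τ)
    have c2 := (bU1.sub bu1).smul τ
    have c3 := ((bH.mul bU1).sub (be.mul bu1)).smul (τ / 2)
    have c4 := ((bU.mul bH1).sub (bu.mul be1)).smul (τ / 2)
    have e2 := SW.nrm_congr (f := fun y => SW.sd ηs 0 s y - SW.sd ηs 0 t y + τ * deriv U y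
        + τ / 2 * (deriv H y * U y + H y * deriv U y))
      (g := fun y => SW.sd ηs 0 s y - SW.sd ηs 0 t y - τ * ηs 1 y t + τ * (deriv U y - SW.sd us 1 t y)
        + τ / 2 * (H y * deriv U y - SW.sd ηs 0 t y * SW.sd us 1 t y)
        + τ / 2 * (U y * deriv H y - SW.sd us 0 t y * SW.sd ηs 1 t y)) (fun y hy => by
          have := (SW.pde hr hηsm husm hsol ht hy).1
          linear_combination τ * this)
    rw [e2]
    have n1 := ((c1.add c2).add c3).nrm_add c4
    have n2 := (c1.add c2).nrm_add c3
    have n3 := c1.nrm_add c2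
    rw [SW.nrm_smul, abs_of_pos (by positivity)] at n1 n2 n3
    have m1 : τ * nrm (fun y => deriv U y - SW.sd us 1 t y) ≤ τ * E := by gcongr
    have m2 := mul_le_mul_of_nonneg_left q1 (by positivity : 0 ≤ τ / 2)
    have m3 := mul_le_mul_of_nonneg_left q2 (by positivity : 0 ≤ τ / 2)
    linarith
  have main2 : nrm (δ2 n) ≤ B2 * τ ^ 2 + τ * E + 2 * τ * ((L + 2 * K) * E) := by
    obtain ⟨mem, hte⟩ := hδ2 n hn
    have bδ := (SW.Sh_W hp mem.1).bl
    have e1 := hte _ mem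
    rw [SW.proj_diff (pU (n + 1) hn) (pU n hn.le) mem bu' bu WU'.bl bU bδ,
      ← SW.ip_smul, ← SW.ip_smul, ← SW.ip_smul,
      ← SW.ip_add (bu'.sub bu) (bH1.smul τ) bδ,
      ← SW.ip_add ((bu'.sub bu).add (bH1.smul τ)) ((bH.mul bH1).smul (τ / 2)) bδ,
      ← SW.ip_add (((bu'.sub bu).add (bH1.smul τ)).add ((bH.mul bH1).smul (τ / 2)))
        ((bU.mul bU1).smul (3 * τ / 2)) bδ] at e1
    have b := SW.tst bδ ((((bu'.sub bu).add (bH1.smul τ)).add ((bH.mul bH1).smul (τ / 2))).add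
        ((bU.mul bU1).smul (3 * τ / 2))) e1
    refine b.trans ?_
    have c1 := (bu'.sub bu).sub (but.smul τ)
    have c2 := (bH1.sub be1).smul τ
    have c3 := ((bH.mul bH1).sub (be.mul be1)).smul (τ / 2)
    have c4 := ((bU.mul bU1).sub (bu.mul bu1)).smul (3 * τ / 2)
    have e2 := SW.nrm_congr (f := fun y => SW.sd us 0 s y - SW.sd us 0 t y + τ * deriv H y
        + τ / 2 * (H y * deriv H y) + 3 * τ / 2 * (U y * deriv U y))
      (g := fun y => SW.sd us 0 s y - SW.sd us 0 t y - τ * us 1 y t + τ * (deriv H y - SW.sd ηs 1 t y)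
        + τ / 2 * (H y * deriv H y - SW.sd ηs 0 t y * SW.sd ηs 1 t y)
        + 3 * τ / 2 * (U y * deriv U y - SW.sd us 0 t y * SW.sd us 1 t y)) (fun y hy => by
          have := (SW.pde hr hηsm husm hsol ht hy).2
          linear_combination τ * this)
    rw [e2]
    have n1 := ((c1.add c2).add c3).nrm_add c4
    have n2 := (c1.add c2).nrm_add c3
    have n3 := c1.nrm_add c2
    rw [SW.nrm_smul, abs_of_pos (by positivity)] at n1 n2 n3
    have m1 : τ * nrm (fun y => deriv H y - SW.sd ηs 1 t y) ≤ τ * E := by gcongr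
    have m2 := mul_le_mul_of_nonneg_left q3 (by positivity : 0 ≤ τ / 2)
    have m3 := mul_le_mul_of_nonneg_left q4 (by positivity : 0 ≤ 3 * τ / 2)
    linarith
  have fin : (B1 + B2 + C0 * K * (2 + 3 * (L + 2 * K))) * τ * (τ + h ^ (r - 1)) =
      (B1 * τ ^ 2 + τ * E + τ * ((L + 2 * K) * E)) + (B2 * τ ^ 2 + τ * E + 2 * τ * ((L + 2 * K) * E))
      + ((B1 + B2) * τ * h ^ (r - 1) + C0 * K * (2 + 3 * (L + 2 * K)) * τ * τ) := by
    rw [hE]; ring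
  rw [fin]
  have : 0 ≤ (B1 + B2) * τ * h ^ (r - 1) + C0 * K * (2 + 3 * (L + 2 * K)) * τ * τ := by positivity
  linarith
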